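/- There exist absolute constants C > 0 and c > 0 such that the following holds. Let x be sufficiently large and let k be a positive integer with k ≤ (log x)^{1/5}. Then there is a prime p0 with c·log log x ≤ p0 ≤ x such that: for every ⟨P3⟩-admissible set ℒ = {L_1, …, L_k} of linear functions L_i(n) = a_i n + b_i whose coefficients satisfy 0 < a_i ≤ (log x)^{1/3}, gcd(2 p0, a_i) = 1 and 0 < b_i < x for all i, one has #{n ∈ [x, 2x] : at least k^{1/2}/C of the values L_1(n), …, L_k(n) lie in 𝒮} ≥ x · exp(−(log x)^{1/2}). -/

import Mathlib

/-- `m : ℤ` is a member of `𝒮`, the set of positive integers expressible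
as a sum of two squares. -/
def IsSumTwoSquaresZ (m : ℤ) : Prop := 0 < m ∧ ∃ u v : ℤ, m = u ^ 2 + v ^ 2

section MertensUpper
open Finset Real

lemma prod_prime_pow_dvd_factorial (n : ℕ) (S : Finset ℕ) (hS : ∀ p ∈ S, p.Prime) :
    (∏ p ∈ S, p ^ (n / p)) ∣ n.factorial := by
  apply Finset.prod_dvd_of_isRelPrime
  · intro p hp q hq hpq
    exact (Nat.coprime_iff_isRelPrime.1
      (Nat.Coprime.pow _ _ ((Nat.coprime_primes (hS p hp) (hS q hq)).2 hpq)))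
  · intro p hp
    have hpp := hS p hp
    rw [hpp.pow_dvd_factorial_iff (Nat.lt_succ_self (Nat.log p n))]
    by_cases h : p ≤ n
    · have h1 : 1 ∈ Finset.Ico 1 (Nat.log p n).succ := by
        simp only [Finset.mem_Ico, le_refl, true_and]
        have := Nat.log_pos hpp.one_lt h
        omega
      calc n / p = n / p ^ 1 := by simp
        _ ≤ _ := Finset.single_le_sum (f := fun i => n / p ^ i) (fun _ _ => Nat.zero_le _) h1
    · rw [Nat.div_eq_of_lt (by omega)]; exact Nat.zero_le _

lemma mertens_upper (L : ℝ) (S : Finset ℕ) (hL : 0 ≤ L)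
    (hS : ∀ p ∈ S, p.Prime ∧ log p ≤ L) :
    ∑ p ∈ S, log p / p ≤ 3 * L := by
  by_cases hL2 : L < log 2
  · have : S = ∅ := by
      apply Finset.eq_empty_of_forall_notMem
      intro p hp
      obtain ⟨h1, h2⟩ := hS p hp
      have : log 2 ≤ log p := log_le_log (by norm_num) (by exact_mod_cast h1.two_le)
      linarith
    subst this; simp; exact hL
  push Not at hL2
  set n : ℕ := ⌊exp L⌋₊ with hn
  have hnle : (n : ℝ) ≤ exp L := Nat.floor_le (exp_pos L).le
  have hn2 : 2 ≤ n := by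
    apply Nat.le_floor
    have := exp_le_exp.2 hL2
    rw [exp_log (by norm_num)] at this
    exact_mod_cast this
  have hn0 : (0:ℝ) < n := by positivity
  have hpn : ∀ p ∈ S, p ≤ n := by
    intro p hp
    obtain ⟨h1, h2⟩ := hS p hp
    apply Nat.le_floor
    have := exp_le_exp.2 h2
    rwa [exp_log (by exact_mod_cast h1.pos)] at this
  have hfac : ∑ p ∈ S, ((n / p : ℕ) : ℝ) * log p ≤ n * log n := by
    have h1 : (∏ p ∈ S, p ^ (n / p)) ≤ n ^ n :=
      (Nat.le_of_dvd (Nat.factorial_pos n)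
        (prod_prime_pow_dvd_factorial n S (fun p hp => (hS p hp).1))).trans (Nat.factorial_le_pow n)
    have h2 : log ((∏ p ∈ S, p ^ (n / p) : ℕ) : ℝ) ≤ log ((n ^ n : ℕ) : ℝ) := by
      apply log_le_log
      · exact_mod_cast Finset.prod_pos (fun p hp => pow_pos (hS p hp).1.pos _)
      · exact_mod_cast h1
    push_cast at h2
    rw [log_prod (fun p hp => pow_ne_zero _ (by exact_mod_cast (hS p hp).1.ne_zero)), log_pow] at h2
    simpa [log_pow] using h2
  have hθ : ∑ p ∈ S, log p ≤ log 4 * n := by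
    have h := Chebyshev.theta_le_log4_mul_x hn0.le
    refine le_trans ?_ h
    rw [Chebyshev.theta_eq_sum_Icc, Nat.floor_natCast]
    apply Finset.sum_le_sum_of_subset_of_nonneg
    · intro p hp
      simp [hpn p hp, (hS p hp).1]
    · intro p hp _
      apply log_natCast_nonneg
  have hmain : n * ∑ p ∈ S, log p / p ≤ n * log n + log 4 * n := by
    refine le_trans ?_ (add_le_add hfac hθ)
    rw [Finset.mul_sum, ← Finset.sum_add_distrib]
    apply Finset.sum_le_sum
    intro p hp
    have hp0 : (0:ℝ) < p := by exact_mod_cast (hS p hp).1.pos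
    have hlt : (n:ℝ) / p ≤ (n / p : ℕ) + 1 := by
      rw [← Nat.floor_div_eq_div (K := ℝ)]
      exact (Nat.lt_floor_add_one _).le
    have hl : 0 ≤ log p := log_natCast_nonneg p
    calc (n:ℝ) * (log p / p) = (n / p) * log p := by ring
      _ ≤ ((n / p : ℕ) + 1) * log p := by gcongr
      _ = _ := by ring
  have h3 : ∑ p ∈ S, log p / p ≤ log n + log 4 := by
    have : n * ∑ p ∈ S, log p / p ≤ n * (log n + log 4) := by linarith
    exact le_of_mul_le_mul_left this hn0
  have h4 : log n ≤ L := by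
    rw [← log_exp L]; exact log_le_log hn0 (by simpa using hnle)
  have h5 : log 4 = 2 * log 2 := by
    rw [show (4:ℝ) = 2 ^ 2 by norm_num, log_pow]; norm_num
  linarith

lemma block_sum (L M : ℝ) (S : Finset ℕ) (hL : 0 < L) (hM : 0 ≤ M)
    (hS : ∀ p ∈ S, p.Prime ∧ L ≤ log p ∧ log p ≤ M) :
    ∑ p ∈ S, (1:ℝ) / p ≤ 3 * M / L := by
  rw [le_div_iff₀ hL, Finset.sum_mul]
  refine le_trans ?_ (mertens_upper M S hM (fun p hp => ⟨(hS p hp).1, (hS p hp).2.2⟩))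
  apply Finset.sum_le_sum
  intro p hp
  rw [div_mul_eq_mul_div, one_mul]
  have := (hS p hp).2.1
  gcongr

end MertensUpper

section EulerMertens
open Finset Real Filter Topology

lemma sum_inv_sq_primes (S : Finset ℕ) (hS : ∀ p ∈ S, p.Prime) :
    ∑ p ∈ S, ((p:ℝ) ^ 2)⁻¹ ≤ 1 := by
  obtain ⟨N, hN⟩ := S.exists_nat_subset_range
  have h1 : S ⊆ Finset.Ioc 1 (N + 1) := by
    intro p hp
    have := (hS p hp).two_le
    have h2 := Finset.mem_range.1 (hN hp)
    simp; omega
  have h2 := sum_Ioc_inv_sq_le_sub (α := ℝ) (k := 1) (n := N + 1) (by norm_num) (by omega)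
  have h3 : (0:ℝ) ≤ ((N + 1 : ℕ) : ℝ)⁻¹ := by positivity
  calc _ ≤ ∑ p ∈ Finset.Ioc 1 (N + 1), ((p:ℝ) ^ 2)⁻¹ :=
        Finset.sum_le_sum_of_subset_of_nonneg h1 (fun _ _ _ => by positivity)
    _ ≤ _ := h2
    _ ≤ 1 := by push_cast at h3 ⊢; simp at h3 ⊢; linarith

/-- `n ↦ n^{-σ}` as a monoid-with-zero hom. -/
noncomputable def rpowHom (σ : ℝ) (hσ : σ ≠ 0) : ℕ →*₀ ℝ where
  toFun n := (n:ℝ) ^ (-σ)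
  map_zero' := by simp [Real.zero_rpow (neg_ne_zero.2 hσ)]
  map_one' := by simp
  map_mul' m n := by
    push_cast
    exact Real.mul_rpow (Nat.cast_nonneg _) (Nat.cast_nonneg _)

/-- `n ↦ χ₄(n) n^{-σ}` as a monoid-with-zero hom. -/
noncomputable def chiHom (σ : ℝ) (_hσ : σ ≠ 0) : ℕ →*₀ ℝ where
  toFun n := ((ZMod.χ₄ (n : ZMod 4) : ℤ) : ℝ) * (n:ℝ) ^ (-σ)
  map_zero' := by simp
  map_one' := by simp
  map_mul' m n := by
    push_cast
    rw [Real.mul_rpow (Nat.cast_nonneg _) (Nat.cast_nonneg _), map_mul]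
    push_cast; ring

lemma chi_abs_le (n : ℕ) : |((ZMod.χ₄ (n : ZMod 4) : ℤ) : ℝ)| ≤ 1 := by
  have : ∀ a : ZMod 4, |ZMod.χ₄ a| ≤ 1 := by decide
  exact_mod_cast this n

lemma summable_rpow (σ : ℝ) (hσ : 1 < σ) : Summable (fun n : ℕ => (n:ℝ) ^ (-σ)) :=
  Real.summable_nat_rpow.2 (by linarith)

lemma summable_chi (σ : ℝ) (hσ : 1 < σ) :
    Summable (fun n : ℕ => ‖((ZMod.χ₄ (n : ZMod 4) : ℤ) : ℝ) * (n:ℝ) ^ (-σ)‖) := by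
  refine Summable.of_nonneg_of_le (fun _ => norm_nonneg _) (fun n => ?_) (summable_rpow σ hσ)
  rw [norm_mul, Real.norm_eq_abs, Real.norm_eq_abs, abs_of_nonneg (by positivity : (0:ℝ) ≤ (n:ℝ) ^ (-σ))]
  have := chi_abs_le n
  have h : (0:ℝ) ≤ (n:ℝ) ^ (-σ) := by positivity
  nlinarith

lemma chi_partial (σ : ℝ) (hσ : 0 < σ) (m : ℕ) :
    ∑ n ∈ Finset.range (4 * m), ((ZMod.χ₄ (n : ZMod 4) : ℤ) : ℝ) * (n:ℝ) ^ (-σ)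
      ≤ 1 - ((4 * m + 1 : ℕ) : ℝ) ^ (-σ) := by
  induction m with
  | zero => simp
  | succ m ih =>
    rw [show 4 * (m + 1) = 4 * m + 1 + 1 + 1 + 1 by ring]
    simp only [Finset.sum_range_succ]
    have c4 : (4 : ZMod 4) = 0 := by decide
    have e0 : ZMod.χ₄ ((4 * m : ℕ) : ZMod 4) = 0 := by push_cast; rw [c4]; simp
    have e1 : ZMod.χ₄ ((4 * m + 1 : ℕ) : ZMod 4) = 1 := by push_cast; rw [c4]; simp
    have e2 : ZMod.χ₄ ((4 * m + 1 + 1 : ℕ) : ZMod 4) = 0 := by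
      push_cast; rw [c4, zero_mul]; decide
    have e3 : ZMod.χ₄ ((4 * m + 1 + 1 + 1: ℕ) : ZMod 4) = -1 := by
      push_cast; rw [c4, zero_mul]; decide
    rw [e0, e1, e2, e3]
    have hmono : ((4 * m + 1 + 1 + 1 + 1 + 1: ℕ) : ℝ) ^ (-σ) ≤ ((4 * m + 1 + 1 + 1: ℕ) : ℝ) ^ (-σ) := by
      apply Real.rpow_le_rpow_of_nonpos
      · positivity
      · push_cast; linarith
      · linarith
    simp only [Int.cast_zero, Int.cast_one, Int.cast_neg]
    linarith

lemma chi_tsum_le (σ : ℝ) (hσ : 1 < σ) :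
    ∑' n : ℕ, ((ZMod.χ₄ (n : ZMod 4) : ℤ) : ℝ) * (n:ℝ) ^ (-σ) ≤ 1 := by
  have h := (summable_chi σ hσ).of_norm.hasSum.tendsto_sum_nat
  have h4 : Tendsto (fun m : ℕ => 4 * m) atTop atTop :=
    tendsto_id.const_mul_atTop' (by norm_num)
  refine le_of_tendsto (h.comp h4) (Eventually.of_forall fun m => ?_)
  have := chi_partial σ (by linarith) m
  have h2 : (0:ℝ) ≤ ((4 * m + 1 : ℕ) : ℝ) ^ (-σ) := by positivity
  simp only [Function.comp]
  linarith

lemma exp_le_inv_one_sub (t : ℝ) (ht : t < 1) : exp t ≤ (1 - t)⁻¹ := by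
  rw [← neg_neg t, exp_neg, neg_neg]
  apply inv_anti₀ (by linarith)
  have := add_one_le_exp (-t)
  linarith

lemma inv_one_sub_le_exp (t : ℝ) (h0 : 0 ≤ t) (ht : t ≤ 1 / 2) : (1 - t)⁻¹ ≤ exp (t + t ^ 2) := by
  have h1 : 1 + (t + t ^ 2) + (t + t^2)^2 / 2 ≤ exp (t + t ^ 2) :=
    Real.quadratic_le_exp_of_nonneg (by positivity)
  refine le_trans ?_ h1
  rw [inv_le_iff_one_le_mul₀ (by linarith)]
  nlinarith [mul_nonneg h0 h0, mul_nonneg (mul_nonneg h0 h0) h0, mul_nonneg (mul_nonneg h0 h0) (sub_nonneg.2 ht), pow_nonneg h0 4, pow_nonneg h0 3,pow_nonneg h0 5, mul_nonneg (pow_nonneg h0 3) (sub_nonneg.2 ht), mul_nonneg (pow_nonneg h0 4) (sub_nonneg.2 ht)]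

lemma chi_prime_sum (σ : ℝ) (hσ : 1 < σ) :
    ∀ᶠ N : ℕ in atTop,
      ∑ p ∈ Nat.primesBelow N, ((ZMod.χ₄ (p : ZMod 4) : ℤ) : ℝ) * (p:ℝ) ^ (-σ) ≤ 1 := by
  have h := EulerProduct.eulerProduct_completely_multiplicative (f := chiHom σ (by linarith))
    (summable_chi σ hσ)
  have h2 : ∑' n, chiHom σ (by linarith) n < 2 := by
    have := chi_tsum_le σ hσ
    have e : ∑' n, chiHom σ (by linarith) n
      = ∑' n : ℕ, ((ZMod.χ₄ (n : ZMod 4) : ℤ) : ℝ) * (n:ℝ) ^ (-σ) := rfl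
    linarith
  filter_upwards [h.eventually_lt_const h2] with N hN
  have h3 : exp (∑ p ∈ Nat.primesBelow N, chiHom σ (by linarith) p) < 2 := by
    refine lt_of_le_of_lt ?_ hN
    rw [Real.exp_sum]
    apply Finset.prod_le_prod (fun _ _ => (exp_pos _).le)
    intro p hp
    apply exp_le_inv_one_sub
    have hp1 := (Nat.prime_of_mem_primesBelow hp).one_lt
    have h5 : (p:ℝ) ^ (-σ) < 1 :=
      Real.rpow_lt_one_of_one_lt_of_neg (by exact_mod_cast hp1) (by linarith)
    have h6 := chi_abs_le p
    have h7 : (0:ℝ) ≤ (p:ℝ) ^ (-σ) := by positivity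
    have h8 := (abs_le.1 h6).2
    change ((ZMod.χ₄ (p : ZMod 4) : ℤ) : ℝ) * (p:ℝ) ^ (-σ) < 1
    nlinarith
  have h4 : ∑ p ∈ Nat.primesBelow N, chiHom σ (by linarith) p < 1 := by
    rw [← Real.exp_lt_exp]
    have := Real.exp_one_gt_d9
    linarith
  exact h4.le

lemma zeta_prime_sum : ∃ L0 : ℝ, 2 ≤ L0 ∧ ∀ L, L0 ≤ L → ∀ᶠ N : ℕ in atTop,
      ∑ p ∈ Nat.primesBelow N, (p:ℝ) ^ (-(1 + 1 / L)) ≤ log L + 3 ∧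
      log L - 3 ≤ ∑ p ∈ Nat.primesBelow N, (p:ℝ) ^ (-(1 + 1 / L)) := by
  have hz := tendsto_sub_mul_tsum_nat_rpow
  have hL : Tendsto (fun L : ℝ => 1 + 1 / L) atTop (𝓝[>] 1) := by
    rw [tendsto_nhdsWithin_iff]
    constructor
    · have := (tendsto_inv_atTop_zero (𝕜 := ℝ)).const_add 1
      simpa using this
    · filter_upwards [eventually_gt_atTop 0] with L hL
      simp; exact hL
  have hc := hz.comp hL
  have e1 := hc.eventually_lt_const (show (1:ℝ) < 2 by norm_num)
  have e2 := hc.eventually_const_lt (show (1/2:ℝ) < 1 by norm_num)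
  obtain ⟨L0, hL0⟩ := eventually_atTop.1 (e1.and e2)
  refine ⟨max L0 2, le_max_right _ _, fun L hLL => ?_⟩
  have hL2 : 2 ≤ L := le_trans (le_max_right _ _) hLL
  obtain ⟨a1, a2⟩ := hL0 L (le_trans (le_max_left _ _) hLL)
  simp only [Function.comp, add_sub_cancel_left] at a1 a2
  set σ := 1 + 1 / L with hσ
  have hσ1 : 1 < σ := by
    have : 0 < 1 / L := by positivity
    linarith
  have hσ0 : σ ≠ 0 := by linarith
  have hsum : Summable (fun n => ‖rpowHom σ hσ0 n‖) := by
    refine (summable_rpow σ hσ1).congr (fun n => ?_)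
    change _ = ‖(n:ℝ) ^ (-σ)‖
    rw [Real.norm_eq_abs, abs_of_nonneg (by positivity)]
  have h := EulerProduct.eulerProduct_completely_multiplicative (f := rpowHom σ hσ0) hsum
  have et : ∑' n, rpowHom σ hσ0 n = ∑' n : ℕ, 1 / (n:ℝ) ^ σ := by
    congr 1; ext n
    change (n:ℝ) ^ (-σ) = _
    rw [Real.rpow_neg (Nat.cast_nonneg _), one_div]
  rw [et] at h
  have b1 : ∑' n : ℕ, 1 / (n:ℝ) ^ σ < 2 * L := by
    have := mul_lt_mul_of_pos_left a1 (by linarith : 0 < L)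
    rw [← mul_assoc, mul_one_div_cancel (by linarith), one_mul] at this
    linarith
  have b2 : L / 2 < ∑' n : ℕ, 1 / (n:ℝ) ^ σ := by
    have := mul_lt_mul_of_pos_left a2 (by linarith : 0 < L)
    rw [← mul_assoc, mul_one_div_cancel (by linarith), one_mul] at this
    linarith
  have hl2 := Real.log_two_lt_d9
  filter_upwards [h.eventually_lt_const b1, h.eventually_const_lt b2] with N h1 h2
  have hbd : ∀ p ∈ Nat.primesBelow N, (0:ℝ) ≤ (p:ℝ) ^ (-σ) ∧ (p:ℝ) ^ (-σ) ≤ (p:ℝ)⁻¹ ∧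
      (p:ℝ)⁻¹ ≤ 1 / 2 := by
    intro p hp
    have hp2 := (Nat.prime_of_mem_primesBelow hp).two_le
    have hp2' : (2:ℝ) ≤ p := by exact_mod_cast hp2
    refine ⟨by positivity, ?_, ?_⟩
    · rw [← Real.rpow_neg_one]
      exact Real.rpow_le_rpow_of_exponent_le (by linarith) (by linarith)
    · rw [one_div]; exact inv_anti₀ (by norm_num) hp2'
  constructor
  · have h3 : exp (∑ p ∈ Nat.primesBelow N, (p:ℝ) ^ (-σ)) < 2 * L := by
      refine lt_of_le_of_lt ?_ h1
      rw [Real.exp_sum]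
      apply Finset.prod_le_prod (fun _ _ => (exp_pos _).le)
      intro p hp
      obtain ⟨q0, q1, q2⟩ := hbd p hp
      exact exp_le_inv_one_sub _ (by linarith)
    have h4 := (Real.lt_log_iff_exp_lt (by linarith)).2 h3
    rw [Real.log_mul (by norm_num) (by linarith)] at h4
    linarith
  · have h3 : L / 2 < exp (∑ p ∈ Nat.primesBelow N, ((p:ℝ) ^ (-σ) + ((p:ℝ)^2)⁻¹)) := by
      refine lt_of_lt_of_le h2 ?_
      rw [Real.exp_sum]
      apply Finset.prod_le_prod
      · intro p hp
        obtain ⟨q0, q1, q2⟩ := hbd p hp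
        change 0 ≤ (1 - (p:ℝ) ^ (-σ))⁻¹
        exact inv_nonneg.2 (by linarith)
      intro p hp
      obtain ⟨q0, q1, q2⟩ := hbd p hp
      refine (inv_one_sub_le_exp _ q0 (by linarith)).trans ?_
      apply exp_le_exp.2
      have : ((p:ℝ) ^ (-σ)) ^ 2 ≤ ((p:ℝ)⁻¹) ^ 2 := pow_le_pow_left₀ q0 q1 2
      rw [inv_pow] at this
      change (p:ℝ) ^ (-σ) + ((p:ℝ) ^ (-σ)) ^ 2 ≤ _
      linarith
    have h4 := (Real.log_lt_iff_lt_exp (by linarith)).2 h3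
    rw [Real.log_div (by linarith) (by norm_num), Finset.sum_add_distrib] at h4
    have h5 := sum_inv_sq_primes (Nat.primesBelow N) (fun p hp => Nat.prime_of_mem_primesBelow hp)
    linarith

end EulerMertens

section PrimesMod
open Finset Real Filter Topology

/-- Primes `p ≡ r (mod 4)` with `log p ≤ L`. -/
noncomputable def PM (r : ℕ) (L : ℝ) : Finset ℕ :=
  (Finset.range (⌊exp L⌋₊ + 1)).filter (fun p => p.Prime ∧ p % 4 = r)

lemma mem_PM (r : ℕ) (L : ℝ) (p : ℕ) : p ∈ PM r L ↔ p.Prime ∧ p % 4 = r ∧ log p ≤ L := by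
  simp only [PM, Finset.mem_filter, Finset.mem_range, Nat.lt_succ_iff]
  constructor
  · rintro ⟨h1, h2, h3⟩
    refine ⟨h2, h3, ?_⟩
    rw [Nat.le_floor_iff (exp_pos L).le] at h1
    rwa [Real.log_le_iff_le_exp (by exact_mod_cast h2.pos)]
  · rintro ⟨h2, h3, h1⟩
    refine ⟨?_, h2, h3⟩
    rw [Nat.le_floor_iff (exp_pos L).le]
    rwa [Real.log_le_iff_le_exp (by exact_mod_cast h2.pos)] at h1

lemma rpow_neg_eq (p : ℕ) (hp : p.Prime) (L : ℝ) :
    (p:ℝ) ^ (-(1 + 1 / L)) = 1 / p * exp (-(log p / L)) := by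
  have hp0 : (0:ℝ) < p := by exact_mod_cast hp.pos
  rw [neg_add, Real.rpow_add hp0, Real.rpow_neg_one, one_div, Real.rpow_def_of_pos hp0]
  rw [show log (p:ℝ) * -L⁻¹ = -(log p / L) by ring, one_div]

lemma tail_sum (L : ℝ) (hL : 0 < L) (S : Finset ℕ) (hS : ∀ p ∈ S, p.Prime ∧ L < log p) :
    ∑ p ∈ S, (p:ℝ) ^ (-(1 + 1 / L)) ≤ 12 := by
  classical
  set t : Finset ℕ := S.image (fun p : ℕ => ⌊log p / L⌋₊) with ht
  rw [← Finset.sum_fiberwise_of_maps_to (t := t) (g := fun p : ℕ => ⌊log p / L⌋₊)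
    (fun p hp => Finset.mem_image_of_mem _ hp)]
  have key : ∀ m ∈ t, ∑ p ∈ S.filter (fun p : ℕ => ⌊log p / L⌋₊ = m), (p:ℝ) ^ (-(1 + 1 / L)) ≤ 6 * exp (-1) ^ m := by
    intro m hm
    have hm1 : 1 ≤ m := by
      obtain ⟨p, hp, rfl⟩ := Finset.mem_image.1 hm
      apply Nat.le_floor
      rw [Nat.cast_one, le_div_iff₀ hL]; linarith [(hS p hp).2]
    have hm1' : (1:ℝ) ≤ m := by exact_mod_cast hm1
    have hb : ∀ p ∈ S.filter (fun p : ℕ => ⌊log p / L⌋₊ = m), p.Prime ∧ m * L ≤ log p ∧ log p ≤ (m + 1) * L := by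
      intro p hp
      rw [Finset.mem_filter] at hp
      obtain ⟨h1, h2⟩ := hp
      have h0 : 0 ≤ log p / L := by have := (hS p h1).2; positivity
      refine ⟨(hS p h1).1, ?_, ?_⟩
      · rw [← le_div_iff₀ hL, ← h2]; exact Nat.floor_le h0
      · rw [← div_le_iff₀ hL, ← h2]; exact (Nat.lt_floor_add_one _).le
    have hs := block_sum (m * L) ((m + 1) * L) _ (by positivity) (by positivity) hb
    calc ∑ p ∈ S.filter (fun p : ℕ => ⌊log p / L⌋₊ = m), (p:ℝ) ^ (-(1 + 1 / L))
        ≤ ∑ p ∈ S.filter (fun p : ℕ => ⌊log p / L⌋₊ = m), 1 / (p:ℝ) * exp (-1) ^ m := by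
          apply Finset.sum_le_sum
          intro p hp
          obtain ⟨h1, h2, h3⟩ := hb p hp
          rw [rpow_neg_eq p h1, ← Real.exp_nat_mul]
          have : (m:ℝ) ≤ log p / L := by rwa [le_div_iff₀ hL]
          gcongr
          linarith
      _ = (∑ p ∈ S.filter (fun p : ℕ => ⌊log p / L⌋₊ = m), 1 / (p:ℝ)) * exp (-1) ^ m := by rw [Finset.sum_mul]
      _ ≤ 6 * exp (-1) ^ m := by
          gcongr
          refine hs.trans ?_
          rw [div_le_iff₀ (by positivity)]
          nlinarith
  refine (Finset.sum_le_sum key).trans ?_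
  rw [← Finset.mul_sum]
  have he : exp (-1) ≤ 1 / 2 := by
    rw [exp_neg, one_div]
    apply inv_anti₀ (by norm_num)
    have := Real.exp_one_gt_d9; linarith
  have h2 : ∑ m ∈ t, exp (-1) ^ m ≤ ∑ m ∈ t, ((1:ℝ)/2) ^ m :=
    Finset.sum_le_sum (fun m _ => pow_le_pow_left₀ (exp_pos _).le he m)
  have h3 : ∑ m ∈ t, ((1:ℝ)/2) ^ m ≤ ∑' m : ℕ, ((1:ℝ)/2) ^ m :=
    summable_geometric_two.sum_le_tsum t (fun _ _ => by positivity)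
  rw [tsum_geometric_two] at h3
  linarith

lemma prime_sums : ∃ L0 : ℝ, 2 ≤ L0 ∧ ∀ L, L0 ≤ L →
    ∑ p ∈ PM 1 L, (1:ℝ) / p ≤ log L / 2 + 5 ∧
    log L / 2 - 15 ≤ ∑ p ∈ PM 3 L, (1:ℝ) / p := by
  classical
  obtain ⟨L0, hL0, h⟩ := zeta_prime_sum
  refine ⟨L0, hL0, fun L hL => ?_⟩
  have hLp : 0 < L := by linarith
  have hσ : 1 < 1 + 1 / L := by have : 0 < 1 / L := by positivity
                                linarith
  obtain ⟨N, ⟨⟨hz1, hz2⟩, hchi⟩, hN⟩ := (((h L hL).and (chi_prime_sum _ hσ)).and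
    (eventually_gt_atTop ⌊exp L⌋₊)).exists
  set T := Nat.primesBelow N with hT
  set f : ℕ → ℝ := fun p => (p:ℝ) ^ (-(1 + 1 / L)) with hf
  have hfn : ∀ p, 0 ≤ f p := fun p => by simp only [hf]; positivity
  have hsub : ∀ r, PM r L ⊆ T.filter (fun p => p % 4 = r) := by
    intro r p hp
    have h1 := (mem_PM r L p).1 hp
    simp only [PM, Finset.mem_filter, Finset.mem_range] at hp
    simp only [hT, Finset.mem_filter, Nat.mem_primesBelow]
    exact ⟨⟨by omega, h1.1⟩, h1.2.1⟩
  have hf1 : ∀ p ∈ T, f p ≤ 1 := by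
    intro p hp
    have hp1 := (Nat.prime_of_mem_primesBelow hp).one_lt
    exact (Real.rpow_lt_one_of_one_lt_of_neg (by exact_mod_cast hp1) (by linarith)).le
  have c1 : ∀ p ∈ T, p % 4 = 1 → ((ZMod.χ₄ (p : ZMod 4) : ℤ) : ℝ) = 1 := by
    intro p _ h; rw [ZMod.χ₄_nat_one_mod_four h]; simp
  have c3 : ∀ p ∈ T, p % 4 = 3 → ((ZMod.χ₄ (p : ZMod 4) : ℤ) : ℝ) = -1 := by
    intro p _ h; rw [ZMod.χ₄_nat_three_mod_four h]; simp
  have c2 : ∀ p ∈ T, p % 4 ≠ 1 → p % 4 ≠ 3 → p = 2 := by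
    intro p hp h1 h3
    rcases (Nat.prime_of_mem_primesBelow hp).eq_two_or_odd with h | h
    · exact h
    · omega
  have k1 : 2 * ∑ p ∈ T with p % 4 = 1, f p ≤ log L + 4 := by
    have : 2 * ∑ p ∈ T with p % 4 = 1, f p ≤
        ∑ p ∈ T, (f p + ((ZMod.χ₄ (p : ZMod 4) : ℤ) : ℝ) * f p) := by
      rw [Finset.mul_sum, Finset.sum_filter]
      apply Finset.sum_le_sum
      intro p hp
      split_ifs with h
      · rw [c1 p hp h]; linarith
      · have := (abs_le.1 (chi_abs_le p)).1
        nlinarith [hfn p]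
    rw [Finset.sum_add_distrib] at this
    linarith
  have k3 : log L - 5 ≤ 2 * ∑ p ∈ T with p % 4 = 3, f p := by
    have : ∑ p ∈ T, (f p - ((ZMod.χ₄ (p : ZMod 4) : ℤ) : ℝ) * f p) ≤
        2 * ∑ p ∈ T with p % 4 = 3, f p + ∑ p ∈ T, (if p = 2 then (1:ℝ) else 0) := by
      rw [Finset.mul_sum, Finset.sum_filter, ← Finset.sum_add_distrib]
      apply Finset.sum_le_sum
      intro p hp
      by_cases h3 : p % 4 = 3
      · rw [c3 p hp h3, if_pos h3]
        have : (0:ℝ) ≤ if p = 2 then (1:ℝ) else 0 := by split_ifs <;> norm_num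
        linarith
      · rw [if_neg h3]
        by_cases h1 : p % 4 = 1
        · rw [c1 p hp h1]
          have : (0:ℝ) ≤ if p = 2 then (1:ℝ) else 0 := by split_ifs <;> norm_num
          linarith
        · have e2 := c2 p hp h1 h3
          rw [if_pos e2]
          have hz : ((ZMod.χ₄ (p : ZMod 4) : ℤ) : ℝ) = 0 := by
            subst e2; simp
          rw [hz]; linarith [hf1 p hp]
    rw [Finset.sum_sub_distrib, Finset.sum_ite_eq'] at this
    have h1 : (if 2 ∈ T then (1:ℝ) else 0) ≤ 1 := by split_ifs <;> norm_num
    linarith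
  constructor
  · have a1 : ∑ p ∈ PM 1 L, (1:ℝ) / p ≤ ∑ p ∈ PM 1 L, (f p + log p / p * (1 / L)) := by
      apply Finset.sum_le_sum
      intro p hp
      have h1 := (mem_PM 1 L p).1 hp
      simp only [hf]
      rw [rpow_neg_eq p h1.1]
      have := add_one_le_exp (-(log p / L))
      have hp0 : (0:ℝ) < 1 / p := by have := h1.1.pos; positivity
      have : 1 / (p:ℝ) * (-(log p / L) + 1) ≤ 1 / p * exp (-(log p / L)) := by gcongr
      have e : log p / p * (1 / L) = 1 / (p:ℝ) * (log p / L) := by ring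
      rw [e]; linarith
    rw [Finset.sum_add_distrib, ← Finset.sum_mul] at a1
    have a2 := mertens_upper L (PM 1 L) hLp.le
      (fun p hp => ⟨((mem_PM 1 L p).1 hp).1, ((mem_PM 1 L p).1 hp).2.2⟩)
    have a3 : (∑ p ∈ PM 1 L, log p / p) * (1 / L) ≤ 3 := by
      rw [mul_one_div, div_le_iff₀ hLp]; exact a2
    have a4 : ∑ p ∈ PM 1 L, f p ≤ ∑ p ∈ T with p % 4 = 1, f p :=
      Finset.sum_le_sum_of_subset_of_nonneg (hsub 1) (fun p _ _ => hfn p)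
    linarith
  · have b1 : ∑ p ∈ PM 3 L, f p ≤ ∑ p ∈ PM 3 L, (1:ℝ) / p := by
      apply Finset.sum_le_sum
      intro p hp
      have h1 := (mem_PM 3 L p).1 hp
      simp only [hf]
      rw [rpow_neg_eq p h1.1]
      have hp0 : (0:ℝ) < 1 / p := by have := h1.1.pos; positivity
      have : exp (-(log p / L)) ≤ 1 := by
        rw [exp_le_one_iff]
        have : 0 ≤ log p / L := div_nonneg (log_natCast_nonneg p) hLp.le
        linarith
      nlinarith
    have b2 := Finset.sum_sdiff (f := f) (hsub 3)
    have b3 := tail_sum L hLp ((T.filter (fun p => p % 4 = 3)) \ PM 3 L) (by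
      intro p hp
      simp only [Finset.mem_sdiff, Finset.mem_filter, mem_PM, hT, Nat.mem_primesBelow] at hp
      refine ⟨hp.1.1.2, ?_⟩
      by_contra hc
      exact hp.2 ⟨hp.1.1.2, hp.1.2, not_lt.1 hc⟩)
    have b4 : ∑ p ∈ (T.filter (fun p => p % 4 = 3)) \ PM 3 L, f p ≤ 12 := b3
    linarith

lemma euler_ratio : ∃ c0 : ℝ, 0 < c0 ∧ ∃ L0 : ℝ, 2 ≤ L0 ∧ ∀ k : ℕ, 1 ≤ k → ∀ L, L0 ≤ L →
    c0 / (k:ℝ) ^ ((1:ℝ)/2) ≤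
      (∏ p ∈ PM 3 L, (1 + 1 / (p:ℝ))) * ∏ p ∈ PM 1 (k * L), (1 - 1 / (p:ℝ)) := by
  obtain ⟨L0, hL0, h⟩ := prime_sums
  refine ⟨exp (-22), exp_pos _, L0, hL0, fun k hk L hL => ?_⟩
  have hk' : (1:ℝ) ≤ k := by exact_mod_cast hk
  have hLp : 0 < L := by linarith
  have h3 := (h L hL).2
  have h1 := (h (k * L) (by nlinarith)).1
  have g1 : ∀ p ∈ PM 1 (k * L), exp (-(1 / (p:ℝ)) - ((p:ℝ)^2)⁻¹) ≤ 1 - 1 / (p:ℝ) := by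
    intro p hp
    have hp2 : (2:ℝ) ≤ p := by exact_mod_cast ((mem_PM _ _ p).1 hp).1.two_le
    have q : 1 / (p:ℝ) ≤ 1 / 2 := one_div_le_one_div_of_le (by norm_num) hp2
    have := inv_one_sub_le_exp (1 / p) (by positivity) q
    rw [inv_le_comm₀ (by linarith) (exp_pos _), ← exp_neg] at this
    refine le_trans (le_of_eq ?_) this
    congr 1; rw [one_div, inv_pow]; ring
  have g3 : ∀ p ∈ PM 3 L, exp (1 / (p:ℝ) - ((p:ℝ)^2)⁻¹) ≤ 1 + 1 / (p:ℝ) := by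
    intro p hp
    have hp2 : (2:ℝ) ≤ p := by exact_mod_cast ((mem_PM _ _ p).1 hp).1.two_le
    set t := 1 / (p:ℝ) with ht
    have q : t ≤ 1 / 2 := one_div_le_one_div_of_le (by norm_num) hp2
    have q0 : 0 < t := by positivity
    have e : t - ((p:ℝ)^2)⁻¹ = -(t ^ 2 - t) := by rw [ht, one_div, inv_pow]; ring
    rw [e, exp_neg]
    have := add_one_le_exp (t ^ 2 - t)
    rw [inv_le_comm₀ (exp_pos _) (by linarith)]
    refine le_trans ?_ this
    rw [inv_le_iff_one_le_mul₀ (by linarith)]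
    nlinarith [pow_pos q0 3]
  have s1 := sum_inv_sq_primes (PM 1 (k * L)) (fun p hp => ((mem_PM _ _ p).1 hp).1)
  have s3 := sum_inv_sq_primes (PM 3 L) (fun p hp => ((mem_PM _ _ p).1 hp).1)
  calc exp (-22) / (k:ℝ) ^ ((1:ℝ)/2) = exp (-22 - log k / 2) := by
        rw [exp_sub, Real.rpow_def_of_pos (by linarith)]; congr 2; ring
    _ ≤ exp ((∑ p ∈ PM 3 L, (1 / (p:ℝ) - ((p:ℝ)^2)⁻¹))
          + ∑ p ∈ PM 1 (k * L), (-(1 / (p:ℝ)) - ((p:ℝ)^2)⁻¹)) := by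
        apply exp_le_exp.2
        simp only [Finset.sum_sub_distrib, Finset.sum_neg_distrib]
        rw [log_mul (by linarith) (by linarith)] at h1
        linarith
    _ ≤ _ := by
        rw [exp_add, exp_sum, exp_sum]
        gcongr with p hp p hp
        · exact g3 p hp
        · exact g1 p hp

end PrimesMod

section BrunHooley
open Finset Real

/-- Weighted sum over subsets, the weight depends only on the cardinality. -/
noncomputable def WW (c : ℕ → ℝ) (P : Finset ℕ) (h : ℕ → ℝ) : ℝ :=
  ∑ D ∈ P.powerset, c D.card * ∏ p ∈ D, h p

lemma WW_empty (c : ℕ → ℝ) (h : ℕ → ℝ) : WW c ∅ h = c 0 := by simp [WW]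

lemma WW_insert (c : ℕ → ℝ) (P : Finset ℕ) (h : ℕ → ℝ) (p : ℕ) (hp : p ∉ P) :
    WW c (insert p P) h = WW c P h + h p * WW (fun i => c (i + 1)) P h := by
  rw [WW, Finset.sum_powerset_insert hp, WW, WW, Finset.mul_sum]
  congr 1
  apply Finset.sum_congr rfl
  intro D hD
  have : p ∉ D := fun h' => hp (Finset.mem_powerset.1 hD h')
  rw [Finset.card_insert_of_notMem this, Finset.prod_insert this]
  ring

/-- truncated Moebius coefficients -/
noncomputable def uc (b : ℕ) : ℕ → ℝ := fun i => if i ≤ b then (-1) ^ i else 0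
/-- coefficient of the elementary symmetric function -/
noncomputable def ec (n : ℕ) : ℕ → ℝ := fun i => if i = n then 1 else 0

lemma uc_succ (b : ℕ) : (fun i => uc (b + 1) (i + 1)) = fun i => - uc b i := by
  ext i; simp only [uc, add_le_add_iff_right]; split_ifs <;> simp [pow_succ]

lemma ec_succ (b : ℕ) : (fun i => ec (b + 1) (i + 1)) = ec b := by
  ext i; simp [ec]

lemma WW_neg (c : ℕ → ℝ) (P : Finset ℕ) (h : ℕ → ℝ) : WW (fun i => - c i) P h = - WW c P h := by
  simp [WW]

lemma WW_uc_zero (P : Finset ℕ) (h : ℕ → ℝ) : WW (uc 0) P h = 1 := by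
  induction P using Finset.induction_on with
  | empty => simp [WW_empty, uc]
  | insert p P hp ih =>
    rw [WW_insert _ _ _ _ hp, ih]
    have : (fun i => uc 0 (i + 1)) = fun _ => 0 := by ext i; simp [uc]
    rw [this]; simp [WW]

lemma WW_uc_succ (b : ℕ) (P : Finset ℕ) (h : ℕ → ℝ) :
    WW (uc (b + 1)) P h = WW (uc b) P h + (-1) ^ (b + 1) * WW (ec (b + 1)) P h := by
  simp only [WW, Finset.mul_sum, ← Finset.sum_add_distrib]
  apply Finset.sum_congr rfl
  intro D _
  simp only [uc, ec]
  by_cases h1 : D.card ≤ b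
  · rw [if_pos (by omega), if_pos h1, if_neg (by omega)]; ring
  · by_cases h2 : D.card = b + 1
    · rw [if_pos (by omega), if_neg h1, if_pos h2, h2]; ring
    · rw [if_neg (by omega), if_neg h1, if_neg h2]; ring

lemma bonferroni_nonneg (P : Finset ℕ) (h : ℕ → ℝ) (hh : ∀ p ∈ P, 0 ≤ h p ∧ h p ≤ 1) :
    ∀ b : ℕ, 0 ≤ (-1) ^ b * (WW (uc b) P h - ∏ p ∈ P, (1 - h p)) := by
  induction P using Finset.induction_on with
  | empty => intro b; simp [WW_empty, uc]
  | insert p P hp ih =>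
    have ih' := ih (fun q hq => hh q (Finset.mem_insert_of_mem hq))
    have hp1 := hh p (Finset.mem_insert_self _ _)
    intro b
    cases b with
    | zero =>
      rw [WW_uc_zero, pow_zero, one_mul, sub_nonneg]
      apply Finset.prod_le_one
      · intro q hq; linarith [(hh q hq).2]
      · intro q hq; linarith [(hh q hq).1]
    | succ b =>
      rw [WW_insert _ _ _ _ hp, Finset.prod_insert hp, uc_succ, WW_neg]
      have e1 := ih' (b + 1)
      have e2 := ih' b
      have e3 := mul_nonneg hp1.1 e2
      have : (-1:ℝ) ^ (b + 1) * (WW (uc (b + 1)) P h + h p * -WW (uc b) P h - (1 - h p) * ∏ x ∈ P, (1 - h x))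
        = (-1) ^ (b + 1) * (WW (uc (b + 1)) P h - ∏ p ∈ P, (1 - h p)) +
          h p * ((-1) ^ b * (WW (uc b) P h - ∏ p ∈ P, (1 - h p))) := by
        rw [pow_succ]; ring
      rw [this]; linarith

lemma bonferroni (P : Finset ℕ) (h : ℕ → ℝ) (hh : ∀ p ∈ P, 0 ≤ h p ∧ h p ≤ 1)
    (b : ℕ) (hb : Even b) :
    ∏ p ∈ P, (1 - h p) ≤ WW (uc b) P h ∧
      WW (uc b) P h ≤ ∏ p ∈ P, (1 - h p) + WW (ec (b + 1)) P h := by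
  have h1 := bonferroni_nonneg P h hh b
  have h2 := bonferroni_nonneg P h hh (b + 1)
  rw [WW_uc_succ, pow_succ, hb.neg_one_pow] at h2
  rw [hb.neg_one_pow] at h1
  constructor <;> linarith

lemma WW_ec_nonneg (n : ℕ) (P : Finset ℕ) (h : ℕ → ℝ) (hh : ∀ p ∈ P, 0 ≤ h p) :
    0 ≤ WW (ec n) P h := by
  apply Finset.sum_nonneg
  intro D hD
  apply mul_nonneg
  · simp only [ec]; split_ifs <;> norm_num
  · exact Finset.prod_nonneg (fun p hp => hh p (Finset.mem_powerset.1 hD hp))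

lemma pow_add_ge (s t : ℝ) (hs : 0 ≤ s) (ht : 0 ≤ t) (n : ℕ) :
    s ^ (n + 1) + (n + 1) * (t * s ^ n) ≤ (s + t) ^ (n + 1) := by
  induction n with
  | zero => simp
  | succ n ih =>
    rw [pow_succ (s + t)]
    have := mul_le_mul_of_nonneg_right ih (by linarith : 0 ≤ s + t)
    refine le_trans ?_ this
    push_cast
    have h1 : 0 ≤ (n + 1) * (t * s ^ n) * t := by positivity
    have e : (s ^ (n + 1) + (n + 1) * (t * s ^ n)) * (s + t)
      = s ^ (n + 1 + 1) + (n + 1 + 1) * (t * s ^ (n + 1)) + (n + 1) * (t * s ^ n) * t := by ring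
    rw [e]; linarith

lemma WW_ec_le (P : Finset ℕ) (h : ℕ → ℝ) (hh : ∀ p ∈ P, 0 ≤ h p) :
    ∀ n : ℕ, WW (ec n) P h ≤ (∑ p ∈ P, h p) ^ n / n.factorial := by
  induction P using Finset.induction_on with
  | empty =>
    intro n; cases n with
    | zero => simp [WW_empty, ec]
    | succ n => simp [WW_empty, ec]
  | insert p P hp ih =>
    have ih' := ih (fun q hq => hh q (Finset.mem_insert_of_mem hq))
    have hp1 := hh p (Finset.mem_insert_self _ _)
    have hs : 0 ≤ ∑ q ∈ P, h q := Finset.sum_nonneg (fun q hq => hh q (Finset.mem_insert_of_mem hq))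
    intro n
    rw [WW_insert _ _ _ _ hp, Finset.sum_insert hp]
    cases n with
    | zero =>
      have : (fun i => ec 0 (i + 1)) = fun _ => 0 := by ext i; simp [ec]
      rw [this]
      have := ih' 0
      simp [WW] at this ⊢
      exact this
    | succ n =>
      rw [ec_succ]
      have e1 := ih' (n + 1)
      have e2 := mul_le_mul_of_nonneg_left (ih' n) hp1
      have e3 := pow_add_ge _ _ hs hp1 n
      have hf : (0:ℝ) < n.factorial := by positivity
      calc _ ≤ (∑ q ∈ P, h q) ^ (n+1) / (n+1).factorial + h p * ((∑ q ∈ P, h q) ^ n / n.factorial) :=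
            add_le_add e1 e2
        _ = ((∑ q ∈ P, h q) ^ (n+1) + (n + 1) * (h p * (∑ q ∈ P, h q) ^ n)) / (n+1).factorial := by
            rw [Nat.factorial_succ]; push_cast; field_simp
        _ ≤ _ := by
            rw [add_comm (h p)]
            gcongr

lemma WW_count (P : Finset ℕ) : ∀ (m : ℕ) (c : ℕ → ℝ), (∀ i, 0 ≤ c i ∧ c i ≤ 1) →
    (∀ i, m < i → c i = 0) → WW c P (fun _ => 1) ≤ ((P.card : ℝ) + 1) ^ m := by
  induction P using Finset.induction_on with
  | empty => intro m c h1 h2; rw [WW_empty]; simpa using (h1 0).2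
  | insert p P hp ih =>
    intro m c h1 h2
    rw [WW_insert _ _ _ _ hp, Finset.card_insert_of_notMem hp, one_mul]
    have e1 := ih m c h1 h2
    cases m with
    | zero =>
      have : (fun i => c (i + 1)) = fun _ => 0 := by ext i; exact h2 _ (by omega)
      rw [this]; simp [WW] at e1 ⊢; exact e1
    | succ m =>
      have e2 := ih m (fun i => c (i + 1)) (fun i => h1 _) (fun i hi => h2 _ (by omega))
      have e3 := pow_add_ge ((P.card : ℝ) + 1) 1 (by positivity) (by norm_num) m
      have e4 : (0:ℝ) ≤ m * ((P.card : ℝ) + 1) ^ m := by positivity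
      push_cast
      rw [one_mul] at e3
      linarith

lemma prod_tele {β : Type*} [DecidableEq β] (s : Finset β) (θ U T : β → ℝ)
    (h : ∀ j, 0 ≤ θ j ∧ θ j ≤ U j ∧ U j ≤ θ j + T j) :
    (∏ j ∈ s, U j) - ∏ j ∈ s, θ j ≤ ∑ j ∈ s, ∏ i ∈ s, (if i = j then T i else U i) := by
  induction s using Finset.induction_on with
  | empty => simp
  | insert a s ha ih =>
    have hU : 0 ≤ ∏ j ∈ s, U j := Finset.prod_nonneg (fun j _ => (h j).1.trans (h j).2.1)
    have hle : ∏ j ∈ s, θ j ≤ ∏ j ∈ s, U j :=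
      Finset.prod_le_prod (fun j _ => (h j).1) (fun j _ => (h j).2.1)
    rw [Finset.prod_insert ha, Finset.prod_insert ha, Finset.sum_insert ha, Finset.prod_insert ha,
      if_pos rfl]
    have e1 : ∏ i ∈ s, (if i = a then T i else U i) = ∏ i ∈ s, U i := by
      apply Finset.prod_congr rfl
      intro i hi
      rw [if_neg (by rintro rfl; exact ha hi)]
    have e2 : ∑ j ∈ s, ∏ i ∈ insert a s, (if i = j then T i else U i) =
        U a * ∑ j ∈ s, ∏ i ∈ s, (if i = j then T i else U i) := by
      rw [Finset.mul_sum]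
      apply Finset.sum_congr rfl
      intro j hj
      rw [Finset.prod_insert ha, if_neg (by rintro rfl; exact ha hj)]
    rw [e1, e2]
    obtain ⟨h1, h2, h3⟩ := h a
    have := mul_le_mul_of_nonneg_left ih (h1.trans h2)
    nlinarith [mul_nonneg (sub_nonneg.2 h2) (sub_nonneg.2 hle), mul_le_mul_of_nonneg_right h3 hU,
      mul_nonneg (sub_nonneg.2 h2) (Finset.prod_nonneg (fun j (_ : j ∈ s) => (h j).1))]

open Classical in
lemma count_expand {α β : Type*} [Fintype β] [DecidableEq β] (A : Finset α)
    (P : β → Finset ℕ) (bad : ℕ → α → Prop) (g : ℕ → ℝ) (X R : ℝ) (m : β → ℕ)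
    (hR : 0 ≤ R)
    (hcount : ∀ D : β → Finset ℕ, (∀ j, D j ⊆ P j ∧ (D j).card ≤ m j) →
      |((A.filter (fun a => ∀ j, ∀ p ∈ D j, bad p a)).card : ℝ) - X * ∏ j, ∏ p ∈ D j, g p| ≤ R)
    (c : β → ℕ → ℝ) (hc : ∀ j i, |c j i| ≤ 1) (hc0 : ∀ j i, m j < i → c j i = 0) :
    |∑ a ∈ A, ∏ j, WW (c j) (P j) (fun p => if bad p a then 1 else 0)
      - X * ∏ j, WW (c j) (P j) g| ≤ R * ∏ j, ((P j).card + 1 : ℝ) ^ (m j) := by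
  have e1 : ∀ h : ℕ → ℝ, ∏ j, WW (c j) (P j) h =
      ∑ D ∈ Fintype.piFinset (fun j => (P j).powerset), (∏ j, c j (D j).card) * ∏ j, ∏ p ∈ D j, h p := by
    intro h
    simp only [WW]
    rw [Finset.prod_univ_sum]
    simp only [Finset.prod_mul_distrib]
  have e2 : ∀ (D : β → Finset ℕ), ∑ a ∈ A, ∏ j, ∏ p ∈ D j, (if bad p a then (1:ℝ) else 0)
      = ((A.filter (fun a => ∀ j, ∀ p ∈ D j, bad p a)).card : ℝ) := by
    intro D
    rw [Finset.card_filter]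
    push_cast
    apply Finset.sum_congr rfl
    intro a _
    split_ifs with hD
    · exact Finset.prod_eq_one (fun j _ => Finset.prod_eq_one (fun p hp => if_pos (hD j p hp)))
    · push Not at hD
      obtain ⟨j, p, hp, hb⟩ := hD
      exact Finset.prod_eq_zero (Finset.mem_univ j) (Finset.prod_eq_zero hp (if_neg hb))
  simp only [e1]
  rw [Finset.sum_comm]
  simp only [← Finset.mul_sum, e2]
  rw [Finset.mul_sum, ← Finset.sum_sub_distrib]
  refine (Finset.abs_sum_le_sum_abs _ _).trans ?_
  have e3 : ∏ j, WW (fun i => |c j i|) (P j) (fun _ => 1) ≤ ∏ j, ((P j).card + 1 : ℝ) ^ (m j) := by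
    apply Finset.prod_le_prod
    · intro j _
      apply Finset.sum_nonneg
      intro D _
      simp
    · intro j _
      exact WW_count (P j) (m j) _ (fun i => ⟨abs_nonneg _, hc j i⟩)
        (fun i hi => by rw [hc0 j i hi, abs_zero])
  refine le_trans ?_ (mul_le_mul_of_nonneg_left e3 hR)
  simp only [WW]
  rw [Finset.prod_univ_sum, Finset.mul_sum]
  apply Finset.sum_le_sum
  intro D hD
  rw [Fintype.mem_piFinset] at hD
  simp only [Finset.prod_const_one, mul_one]
  rw [← Finset.abs_prod]
  by_cases hD2 : ∀ j, (D j).card ≤ m j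
  · have := hcount D (fun j => ⟨Finset.mem_powerset.1 (hD j), hD2 j⟩)
    rw [show (∏ j, c j (D j).card) * ((A.filter (fun a => ∀ j, ∀ p ∈ D j, bad p a)).card : ℝ) -
      X * ((∏ j, c j (D j).card) * ∏ j, ∏ p ∈ D j, g p) = (∏ j, c j (D j).card) *
      (((A.filter (fun a => ∀ j, ∀ p ∈ D j, bad p a)).card : ℝ) - X * ∏ j, ∏ p ∈ D j, g p) by ring,
      abs_mul, mul_comm R]
    gcongr
  · push Not at hD2
    obtain ⟨j, hj⟩ := hD2
    have : ∏ j, c j (D j).card = 0 := Finset.prod_eq_zero (Finset.mem_univ j) (hc0 j _ hj)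
    rw [this]; simp

open Classical in
theorem brun_hooley {α β : Type*} [Fintype β] [DecidableEq β] (A : Finset α)
    (P : β → Finset ℕ) (bad : ℕ → α → Prop) (g : ℕ → ℝ) (X R : ℝ) (b : β → ℕ) (η : β → ℝ)
    (hX : 0 ≤ X) (hR : 0 ≤ R) (hg : ∀ j, ∀ p ∈ P j, 0 ≤ g p ∧ g p ≤ 1 / 2)
    (hb : ∀ j, Even (b j))
    (hη0 : ∀ j, 0 ≤ η j) (hηs : ∑ j, η j ≤ 1 / 2)
    (hη : ∀ j, (∑ p ∈ P j, g p) ^ (b j + 1) / (b j + 1).factorial ≤ η j * ∏ p ∈ P j, (1 - g p))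
    (hcount : ∀ D : β → Finset ℕ, (∀ j, D j ⊆ P j ∧ (D j).card ≤ b j + 1) →
      |((A.filter (fun a => ∀ j, ∀ p ∈ D j, bad p a)).card : ℝ) - X * ∏ j, ∏ p ∈ D j, g p| ≤ R) :
    ((A.filter (fun a => ∀ j, ∀ p ∈ P j, ¬ bad p a)).card : ℝ) ≤
        2 * X * ∏ j, ∏ p ∈ P j, (1 - g p) + R * ∏ j, ((P j).card + 1 : ℝ) ^ (b j + 1) ∧
    X / 2 * (∏ j, ∏ p ∈ P j, (1 - g p)) -
        (1 + Fintype.card β) * (R * ∏ j, ((P j).card + 1 : ℝ) ^ (b j + 1)) ≤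
      ((A.filter (fun a => ∀ j, ∀ p ∈ P j, ¬ bad p a)).card : ℝ) := by
  set K := R * ∏ j, ((P j).card + 1 : ℝ) ^ (b j + 1) with hK
  set h : α → ℕ → ℝ := fun a p => if bad p a then 1 else 0 with hh
  have hh01 : ∀ a p, 0 ≤ h a p ∧ h a p ≤ 1 := by
    intro a p; simp only [hh]; split_ifs <;> norm_num
  have hS : ((A.filter (fun a => ∀ j, ∀ p ∈ P j, ¬ bad p a)).card : ℝ) =
      ∑ a ∈ A, ∏ j, ∏ p ∈ P j, (1 - h a p) := by
    rw [Finset.card_filter]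
    push_cast
    apply Finset.sum_congr rfl
    intro a _
    split_ifs with hD
    · symm
      exact Finset.prod_eq_one (fun j _ => Finset.prod_eq_one (fun p hp => by
        simp [hh, hD j p hp]))
    · push Not at hD
      obtain ⟨j, p, hp, hb⟩ := hD
      symm
      exact Finset.prod_eq_zero (Finset.mem_univ j) (Finset.prod_eq_zero hp (by simp [hh, hb]))
  have hucb : ∀ (j : β) (i : ℕ), |uc (b j) i| ≤ 1 := by
    intro j i; simp only [uc]; split_ifs <;> simp
  have hecb : ∀ (j : β) (i : ℕ), |ec (b j + 1) i| ≤ 1 := by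
    intro j i; simp only [ec]; split_ifs <;> simp
  have hU := count_expand A P bad g X R (fun j => b j + 1) hR hcount (fun j => uc (b j)) hucb
    (fun j i hi => by simp only [uc]; rw [if_neg (by omega)])
  have hT : ∀ j : β, _ := fun j => count_expand A P bad g X R (fun j => b j + 1) hR hcount
    (fun i => if i = j then ec (b i + 1) else uc (b i))
    (fun i n => by by_cases hij : i = j <;> simp only [hij, if_true, if_false, hucb, hecb])
    (fun i n hi => by
      by_cases hij : i = j
      · simp only [if_pos hij, ec]; rw [if_neg (by omega)]
      · simp only [if_neg hij, uc]; rw [if_neg (by omega)])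
  have bonA := fun a j => bonferroni (P j) (h a) (fun p _ => hh01 a p) (b j) (hb j)
  have bonG := fun j => bonferroni (P j) g (fun p hp => ⟨(hg j p hp).1, by linarith [(hg j p hp).2]⟩)
    (b j) (hb j)
  have vA : ∀ a j, 0 ≤ ∏ p ∈ P j, (1 - h a p) := fun a j =>
    Finset.prod_nonneg (fun p _ => by linarith [(hh01 a p).2])
  have vG : ∀ j, 0 < ∏ p ∈ P j, (1 - g p) := fun j =>
    Finset.prod_pos (fun p hp => by linarith [(hg j p hp).2])
  have eG : ∀ j, WW (ec (b j + 1)) (P j) g ≤ η j * ∏ p ∈ P j, (1 - g p) := fun j =>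
    (WW_ec_le (P j) g (fun p hp => (hg j p hp).1) _).trans (hη j)
  have eG0 : ∀ j, 0 ≤ WW (ec (b j + 1)) (P j) g := fun j =>
    WW_ec_nonneg _ _ _ (fun p hp => (hg j p hp).1)
  rw [hS]
  constructor
  · have m1 : ∏ j, WW (uc (b j)) (P j) g ≤ 2 * ∏ j, ∏ p ∈ P j, (1 - g p) := by
      calc ∏ j, WW (uc (b j)) (P j) g ≤ ∏ j, (exp (η j) * ∏ p ∈ P j, (1 - g p)) := by
            apply Finset.prod_le_prod
            · intro j _; exact (vG j).le.trans (bonG j).1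
            · intro j _
              have := add_one_le_exp (η j)
              nlinarith [(bonG j).2, eG j, vG j]
        _ = exp (∑ j, η j) * ∏ j, ∏ p ∈ P j, (1 - g p) := by
            rw [Finset.prod_mul_distrib, exp_sum]
        _ ≤ _ := by
            have h0 : 0 ≤ ∏ j, ∏ p ∈ P j, (1 - g p) := Finset.prod_nonneg (fun j _ => (vG j).le)
            have h1 : exp (∑ j, η j) ≤ exp (1/2) := exp_le_exp.2 hηs
            have h2 : exp (1/2) ≤ 2 := by
              have h3 := inv_one_sub_le_exp
              have := exp_le_inv_one_sub (1/2) (by norm_num)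
              norm_num at this ⊢; exact this
            gcongr; linarith
    have m2 : ∑ a ∈ A, ∏ j, ∏ p ∈ P j, (1 - h a p) ≤ ∑ a ∈ A, ∏ j, WW (uc (b j)) (P j) (h a) := by
      apply Finset.sum_le_sum
      intro a _
      exact Finset.prod_le_prod (fun j _ => vA a j) (fun j _ => (bonA a j).1)
    have m3 := (abs_le.1 hU).2
    have m4 := mul_le_mul_of_nonneg_left m1 hX
    linarith
  · have l1 : ∑ a ∈ A, ∏ j, WW (uc (b j)) (P j) (h a) -
        ∑ j, ∑ a ∈ A, ∏ i, WW (if i = j then ec (b i + 1) else uc (b i)) (P i) (h a) ≤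
        ∑ a ∈ A, ∏ j, ∏ p ∈ P j, (1 - h a p) := by
      rw [Finset.sum_comm, ← Finset.sum_sub_distrib]
      apply Finset.sum_le_sum
      intro a _
      have := prod_tele Finset.univ (fun j => ∏ p ∈ P j, (1 - h a p)) (fun j => WW (uc (b j)) (P j) (h a))
        (fun j => WW (ec (b j + 1)) (P j) (h a)) (fun j => ⟨vA a j, bonA a j⟩)
      have e : ∀ i j, (if i = j then WW (ec (b i + 1)) (P i) (h a) else WW (uc (b i)) (P i) (h a)) =
        WW (if i = j then ec (b i + 1) else uc (b i)) (P i) (h a) := by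
        intro i j; split_ifs <;> rfl
      simp only [e] at this
      linarith
    have l2 : ∀ j, ∑ a ∈ A, ∏ i, WW (if i = j then ec (b i + 1) else uc (b i)) (P i) (h a) ≤
        X * (η j * ∏ i, WW (uc (b i)) (P i) g) + K := by
      intro j
      have h1 := (abs_le.1 (hT j)).2
      have h2 : ∏ i, WW (if i = j then ec (b i + 1) else uc (b i)) (P i) g ≤
          η j * ∏ i, WW (uc (b i)) (P i) g := by
        calc _ ≤ ∏ i, ((if i = j then η j else 1) * WW (uc (b i)) (P i) g) := by
              apply Finset.prod_le_prod
              · intro i _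
                split_ifs
                · exact eG0 i
                · exact (vG i).le.trans (bonG i).1
              · intro i _
                split_ifs with hij
                · subst hij
                  exact (eG i).trans (mul_le_mul_of_nonneg_left (bonG i).1 (hη0 i))
                · rw [one_mul]
          _ = _ := by
              rw [Finset.prod_mul_distrib, Finset.prod_ite_eq' Finset.univ j, if_pos (Finset.mem_univ j)]
      have h3 := mul_le_mul_of_nonneg_left h2 hX
      linarith
    have l3 := (abs_le.1 hU).1
    have l4 : ∏ j, ∏ p ∈ P j, (1 - g p) ≤ ∏ j, WW (uc (b j)) (P j) g :=
      Finset.prod_le_prod (fun j _ => (vG j).le) (fun j _ => (bonG j).1)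
    have l5 := Finset.sum_le_sum (fun j (_ : j ∈ Finset.univ) => l2 j)
    rw [Finset.sum_add_distrib, ← Finset.mul_sum, ← Finset.sum_mul, Finset.sum_const,
      Finset.card_univ, nsmul_eq_mul] at l5
    have l6 : 0 ≤ ∏ j, WW (uc (b j)) (P j) g :=
      (Finset.prod_nonneg (fun j _ => (vG j).le)).trans l4
    set Y := ∏ j, WW (uc (b j)) (P j) g
    set Z := ∏ j, ∏ p ∈ P j, (1 - g p)
    have l7 : X * Z ≤ X * Y := mul_le_mul_of_nonneg_left l4 hX
    have l8 : X * ((∑ j, η j) * Y) ≤ X * (1 / 2 * Y) := by gcongr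
    linarith

end BrunHooley

section SieveTwo
open Finset Real
open scoped Classical

/-- dyadic (in log scale) block -/
noncomputable def blk (S : Finset ℕ) (L : ℝ) (j : ℕ) : Finset ℕ :=
  S.filter (fun p : ℕ => L / 2 ^ (j + 1) < log p ∧ log p ≤ L / 2 ^ j)

lemma mem_blk (S : Finset ℕ) (L : ℝ) (j p : ℕ) :
    p ∈ blk S L j ↔ p ∈ S ∧ L / 2 ^ (j + 1) < log p ∧ log p ≤ L / 2 ^ j := by
  simp [blk]

lemma blk_sum (S : Finset ℕ) (L : ℝ) (j κ : ℕ) (g : ℕ → ℝ) (hL : 0 < L)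
    (hS : ∀ p ∈ S, p.Prime ∧ g p ≤ (κ : ℝ) / p) : ∑ p ∈ blk S L j, g p ≤ 6 * κ := by
  have h := block_sum (L / 2 ^ (j + 1)) (L / 2 ^ j) (blk S L j) (by positivity) (by positivity)
    (fun p hp => by
      rw [mem_blk] at hp
      exact ⟨(hS p hp.1).1, hp.2.1.le, hp.2.2⟩)
  have e : 3 * (L / 2 ^ j) / (L / 2 ^ (j + 1)) = 6 := by
    field_simp; ring
  rw [e] at h
  calc ∑ p ∈ blk S L j, g p ≤ ∑ p ∈ blk S L j, (κ : ℝ) * (1 / p) := by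
        apply Finset.sum_le_sum
        intro p hp
        rw [mem_blk] at hp
        have := (hS p hp.1).2
        rw [mul_one_div]; exact this
    _ = κ * ∑ p ∈ blk S L j, (1 : ℝ) / p := by rw [Finset.mul_sum]
    _ ≤ κ * 6 := by gcongr
    _ = 6 * κ := by ring

lemma prod_one_sub_ge (S : Finset ℕ) (g : ℕ → ℝ) (hg : ∀ p ∈ S, 0 ≤ g p ∧ g p ≤ 1 / 2) :
    exp (- 2 * ∑ p ∈ S, g p) ≤ ∏ p ∈ S, (1 - g p) := by
  rw [Finset.mul_sum, Real.exp_sum]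
  apply Finset.prod_le_prod
  · intro p _; positivity
  · intro p hp
    obtain ⟨h0, h1⟩ := hg p hp
    have h := inv_one_sub_le_exp (g p) h0 h1
    have h2 : exp (g p + g p ^ 2) ≤ exp (2 * g p) := by
      apply exp_le_exp.2; nlinarith
    have h3 : (1 - g p)⁻¹ ≤ exp (2 * g p) := h.trans h2
    have h4 : -2 * g p = - (2 * g p) := by ring
    rw [h4, exp_neg]
    exact inv_le_of_inv_le₀ (by linarith) h3

lemma blk_prod (S : Finset ℕ) (L : ℝ) (j κ : ℕ) (g : ℕ → ℝ) (hL : 0 < L)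
    (hS : ∀ p ∈ S, p.Prime ∧ 0 ≤ g p ∧ g p ≤ 1 / 2 ∧ g p ≤ (κ : ℝ) / p) :
    exp (- 12 * κ) ≤ ∏ p ∈ blk S L j, (1 - g p) := by
  refine le_trans ?_ (prod_one_sub_ge _ g (fun p hp => ?_))
  · apply exp_le_exp.2
    have := blk_sum S L j κ g hL (fun p hp => ⟨(hS p hp).1, (hS p hp).2.2.2⟩)
    linarith
  · rw [mem_blk] at hp
    exact ⟨(hS p hp.1).2.1, (hS p hp.1).2.2.1⟩

lemma blk_eta (S : Finset ℕ) (L : ℝ) (j κ : ℕ) (g : ℕ → ℝ) (hL : 0 < L) (hκ : 1 ≤ κ)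
    (hS : ∀ p ∈ S, p.Prime ∧ 0 ≤ g p ∧ g p ≤ 1 / 2 ∧ g p ≤ (κ : ℝ) / p) :
    (∑ p ∈ blk S L j, g p) ^ (48 * κ * (j + 1) + 1) / ((48 * κ * (j + 1) + 1).factorial : ℝ) ≤
      (1 / 2) ^ (j + 3) * ∏ p ∈ blk S L j, (1 - g p) := by
  set s := ∑ p ∈ blk S L j, g p with hs
  set n := 48 * κ * (j + 1) + 1 with hn
  have hs6 : s ≤ 6 * κ := blk_sum S L j κ g hL (fun p hp => ⟨(hS p hp).1, (hS p hp).2.2.2⟩)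
  have hs0 : 0 ≤ s := by
    apply Finset.sum_nonneg
    intro p hp
    rw [mem_blk] at hp
    exact (hS p hp.1).2.1
  have hP := blk_prod S L j κ g hL hS
  have h1 : (s * exp 2) ^ n / (n.factorial : ℝ) ≤ exp (s * exp 2) :=
    Real.pow_div_factorial_le_exp _ (by positivity) n
  have he : exp 2 ≤ 7.5 := by
    have := Real.exp_one_lt_d9
    have h2 : exp 2 = exp 1 * exp 1 := by rw [← exp_add]; norm_num
    rw [h2]
    have := exp_pos 1
    nlinarith
  have h2 : s ^ n / (n.factorial : ℝ) ≤ exp (s * exp 2 - 2 * n) := by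
    rw [exp_sub, le_div_iff₀ (exp_pos _)]
    calc s ^ n / (n.factorial : ℝ) * exp (2 * n) = (s * exp 2) ^ n / (n.factorial : ℝ) := by
          rw [mul_pow, ← Real.exp_nat_mul]; ring_nf
      _ ≤ _ := h1
  have h3 : s * exp 2 - 2 * n ≤ - (j + 3 : ℝ) + - 12 * κ := by
    have : s * exp 2 ≤ 6 * κ * 7.5 := by gcongr
    have hk1 : (1 : ℝ) ≤ κ := by exact_mod_cast hκ
    rw [hn]; push_cast
    have hj : (0 : ℝ) ≤ j := by positivity
    nlinarith
  have h4 : exp (- (j + 3 : ℝ)) ≤ (1 / 2) ^ (j + 3) := by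
    have : exp (-(j + 3 : ℝ)) = (exp (-1)) ^ (j + 3) := by
      rw [← Real.exp_nat_mul]; push_cast; ring_nf
    rw [this]
    gcongr
    rw [exp_neg, one_div]
    gcongr
    linarith [Real.add_one_le_exp (1 : ℝ)]
  calc s ^ n / (n.factorial : ℝ) ≤ exp (s * exp 2 - 2 * n) := h2
    _ ≤ exp (- (j + 3 : ℝ) + - 12 * κ) := exp_le_exp.2 h3
    _ = exp (- (j + 3 : ℝ)) * exp (- 12 * κ) := exp_add _ _
    _ ≤ _ := by gcongr

lemma blk_card (S : Finset ℕ) (L : ℝ) (hL : 0 ≤ L) (hS : ∀ p ∈ S, p.Prime ∧ log p ≤ L) :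
    (S.card + 1 : ℝ) ≤ exp L := by
  have hsub : S ⊆ Finset.Icc 2 ⌊exp L⌋₊ := by
    intro p hp
    obtain ⟨h1, h2⟩ := hS p hp
    rw [Finset.mem_Icc]
    refine ⟨h1.two_le, Nat.le_floor ?_⟩
    rw [← Real.exp_log (show (0 : ℝ) < p by exact_mod_cast h1.pos)]
    exact exp_le_exp.2 h2
  have hc := Finset.card_le_card hsub
  rw [Nat.card_Icc] at hc
  have h1 : 1 ≤ ⌊exp L⌋₊ := by
    apply Nat.le_floor; simpa using hL
  have h2 : S.card + 1 ≤ ⌊exp L⌋₊ := by omega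
  calc (S.card + 1 : ℝ) ≤ (⌊exp L⌋₊ : ℝ) := by exact_mod_cast h2
    _ ≤ exp L := Nat.floor_le (exp_pos _).le

lemma blk_exists (S : Finset ℕ) (L : ℝ) (J : ℕ)
    (hS : ∀ p ∈ S, p.Prime ∧ log p ≤ L) (hJ : L < 2 ^ J * log 2) (p : ℕ) (hp : p ∈ S) :
    ∃ j : Fin J, p ∈ blk S L j := by
  obtain ⟨h1, h2⟩ := hS p hp
  have hex : ∃ m : ℕ, L / 2 ^ m < log p := by
    refine ⟨J, lt_of_lt_of_le (b := log 2) ?_ ?_⟩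
    · rw [div_lt_iff₀ (by positivity)]; linarith
    · apply Real.log_le_log (by norm_num); exact_mod_cast h1.two_le
  have hm := Nat.find_spec hex
  have hmJ : Nat.find hex ≤ J := by
    apply Nat.find_min'
    refine lt_of_lt_of_le (b := log 2) ?_ ?_
    · rw [div_lt_iff₀ (by positivity)]; linarith
    · apply Real.log_le_log (by norm_num); exact_mod_cast h1.two_le
  have hm0 : Nat.find hex ≠ 0 := by
    intro h; rw [h] at hm; simp at hm; linarith
  obtain ⟨m, hm'⟩ := Nat.exists_eq_succ_of_ne_zero hm0
  refine ⟨⟨m, by omega⟩, ?_⟩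
  rw [mem_blk]
  refine ⟨hp, ?_, ?_⟩
  · rw [hm'] at hm; exact hm
  · have := Nat.find_min hex (m := m) (by omega)
    simpa using this

lemma blk_disj (S : Finset ℕ) (L : ℝ) (hL : 0 < L) (i j p : ℕ) (hi : p ∈ blk S L i) (hj : p ∈ blk S L j) :
    i = j := by
  rw [mem_blk] at hi hj
  have key : ∀ a b : ℕ, L / 2 ^ (a + 1) < L / 2 ^ b → b ≤ a := by
    intro a b h
    by_contra hab
    push Not at hab
    have : L / 2 ^ b ≤ L / 2 ^ (a + 1) := by
      gcongr
      · norm_num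
      · omega
    linarith
  have h1 := key i j (hi.2.1.trans_le hj.2.2)
  have h2 := key j i (hj.2.1.trans_le hi.2.2)
  omega

lemma weight_sum (κ J : ℕ) (hκ : 1 ≤ κ) :
    ∑ j : Fin J, ((48 * κ * (j.1 + 1) + 1 : ℕ) : ℝ) / 2 ^ j.1 ≤ 240 * κ := by
  have h : ∀ J : ℕ, ∑ j ∈ Finset.range J, ((j : ℝ) + 1) / 2 ^ j = 4 - 2 * (J + 2) / 2 ^ J := by
    intro J
    induction J with
    | zero => norm_num
    | succ n ih =>
      rw [Finset.sum_range_succ, ih]; push_cast; field_simp; ring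
  have hk1 : (1 : ℝ) ≤ κ := by exact_mod_cast hκ
  calc ∑ j : Fin J, ((48 * κ * (j.1 + 1) + 1 : ℕ) : ℝ) / 2 ^ j.1 
      ≤ ∑ j : Fin J, 60 * κ * (((j.1 : ℝ) + 1) / 2 ^ j.1) := by
        apply Finset.sum_le_sum
        intro j _
        push_cast
        rw [← mul_div_assoc]
        gcongr
        have hj : (0 : ℝ) ≤ (j.1 : ℝ) := by positivity
        nlinarith
    _ = 60 * κ * ∑ j ∈ Finset.range J, ((j : ℝ) + 1) / 2 ^ j := by
        rw [Finset.mul_sum, Finset.sum_range]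
    _ ≤ 60 * κ * 4 := by
        rw [h]
        have : 0 ≤ 2 * ((J : ℝ) + 2) / 2 ^ J := by positivity
        gcongr; linarith
    _ = 240 * κ := by ring

lemma prod_blocks (J : ℕ) (S : Finset ℕ) (L : ℝ) (hL : 0 < L)
    (hS : ∀ p ∈ S, p.Prime ∧ log p ≤ L) (hJ : L < 2 ^ J * log 2) (f : ℕ → ℝ) :
    ∏ j : Fin J, ∏ p ∈ blk S L j, f p = ∏ p ∈ S, f p := by
  rw [← Finset.prod_biUnion]
  · congr 1
    ext p
    simp only [Finset.mem_biUnion, Finset.mem_univ, true_and]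
    constructor
    · rintro ⟨j, hj⟩; rw [mem_blk] at hj; exact hj.1
    · intro hp; exact blk_exists S L J hS hJ p hp
  · intro i _ j _ hij
    rw [Function.onFun, Finset.disjoint_left]
    intro p hp hp'
    exact hij (Fin.ext (blk_disj S L hL i j p hp hp'))

lemma V_lower (J : ℕ) (S : Finset ℕ) (L : ℝ) (κ : ℕ) (g : ℕ → ℝ) (hL : 0 < L)
    (hS : ∀ p ∈ S, p.Prime ∧ log p ≤ L) (hJ : L < 2 ^ J * log 2)
    (hg : ∀ p ∈ S, 0 ≤ g p ∧ g p ≤ 1 / 2 ∧ g p ≤ (κ : ℝ) / p) :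
    exp (- (12 * κ * J)) ≤ ∏ p ∈ S, (1 - g p) := by
  rw [← prod_blocks J S L hL hS hJ]
  calc exp (- (12 * κ * J)) = ∏ j : Fin J, exp (- 12 * κ) := by
        rw [Finset.prod_const, ← Real.exp_nat_mul]; simp; ring
    _ ≤ _ := by
        apply Finset.prod_le_prod
        · intro _ _; positivity
        · intro j _
          exact blk_prod S L j κ g hL (fun p hp => ⟨(hS p hp).1, hg p hp⟩)

theorem sieve2 {α : Type*} (A : Finset α) (bad : ℕ → α → Prop) (g : ℕ → ℝ) (X R W : ℝ) (J : ℕ)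
    (P : Bool → Finset ℕ) (L : Bool → ℝ) (κ : Bool → ℕ)
    (hX : 0 ≤ X) (hR : 0 ≤ R) (hL : ∀ s, 0 < L s) (hκ : ∀ s, 1 ≤ κ s)
    (hdisj : Disjoint (P true) (P false))
    (hP : ∀ s, ∀ p ∈ P s, p.Prime ∧ log p ≤ L s)
    (hJ : ∀ s, L s < 2 ^ J * log 2)
    (hg : ∀ s, ∀ p ∈ P s, 0 ≤ g p ∧ g p ≤ 1 / 2 ∧ g p ≤ (κ s : ℝ) / p)
    (hW : ∑ s, 240 * (κ s : ℝ) * L s ≤ W)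
    (hcount : ∀ D ⊆ P true ∪ P false, ∑ p ∈ D, log (p : ℝ) ≤ W →
      |((A.filter (fun a => ∀ p ∈ D, bad p a)).card : ℝ) - X * ∏ p ∈ D, g p| ≤ R) :
    ((A.filter (fun a => ∀ p ∈ P true ∪ P false, ¬ bad p a)).card : ℝ) ≤
        2 * X * ∏ p ∈ P true ∪ P false, (1 - g p) + R * exp W ∧
    X / 2 * (∏ p ∈ P true ∪ P false, (1 - g p)) - (1 + 2 * J) * (R * exp W) ≤
      ((A.filter (fun a => ∀ p ∈ P true ∪ P false, ¬ bad p a)).card : ℝ) := by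
  set B : Bool × Fin J → Finset ℕ := fun j => blk (P j.1) (L j.1) j.2 with hB
  set b : Bool × Fin J → ℕ := fun j => 48 * κ j.1 * (j.2.1 + 1) with hb
  have hsum : ∑ j : Bool × Fin J, ((b j + 1 : ℕ) : ℝ) * (L j.1 / 2 ^ j.2.1) ≤ W := by
    refine le_trans ?_ hW
    rw [Fintype.sum_prod_type]
    apply Finset.sum_le_sum
    intro s _
    calc ∑ j : Fin J, ((b (s, j) + 1 : ℕ) : ℝ) * (L s / 2 ^ j.1)
        = (∑ j : Fin J, ((48 * κ s * (j.1 + 1) + 1 : ℕ) : ℝ) / 2 ^ j.1) * L s := by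
          rw [Finset.sum_mul]
          apply Finset.sum_congr rfl
          intro j _
          simp only [hb]; ring
      _ ≤ 240 * κ s * L s := by
          have := weight_sum (κ s) J (hκ s)
          have := (hL s).le
          gcongr
  have hK : ∏ j, ((B j).card + 1 : ℝ) ^ (b j + 1) ≤ exp W := by
    calc ∏ j, ((B j).card + 1 : ℝ) ^ (b j + 1) ≤ ∏ j, exp (((b j + 1 : ℕ) : ℝ) * (L j.1 / 2 ^ j.2.1)) := by
          apply Finset.prod_le_prod
          · intro j _; positivity
          · intro j _
            rw [Real.exp_nat_mul]
            gcongr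
            apply blk_card
            · have := (hL j.1).le; positivity
            · intro p hp
              simp only [hB] at hp
              rw [mem_blk] at hp
              exact ⟨(hP _ p hp.1).1, hp.2.2⟩
      _ = exp (∑ j : Bool × Fin J, ((b j + 1 : ℕ) : ℝ) * (L j.1 / 2 ^ j.2.1)) := by rw [Real.exp_sum]
      _ ≤ _ := exp_le_exp.2 hsum
  have hBd : ∀ i j : Bool × Fin J, ∀ p, p ∈ B i → p ∈ B j → i = j := by
    rintro ⟨s, i⟩ ⟨t, j⟩ p hi hj
    simp only [hB] at hi hj
    have hs : s = t := by
      have h1 := ((mem_blk _ _ _ _).1 hi).1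
      have h2 := ((mem_blk _ _ _ _).1 hj).1
      rw [Finset.disjoint_left] at hdisj
      cases s <;> cases t <;> simp_all
    subst hs
    have := blk_disj _ _ (hL s) _ _ p hi hj
    ext
    · rfl
    · exact this
  have hU : Finset.univ.biUnion B = P true ∪ P false := by
    ext p
    simp only [Finset.mem_biUnion, Finset.mem_univ, true_and, Finset.mem_union, hB]
    constructor
    · rintro ⟨⟨s, j⟩, hj⟩
      have h1 := ((mem_blk _ _ _ _).1 hj).1
      cases s
      · exact Or.inr h1
      · exact Or.inl h1
    · rintro (h | h)
      · obtain ⟨j, hj⟩ := blk_exists _ _ J (hP true) (hJ true) p h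
        exact ⟨(true, j), hj⟩
      · obtain ⟨j, hj⟩ := blk_exists _ _ J (hP false) (hJ false) p h
        exact ⟨(false, j), hj⟩
  have main := brun_hooley A B bad g X R b (fun j => (1 / 2 : ℝ) ^ (j.2.1 + 3)) hX hR
    (fun j p hp => by
      have := hg j.1 p ((mem_blk _ _ _ _).1 hp).1
      exact ⟨this.1, this.2.1⟩)
    (fun j => by simp only [hb]; exact ⟨24 * κ j.1 * (j.2.1 + 1), by ring⟩)
    (fun j => by positivity)
    (by
      rw [Fintype.sum_prod_type]
      have h2 : ∀ J : ℕ, ∑ j ∈ Finset.range J, (1 / 2 : ℝ) ^ (j + 3) = 1 / 4 - 1 / 4 * (1 / 2) ^ J := by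
        intro J
        induction J with
        | zero => norm_num
        | succ n ih =>
          rw [Finset.sum_range_succ, ih]; rw [pow_succ, pow_add]; ring
      have h3 := h2 J
      rw [Finset.sum_range] at h3
      simp only [h3, Fintype.sum_bool]
      have : 0 ≤ (1 / 2 : ℝ) ^ J := by positivity
      linarith)
    (fun j => by
      exact blk_eta (P j.1) (L j.1) j.2.1 (κ j.1) g (hL _) (hκ _)
        (fun p hp => ⟨(hP _ p hp).1, hg _ p hp⟩))
    (fun D hD => by
      have hdisD : ((Finset.univ : Finset (Bool × Fin J)) : Set (Bool × Fin J)).PairwiseDisjoint D := by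
        intro i _ j _ hij
        rw [Function.onFun, Finset.disjoint_left]
        intro p hp hp'
        exact hij (hBd i j p ((hD i).1 hp) ((hD j).1 hp'))
      have h1 := hcount (Finset.univ.biUnion D) (by
        rw [← hU]
        apply Finset.biUnion_mono
        intro j _; exact (hD j).1) (by
        rw [Finset.sum_biUnion hdisD]
        refine le_trans (Finset.sum_le_sum (fun j _ => ?_)) hsum
        calc ∑ p ∈ D j, log (p : ℝ) ≤ ∑ p ∈ D j, (L j.1 / 2 ^ j.2.1) := by
              apply Finset.sum_le_sum
              intro p hp
              exact ((mem_blk _ _ _ _).1 ((hD j).1 hp)).2.2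
          _ = (D j).card * (L j.1 / 2 ^ j.2.1) := by simp
          _ ≤ _ := by
              have := (hL j.1).le
              gcongr
              exact (hD j).2)
      rw [Finset.prod_biUnion hdisD] at h1
      convert h1 using 5
      apply Finset.filter_congr
      intro a _
      simp only [Finset.mem_biUnion, Finset.mem_univ, true_and]
      constructor
      · rintro h p ⟨j, hj⟩; exact h j p hj
      · intro h j p hp; exact h p ⟨j, hp⟩)
  have hdisB : ((Finset.univ : Finset (Bool × Fin J)) : Set (Bool × Fin J)).PairwiseDisjoint B := by
    intro i _ j _ hij
    rw [Function.onFun, Finset.disjoint_left]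
    intro p hp hp'
    exact hij (hBd i j p hp hp')
  rw [← Finset.prod_biUnion hdisB, hU] at main
  have hf : (A.filter (fun a => ∀ j, ∀ p ∈ B j, ¬ bad p a)) =
      (A.filter (fun a => ∀ p ∈ P true ∪ P false, ¬ bad p a)) := by
    apply Finset.filter_congr
    intro a _
    rw [← hU]
    simp only [Finset.mem_biUnion, Finset.mem_univ, true_and]
    constructor
    · rintro h p ⟨j, hj⟩; exact h j p hj
    · intro h j p hp; exact h p ⟨j, hp⟩
  rw [hf] at main
  have hRK := mul_le_mul_of_nonneg_left hK hR
  have hcard : (Fintype.card (Bool × Fin J) : ℝ) = 2 * J := by simp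
  rw [hcard] at main
  refine ⟨by linarith [main.1], le_trans ?_ main.2⟩
  have hJ0 : (0 : ℝ) ≤ J := by positivity
  have : (1 + 2 * (J : ℝ)) * (R * ∏ j, ((B j).card + 1 : ℝ) ^ (b j + 1)) ≤ (1 + 2 * J) * (R * exp W) := by
    gcongr
  linarith

end SieveTwo

section Dens
open Finset Real
open scoped Classical

/-- `T` is periodic modulo `M` with density `δ`. -/
def HasDens (M : ℕ) (T : ℤ → ℤ → Prop) (δ : ℝ) : Prop :=
  0 < M ∧ ∃ T' : Finset (ZMod M × ZMod M),
    (∀ u v : ℤ, T u v ↔ ((u : ZMod M), (v : ZMod M)) ∈ T') ∧ (T'.card : ℝ) = δ * (M : ℝ) ^ 2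

lemma HasDens.congr {M : ℕ} {T S : ℤ → ℤ → Prop} {δ ε : ℝ} (h : HasDens M T δ)
    (hT : ∀ u v, T u v ↔ S u v) (hδ : δ = ε) : HasDens M S ε := by
  obtain ⟨h0, T', h1, h2⟩ := h
  exact ⟨h0, T', fun u v => (hT u v).symm.trans (h1 u v), hδ ▸ h2⟩

lemma HasDens.mul {M N : ℕ} {T S : ℤ → ℤ → Prop} {δ ε : ℝ} (hMN : Nat.Coprime M N)
    (hT : HasDens M T δ) (hS : HasDens N S ε) :
    HasDens (M * N) (fun u v => T u v ∧ S u v) (δ * ε) := by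
  obtain ⟨hM, T', hT1, hT2⟩ := hT
  obtain ⟨hN, S', hS1, hS2⟩ := hS
  set e := ZMod.chineseRemainder hMN with he
  have hfst : ∀ u : ℤ, e (u : ZMod (M * N)) = ((u : ZMod M), (u : ZMod N)) := by
    intro u
    rw [map_intCast]; rfl
  let F : (ZMod (M * N) × ZMod (M * N)) ≃ ((ZMod M × ZMod M) × (ZMod N × ZMod N)) :=
    { toFun := fun z => (((e z.1).1, (e z.2).1), ((e z.1).2, (e z.2).2))
      invFun := fun y => (e.symm (y.1.1, y.2.1), e.symm (y.1.2, y.2.2))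
      left_inv := by
        intro z; simp
      right_inv := by
        intro y; simp }
  refine ⟨Nat.mul_pos hM hN, (T' ×ˢ S').map F.symm.toEmbedding, ?_, ?_⟩
  · intro u v
    rw [Finset.mem_map_equiv]
    simp only [Equiv.symm_symm, Finset.mem_product]
    have : F ((u : ZMod (M * N)), (v : ZMod (M * N))) =
      (((u : ZMod M), (v : ZMod M)), ((u : ZMod N), (v : ZMod N))) := by
      simp only [F, Equiv.coe_fn_mk, hfst]
    rw [this, hT1, hS1]
  · rw [Finset.card_map, Finset.card_product]
    push_cast
    rw [hT2, hS2]; ring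

lemma HasDens.true_one : HasDens 1 (fun _ _ => True) 1 := by
  refine ⟨one_pos, Finset.univ, ?_, ?_⟩
  · intro u v; simp
  · simp [Finset.card_univ, ZMod.card]

lemma HasDens.prod {ι : Type*} (D : Finset ι) (m : ι → ℕ) (M0 : ℕ) (T0 : ℤ → ℤ → Prop) (δ0 : ℝ)
    (bad : ι → ℤ → ℤ → Prop) (g : ι → ℝ) (h0 : HasDens M0 T0 δ0)
    (hc0 : ∀ p ∈ D, Nat.Coprime M0 (m p))
    (hc : ∀ p ∈ D, ∀ q ∈ D, p ≠ q → Nat.Coprime (m p) (m q))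
    (h : ∀ p ∈ D, HasDens (m p) (bad p) (g p)) :
    HasDens (M0 * ∏ p ∈ D, m p) (fun u v => T0 u v ∧ ∀ p ∈ D, bad p u v) (δ0 * ∏ p ∈ D, g p) := by
  induction D using Finset.induction_on with
  | empty => simpa using h0
  | insert p D hp ih =>
    have ih' := ih (fun q hq => hc0 q (Finset.mem_insert_of_mem hq))
      (fun q hq r hr => hc q (Finset.mem_insert_of_mem hq) r (Finset.mem_insert_of_mem hr))
      (fun q hq => h q (Finset.mem_insert_of_mem hq))
    have hcop : Nat.Coprime (M0 * ∏ q ∈ D, m q) (m p) := by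
      apply Nat.Coprime.mul_left
      · exact hc0 p (Finset.mem_insert_self _ _)
      · apply Nat.Coprime.prod_left
        intro q hq
        apply hc q (Finset.mem_insert_of_mem hq) p (Finset.mem_insert_self _ _)
        rintro rfl; exact hp hq
    have := ih'.mul hcop (h p (Finset.mem_insert_self _ _))
    rw [Finset.prod_insert hp, Finset.prod_insert hp]
    have e1 : M0 * (m p * ∏ q ∈ D, m q) = M0 * (∏ q ∈ D, m q) * m p := by ring
    rw [e1]
    refine this.congr ?_ (by ring)
    intro u v
    simp only [Finset.forall_mem_insert]
    tauto

lemma count_res (M : ℕ) (hM : 0 < M) (A : ℤ) (H : ℕ) (r : ZMod M) :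
    |(((Finset.Ico A (A + H)).filter (fun u : ℤ => (u : ZMod M) = r)).card : ℝ) - H / M| ≤ 1 := by
  have : NeZero M := ⟨hM.ne'⟩
  have hMz : (0 : ℤ) < M := by exact_mod_cast hM
  have hr : ∀ u : ℤ, (u : ZMod M) = r ↔ u ≡ (r.val : ℤ) [ZMOD M] := by
    intro u
    rw [← ZMod.intCast_eq_intCast_iff]
    simp
  have h1 := Int.Ico_filter_modEq_card A (A + H) hMz (r.val : ℤ)
  have h2 : ((Finset.Ico A (A + H)).filter (fun u : ℤ => (u : ZMod M) = r)) =
      (Finset.Ico A (A + H)).filter (fun u : ℤ => u ≡ (r.val : ℤ) [ZMOD M]) := by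
    apply Finset.filter_congr
    intro u _
    exact hr u
  rw [h2]
  set N := ((Finset.Ico A (A + H)).filter (fun u : ℤ => u ≡ (r.val : ℤ) [ZMOD M])).card with hN
  set c1 := ⌈((A + H - (r.val : ℤ) : ℤ) : ℚ) / (M : ℚ)⌉ with hc1
  set c2 := ⌈((A - (r.val : ℤ) : ℤ) : ℚ) / (M : ℚ)⌉ with hc2
  have h3 : (N : ℤ) = max (c1 - c2) 0 := by
    rw [hc1, hc2]
    push_cast at h1 ⊢
    exact h1
  have hMq : (0 : ℚ) < M := by exact_mod_cast hM
  have b1 := Int.le_ceil (((A + H - (r.val : ℤ) : ℤ) : ℚ) / (M : ℚ))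
  have b2 := Int.ceil_lt_add_one (((A + H - (r.val : ℤ) : ℤ) : ℚ) / (M : ℚ))
  have b3 := Int.le_ceil (((A - (r.val : ℤ) : ℤ) : ℚ) / (M : ℚ))
  have b4 := Int.ceil_lt_add_one (((A - (r.val : ℤ) : ℤ) : ℚ) / (M : ℚ))
  rw [← hc1] at b1 b2
  rw [← hc2] at b3 b4
  have hdiff : ((A + H - (r.val : ℤ) : ℤ) : ℚ) / (M : ℚ) = ((A - (r.val : ℤ) : ℤ) : ℚ) / (M : ℚ) + H / M := by
    push_cast; ring
  have hH : (0 : ℚ) ≤ (H : ℚ) / M := by positivity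
  have hge : 0 ≤ c1 - c2 := by
    rw [hc1, hc2, sub_nonneg]
    apply Int.ceil_le_ceil
    rw [hdiff]; linarith
  rw [max_eq_left hge] at h3
  have h4 : (N : ℚ) = c1 - c2 := by exact_mod_cast h3
  have h5 : |(N : ℚ) - H / M| ≤ 1 := by
    rw [h4, abs_le]; constructor <;> linarith
  have h6 : ((|(N : ℚ) - H / M| : ℚ) : ℝ) ≤ ((1 : ℚ) : ℝ) := by exact_mod_cast h5
  push_cast at h6
  exact h6

lemma box_count {M : ℕ} {T : ℤ → ℤ → Prop} {δ : ℝ} (h : HasDens M T δ) (A B : ℤ) (H K : ℕ) :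
    |((((Finset.Ico A (A + H)) ×ˢ (Finset.Ico B (B + K))).filter (fun z : ℤ × ℤ => T z.1 z.2)).card : ℝ)
      - δ * H * K| ≤ (H + K) * M + (M : ℝ) ^ 2 := by
  obtain ⟨hM, T', hT1, hT2⟩ := h
  have : NeZero M := ⟨hM.ne'⟩
  set N : ZMod M → ℝ := fun r => (((Finset.Ico A (A + H)).filter (fun u : ℤ => (u : ZMod M) = r)).card : ℝ)
  set N' : ZMod M → ℝ := fun r => (((Finset.Ico B (B + K)).filter (fun u : ℤ => (u : ZMod M) = r)).card : ℝ)
  have hcard : ((((Finset.Ico A (A + H)) ×ˢ (Finset.Ico B (B + K))).filter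
      (fun z : ℤ × ℤ => T z.1 z.2)).card : ℝ) = ∑ t ∈ T', N t.1 * N' t.2 := by
    rw [Finset.card_eq_sum_card_fiberwise (f := fun z : ℤ × ℤ => ((z.1 : ZMod M), (z.2 : ZMod M))) (t := T')]
    · push_cast
      apply Finset.sum_congr rfl
      intro t ht
      simp only [N, N']
      rw [← Nat.cast_mul, ← Finset.card_product, ← Finset.filter_product, Finset.filter_filter]
      congr 2
      apply Finset.filter_congr
      intro z _
      rw [hT1]
      constructor
      · rintro ⟨_, h2⟩; rw [← h2]; simp
      · rintro ⟨h2, h3⟩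
        rw [h2, h3]; exact ⟨ht, rfl⟩
    · intro z hz
      have := (Finset.mem_filter.1 hz).2
      exact (hT1 _ _).1 this
  have hMr : (0 : ℝ) < M := by exact_mod_cast hM
  have hmain : δ * H * K = ∑ t ∈ T', (H / M : ℝ) * (K / M) := by
    rw [Finset.sum_const, nsmul_eq_mul, hT2]
    field_simp
  rw [hcard, hmain, ← Finset.sum_sub_distrib]
  refine (Finset.abs_sum_le_sum_abs _ _).trans ?_
  have hterm : ∀ t ∈ T', |N t.1 * N' t.2 - (H / M : ℝ) * (K / M)| ≤ H / M + K / M + 1 := by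
    intro t _
    have h1 := count_res M hM A H t.1
    have h2 := count_res M hM B K t.2
    change |N t.1 - H / M| ≤ 1 at h1
    change |N' t.2 - K / M| ≤ 1 at h2
    have e : N t.1 * N' t.2 - (H / M : ℝ) * (K / M) =
      (N t.1 - H / M) * (N' t.2 - K / M) + (N t.1 - H / M) * (K / M) + (H / M) * (N' t.2 - K / M) := by ring
    have hH : (0 : ℝ) ≤ H / M := by positivity
    have hK : (0 : ℝ) ≤ K / M := by positivity
    rw [e]
    calc _ ≤ |(N t.1 - H / M) * (N' t.2 - K / M)| + |(N t.1 - H / M) * (K / M)| + |(H / M) * (N' t.2 - K / M)| :=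
          (abs_add_le _ _).trans (by gcongr; exact abs_add_le _ _)
      _ = |N t.1 - H / M| * |N' t.2 - K / M| + |N t.1 - H / M| * (K / M) + (H / M) * |N' t.2 - K / M| := by
          rw [abs_mul, abs_mul, abs_mul, abs_of_nonneg hH, abs_of_nonneg hK]
      _ ≤ 1 * 1 + 1 * (K / M) + H / M * 1 := by gcongr
      _ = _ := by ring
  have hT'card : (T'.card : ℝ) ≤ (M : ℝ) ^ 2 := by
    have := Finset.card_le_univ T'
    rw [Fintype.card_prod, ZMod.card] at this
    calc (T'.card : ℝ) ≤ ((M * M : ℕ) : ℝ) := by exact_mod_cast this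
      _ = _ := by push_cast; ring
  calc _ ≤ ∑ t ∈ T', ((H : ℝ) / M + K / M + 1) := Finset.sum_le_sum hterm
    _ = T'.card * ((H : ℝ) / M + K / M + 1) := by rw [Finset.sum_const, nsmul_eq_mul]
    _ ≤ (M : ℝ) ^ 2 * ((H : ℝ) / M + K / M + 1) := by gcongr
    _ = _ := by field_simp

theorem sieve_box (A B : ℤ) (H K : ℕ) (M0 : ℕ) (T0 : ℤ → ℤ → Prop) (δ0 : ℝ)
    (bad : ℕ → ℤ → ℤ → Prop) (g : ℕ → ℝ) (W : ℝ) (J : ℕ)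
    (P : Bool → Finset ℕ) (L : Bool → ℝ) (κ : Bool → ℕ)
    (hδ0 : 0 ≤ δ0) (h0 : HasDens M0 T0 δ0) (hL : ∀ s, 0 < L s) (hκ : ∀ s, 1 ≤ κ s)
    (hdisj : Disjoint (P true) (P false))
    (hP : ∀ s, ∀ p ∈ P s, p.Prime ∧ log p ≤ L s)
    (hJ : ∀ s, L s < 2 ^ J * log 2)
    (hg : ∀ s, ∀ p ∈ P s, 0 ≤ g p ∧ g p ≤ 1 / 2 ∧ g p ≤ (κ s : ℝ) / p)
    (hW : ∑ s, 240 * (κ s : ℝ) * L s ≤ W)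
    (hM0 : ∀ p ∈ P true ∪ P false, Nat.Coprime M0 p)
    (hbad : ∀ p ∈ P true ∪ P false, HasDens p (bad p) (g p)) :
    let S : ℝ := ((((Finset.Ico A (A + H)) ×ˢ (Finset.Ico B (B + K))).filter
      (fun z : ℤ × ℤ => T0 z.1 z.2 ∧ ∀ p ∈ P true ∪ P false, ¬ bad p z.1 z.2)).card : ℝ)
    let V : ℝ := ∏ p ∈ P true ∪ P false, (1 - g p)
    let R : ℝ := (H + K) * (M0 * exp W) + (M0 * exp W) ^ 2
    S ≤ 2 * (δ0 * H * K) * V + R * exp W ∧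
    (δ0 * H * K) / 2 * V - (1 + 2 * J) * (R * exp W) ≤ S := by
  intro S V R
  have hprime : ∀ p ∈ P true ∪ P false, p.Prime := by
    intro p hp
    rcases Finset.mem_union.1 hp with h | h
    · exact (hP _ p h).1
    · exact (hP _ p h).1
  have main := sieve2 (((Finset.Ico A (A + H)) ×ˢ (Finset.Ico B (B + K))).filter
      (fun z : ℤ × ℤ => T0 z.1 z.2)) (fun p z => bad p z.1 z.2) g (δ0 * H * K) R W J P L κ
      (by positivity) (by positivity) hL hκ hdisj hP hJ hg hW (by
      intro D hD hDW
      have hd := HasDens.prod D (fun p => p) M0 T0 δ0 bad g h0 (fun p hp => hM0 p (hD hp))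
        (fun p hp q hq hpq => (Nat.coprime_primes (hprime p (hD hp)) (hprime q (hD hq))).2 hpq)
        (fun p hp => hbad p (hD hp))
      have hb := box_count hd A B H K
      rw [Finset.filter_filter]
      have e : δ0 * H * K * ∏ p ∈ D, g p = δ0 * (∏ p ∈ D, g p) * H * K := by ring
      rw [e]
      refine le_trans (le_of_eq ?_) (hb.trans ?_)
      · congr!
      have hM : ((M0 * ∏ p ∈ D, p : ℕ) : ℝ) ≤ M0 * exp W := by
        push_cast
        gcongr
        have : ∏ p ∈ D, (p : ℝ) = exp (∑ p ∈ D, log (p : ℝ)) := by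
          rw [Real.exp_sum]
          apply Finset.prod_congr rfl
          intro p hp
          rw [Real.exp_log]
          exact_mod_cast (hprime p (hD hp)).pos
        rw [this]
        exact exp_le_exp.2 hDW
      simp only [R]
      gcongr)
  rw [Finset.filter_filter] at main
  exact main

end Dens

section Local
open Finset Real
open scoped Classical

lemma HasDens.of_pred (M : ℕ) [NeZero M] (φ : ZMod M → ZMod M → Prop) (S : Finset (ZMod M × ZMod M))
    (hS : ∀ z, z ∈ S ↔ φ z.1 z.2) (T : ℤ → ℤ → Prop)
    (h : ∀ u v : ℤ, T u v ↔ φ u v) (N : ℝ) (δ : ℝ)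
    (hN : (S.card : ℝ) = N)
    (hδ : N = δ * (M : ℝ) ^ 2) :
    HasDens M T δ := by
  refine ⟨NeZero.pos M, S, ?_, hN.trans hδ⟩
  intro u v
  rw [h, hS]

lemma HasDens.card_box {M : ℕ} {T : ℤ → ℤ → Prop} {δ : ℝ} (h : HasDens M T δ) :
    (((Finset.Ico (0 : ℤ) M ×ˢ Finset.Ico (0 : ℤ) M).filter (fun z : ℤ × ℤ => T z.1 z.2)).card : ℝ)
      = δ * (M : ℝ) ^ 2 := by
  obtain ⟨hM, T', hT1, hT2⟩ := h
  have : NeZero M := ⟨hM.ne'⟩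
  rw [← hT2]
  congr 1
  refine Finset.card_nbij' (fun z : ℤ × ℤ => ((z.1 : ZMod M), (z.2 : ZMod M)))
    (fun z => ((z.1.val : ℤ), (z.2.val : ℤ))) ?_ ?_ ?_ ?_
  · intro z hz
    exact (hT1 _ _).1 (Finset.mem_filter.1 hz).2
  · intro z hz
    rw [Finset.mem_coe, Finset.mem_filter, Finset.mem_product, Finset.mem_Ico, Finset.mem_Ico]
    have hv1 := ZMod.val_lt z.1
    have hv2 := ZMod.val_lt z.2
    refine ⟨⟨⟨by positivity, Int.ofNat_lt.2 hv1⟩, ⟨by positivity, Int.ofNat_lt.2 hv2⟩⟩, ?_⟩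
    rw [hT1]; simpa using hz
  · intro z hz
    rw [Finset.mem_coe, Finset.mem_filter, Finset.mem_product, Finset.mem_Ico, Finset.mem_Ico] at hz
    ext
    · simp only [ZMod.val_intCast]; exact Int.emod_eq_of_lt hz.1.1.1 hz.1.1.2
    · simp only [ZMod.val_intCast]; exact Int.emod_eq_of_lt hz.1.2.1 hz.1.2.2
  · intro z _
    simp

lemma HasDens.of_box {M : ℕ} {T : ℤ → ℤ → Prop} {δ : ℝ} (hM : 0 < M)
    (hper : ∀ u v u' v' : ℤ, (M : ℤ) ∣ u - u' → (M : ℤ) ∣ v - v' → T u v → T u' v')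
    (hc : (((Finset.Ico (0 : ℤ) M ×ˢ Finset.Ico (0 : ℤ) M).filter (fun z : ℤ × ℤ => T z.1 z.2)).card : ℝ)
      = δ * (M : ℝ) ^ 2) : HasDens M T δ := by
  have : NeZero M := ⟨hM.ne'⟩
  set T' : Finset (ZMod M × ZMod M) := Finset.univ.filter (fun z => T (z.1.val : ℤ) (z.2.val : ℤ)) with hT'
  have hmem : ∀ u v : ℤ, T u v ↔ ((u : ZMod M), (v : ZMod M)) ∈ T' := by
    intro u v
    rw [hT', Finset.mem_filter]
    simp only [Finset.mem_univ, true_and, ZMod.val_intCast]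
    constructor
    · apply hper
      · exact Int.dvd_self_sub_emod
      · exact Int.dvd_self_sub_emod
    · apply hper
      · rw [← dvd_neg, neg_sub]; exact Int.dvd_self_sub_emod
      · rw [← dvd_neg, neg_sub]; exact Int.dvd_self_sub_emod
  have h1 : HasDens M T ((T'.card : ℝ) / (M : ℝ) ^ 2) := by
    refine ⟨hM, T', hmem, ?_⟩
    have hM0 : ((M : ℝ) ^ 2) ≠ 0 := by positivity
    rw [div_mul_cancel₀ _ hM0]
  have h2 := h1.card_box
  rw [hc] at h2
  refine h1.congr (fun _ _ => Iff.rfl) ?_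
  have : ((M : ℝ) ^ 2) ≠ 0 := by positivity
  exact (mul_right_cancel₀ this h2).symm

lemma dens_lin (p : ℕ) (hp : p.Prime) (c α β : ℤ) (h : ¬ ((p : ℤ) ∣ α ∧ (p : ℤ) ∣ β)) :
    HasDens p (fun s t => (p : ℤ) ∣ c + α * s + β * t) (1 / p) := by
  have : Fact p.Prime := ⟨hp⟩
  have hp0 : (p : ℝ) ≠ 0 := by exact_mod_cast hp.ne_zero
  refine HasDens.of_pred p (fun s t => (c : ZMod p) + α * s + β * t = 0)
    (Finset.univ.filter (fun z : ZMod p × ZMod p => (c : ZMod p) + α * z.1 + β * z.2 = 0)) (by simp) _ ?_ p _ ?_ (by field_simp)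
  · intro s t
    rw [← ZMod.intCast_zmod_eq_zero_iff_dvd]; push_cast; rfl
  · congr 1
    have hcard : Fintype.card (ZMod p) = p := ZMod.card p
    conv_rhs => rw [← hcard, ← Finset.card_univ]
    by_cases hβ : (β : ZMod p) = 0
    · have hα : (α : ZMod p) ≠ 0 := by
        intro hα
        rw [ZMod.intCast_zmod_eq_zero_iff_dvd] at hα hβ
        exact h ⟨hα, hβ⟩
      refine Finset.card_nbij' (fun z => z.2) (fun t => (-(c + β * t) / α, t)) ?_ ?_ ?_ ?_
      · intro z _; simp
      · intro t _
        simp only [Finset.coe_filter, Set.mem_ofPred_eq, Finset.mem_univ, true_and]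
        field_simp; ring
      · intro z hz
        simp only [Finset.coe_filter, Set.mem_ofPred_eq, Finset.mem_univ, true_and] at hz
        ext
        · simp only
          rw [div_eq_iff hα]; linear_combination -hz
        · rfl
      · intro t _; rfl
    · refine Finset.card_nbij' (fun z => z.1) (fun s => (s, -(c + α * s) / β)) ?_ ?_ ?_ ?_
      · intro z _; simp
      · intro t _
        simp only [Finset.coe_filter, Set.mem_ofPred_eq, Finset.mem_univ, true_and]
        field_simp; ring
      · intro z hz
        simp only [Finset.coe_filter, Set.mem_ofPred_eq, Finset.mem_univ, true_and] at hz
        ext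
        · rfl
        · simp only
          rw [div_eq_iff hβ]; linear_combination -hz
      · intro t _; rfl

lemma dens_lift (p : ℕ) (hp : p.Prime) (hp2 : p ≠ 2) (T : ZMod p → ZMod p → Prop) (hT : ¬ T 0 0)
    (m : ℤ) (f : ℕ) (hf : 1 ≤ f) (δ : ℝ)
    (h : HasDens (p ^ f) (fun u v => ((p : ℤ) ^ f ∣ u ^ 2 + v ^ 2 - m) ∧ T u v) δ) :
    HasDens (p ^ (f + 1)) (fun u v => ((p : ℤ) ^ (f + 1) ∣ u ^ 2 + v ^ 2 - m) ∧ T u v) (δ / p) := by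
  have hp0 : (p : ℝ) ≠ 0 := by exact_mod_cast hp.ne_zero
  have hpz : (p : ℤ) ≠ 0 := by exact_mod_cast hp.ne_zero
  have hpf : (0 : ℤ) < (p : ℤ) ^ f := by have := hp.pos; positivity
  have hpp : (0 : ℤ) < (p : ℤ) := by exact_mod_cast hp.pos
  have hTp : ∀ u u' v v' : ℤ, (p : ℤ) ∣ u - u' → (p : ℤ) ∣ v - v' →
      (T (u : ZMod p) (v : ZMod p) ↔ T (u' : ZMod p) (v' : ZMod p)) := by
    intro u u' v v' h1 h2
    rw [(ZMod.intCast_eq_intCast_iff_dvd_sub u' u p).2 h1,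
      (ZMod.intCast_eq_intCast_iff_dvd_sub v' v p).2 h2]
  have hsq : ∀ (n : ℤ) (u u' v v' : ℤ), n ∣ u - u' → n ∣ v - v' →
      n ∣ u ^ 2 + v ^ 2 - m → n ∣ u' ^ 2 + v' ^ 2 - m := by
    intro n u u' v v' h1 h2 h3
    have e : u' ^ 2 + v' ^ 2 - m = (u ^ 2 + v ^ 2 - m) - (u - u') * (u + u') - (v - v') * (v + v') := by ring
    rw [e]
    exact dvd_sub (dvd_sub h3 (h1.mul_right _)) (h2.mul_right _)
  apply HasDens.of_box (pow_pos hp.pos _)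
  · intro u v u' v' h1 h2 ⟨h3, h4⟩
    push_cast at h1 h2
    refine ⟨hsq _ u u' v v' h1 h2 h3, ?_⟩
    have hd : (p : ℤ) ∣ (p : ℤ) ^ (f + 1) := dvd_pow_self _ (by omega)
    exact (hTp u u' v v' (hd.trans h1) (hd.trans h2)).1 h4
  · have hbox := h.card_box
    rw [Finset.card_eq_sum_card_fiberwise (f := fun z : ℤ × ℤ => (z.1 % (p : ℤ) ^ f, z.2 % (p : ℤ) ^ f))
      (t := (Finset.Ico (0 : ℤ) ((p ^ f : ℕ) : ℤ) ×ˢ Finset.Ico (0 : ℤ) ((p ^ f : ℕ) : ℤ)).filter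
        (fun z : ℤ × ℤ => (p : ℤ) ^ f ∣ z.1 ^ 2 + z.2 ^ 2 - m ∧ T z.1 z.2))]
    · have hfib : ∀ z ∈ (Finset.Ico (0 : ℤ) ((p ^ f : ℕ) : ℤ) ×ˢ Finset.Ico (0 : ℤ) ((p ^ f : ℕ) : ℤ)).filter
        (fun z : ℤ × ℤ => (p : ℤ) ^ f ∣ z.1 ^ 2 + z.2 ^ 2 - m ∧ T z.1 z.2),
        ((((Finset.Ico (0 : ℤ) ((p ^ (f + 1) : ℕ) : ℤ) ×ˢ Finset.Ico (0 : ℤ) ((p ^ (f + 1) : ℕ) : ℤ)).filter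
        (fun z : ℤ × ℤ => (p : ℤ) ^ (f + 1) ∣ z.1 ^ 2 + z.2 ^ 2 - m ∧ T z.1 z.2)).filter
        (fun y : ℤ × ℤ => (y.1 % (p : ℤ) ^ f, y.2 % (p : ℤ) ^ f) = z)).card : ℝ) = p := by
        rintro ⟨u, v⟩ hz
        rw [Finset.mem_filter, Finset.mem_product, Finset.mem_Ico, Finset.mem_Ico] at hz
        obtain ⟨⟨⟨hu0, hu1⟩, ⟨hv0, hv1⟩⟩, ⟨c, hc⟩, hTuv⟩ := hz
        simp only at hu0 hu1 hv0 hv1 hc hTuv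
        push_cast at hu1 hv1
        have hnd : ¬ ((p : ℤ) ∣ 2 * u ∧ (p : ℤ) ∣ 2 * v) := by
          rintro ⟨h1, h2⟩
          have hcop : IsCoprime (p : ℤ) 2 := by
            have h2 := Nat.isCoprime_iff_coprime.2 ((Nat.coprime_primes hp Nat.prime_two).2 hp2)
            exact_mod_cast h2
          have h1' := hcop.dvd_of_dvd_mul_left h1
          have h2' := hcop.dvd_of_dvd_mul_left h2
          rw [← ZMod.intCast_zmod_eq_zero_iff_dvd] at h1' h2'
          rw [h1', h2'] at hTuv
          exact hT hTuv
        have hl := (dens_lin p hp c (2 * u) (2 * v) hnd).card_box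
        have e1 : (1 / (p : ℝ)) * (p : ℝ) ^ 2 = p := by field_simp
        rw [e1] at hl
        rw [← hl]
        congr 1
        have hmodu : ∀ s : ℤ, (u + (p : ℤ) ^ f * s) % (p : ℤ) ^ f = u := by
          intro s; rw [Int.add_mul_emod_self_left]; exact Int.emod_eq_of_lt hu0 hu1
        have hmodv : ∀ s : ℤ, (v + (p : ℤ) ^ f * s) % (p : ℤ) ^ f = v := by
          intro s; rw [Int.add_mul_emod_self_left]; exact Int.emod_eq_of_lt hv0 hv1
        have hdivu : ∀ s : ℤ, (u + (p : ℤ) ^ f * s) / (p : ℤ) ^ f = s := by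
          intro s; rw [Int.add_mul_ediv_left _ _ hpf.ne', Int.ediv_eq_zero_of_lt hu0 hu1]; ring
        have hdivv : ∀ s : ℤ, (v + (p : ℤ) ^ f * s) / (p : ℤ) ^ f = s := by
          intro s; rw [Int.add_mul_ediv_left _ _ hpf.ne', Int.ediv_eq_zero_of_lt hv0 hv1]; ring
        have hdf : (p : ℤ) ∣ (p : ℤ) ^ f := dvd_pow_self _ (by omega)
        have hkey : ∀ s t : ℤ, ((p : ℤ) ^ (f + 1) ∣ (u + (p : ℤ) ^ f * s) ^ 2 + (v + (p : ℤ) ^ f * t) ^ 2 - m) ↔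
            (p : ℤ) ∣ c + 2 * u * s + 2 * v * t := by
          intro s t
          have e : (u + (p : ℤ) ^ f * s) ^ 2 + (v + (p : ℤ) ^ f * t) ^ 2 - m =
            (p : ℤ) ^ f * ((c + 2 * u * s + 2 * v * t) + (p : ℤ) ^ f * (s ^ 2 + t ^ 2)) := by
            linear_combination hc
          rw [e, pow_succ, mul_dvd_mul_iff_left hpf.ne']
          exact dvd_add_left (hdf.mul_right _)
        have hrange : ∀ a s : ℤ, 0 ≤ a → a < (p : ℤ) ^ f →
            ((0 ≤ a + (p : ℤ) ^ f * s ∧ a + (p : ℤ) ^ f * s < (p : ℤ) ^ (f + 1)) ↔ (0 ≤ s ∧ s < p)) := by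
          intro a s ha ha'
          rw [pow_succ]
          constructor
          · rintro ⟨h1, h2⟩
            constructor
            · by_contra hs
              push Not at hs
              have : s ≤ -1 := by omega
              nlinarith
            · by_contra hs
              push Not at hs
              nlinarith
          · rintro ⟨h1, h2⟩
            have : s ≤ p - 1 := by omega
            constructor
            · positivity
            · nlinarith
        refine Finset.card_nbij' (fun y : ℤ × ℤ => (y.1 / (p : ℤ) ^ f, y.2 / (p : ℤ) ^ f))
          (fun y => (u + (p : ℤ) ^ f * y.1, v + (p : ℤ) ^ f * y.2)) ?_ ?_ ?_ ?_
        · rintro ⟨U, V⟩ hy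
          simp only [Finset.coe_filter, Finset.mem_filter, Finset.mem_product, Finset.mem_Ico, Set.mem_ofPred_eq,
            Prod.mk.injEq] at hy ⊢
          obtain ⟨⟨⟨hU, hV⟩, hd, _⟩, hU2, hV2⟩ := hy
          have eU : U = u + (p : ℤ) ^ f * (U / (p : ℤ) ^ f) := by
            rw [← hU2]; exact (Int.emod_add_mul_ediv U _).symm
          have eV : V = v + (p : ℤ) ^ f * (V / (p : ℤ) ^ f) := by
            rw [← hV2]; exact (Int.emod_add_mul_ediv V _).symm
          push_cast at hU hV
          rw [eU] at hU
          rw [eV] at hV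
          rw [eU, eV] at hd
          rw [hkey] at hd
          exact ⟨⟨(hrange _ _ hu0 hu1).1 hU, (hrange _ _ hv0 hv1).1 hV⟩, hd⟩
        · rintro ⟨s, t⟩ hy
          simp only [Finset.coe_filter, Finset.mem_filter, Finset.mem_product, Finset.mem_Ico, Set.mem_ofPred_eq,
            Prod.mk.injEq] at hy ⊢
          obtain ⟨⟨hs, ht⟩, hd⟩ := hy
          push_cast
          refine ⟨⟨⟨(hrange _ _ hu0 hu1).2 hs, (hrange _ _ hv0 hv1).2 ht⟩, (hkey _ _).2 hd, ?_⟩, hmodu s, hmodv t⟩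
          have := (hTp (u + (p : ℤ) ^ f * s) u (v + (p : ℤ) ^ f * t) v (by
            rw [add_sub_cancel_left]; exact hdf.mul_right _) (by
            rw [add_sub_cancel_left]; exact hdf.mul_right _)).2 hTuv
          push_cast at this
          exact this
        · rintro ⟨U, V⟩ hy
          simp only [Finset.coe_filter, Finset.mem_filter, Finset.mem_product, Finset.mem_Ico, Set.mem_ofPred_eq,
            Prod.mk.injEq] at hy ⊢
          obtain ⟨_, hU2, hV2⟩ := hy
          constructor
          · rw [← hU2]; exact Int.emod_add_mul_ediv U _
          · rw [← hV2]; exact Int.emod_add_mul_ediv V _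
        · rintro ⟨s, t⟩ hy
          simp only [hdivu, hdivv]
      rw [Nat.cast_sum]
      refine (Finset.sum_congr rfl (g := fun _ => (p : ℝ)) (fun z hz => ?_)).trans ?_
      · convert hfib z hz
        rfl
      · rw [Finset.sum_const, nsmul_eq_mul]
        calc _ = (δ * ((p ^ f : ℕ) : ℝ) ^ 2) * p := by
              congr 1
              convert hbox
              rfl
          _ = _ := by
              push_cast; field_simp; ring
    · intro z hz
      simp only [Finset.coe_filter, Finset.mem_product, Finset.mem_Ico, Set.mem_ofPred_eq] at hz ⊢
      obtain ⟨⟨hU, hV⟩, hd, hT'⟩ := hz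
      have hd' : (p : ℤ) ^ f ∣ (p : ℤ) ^ (f + 1) := pow_dvd_pow _ (by omega)
      have hdf : (p : ℤ) ∣ (p : ℤ) ^ f := dvd_pow_self _ (by omega)
      push_cast
      refine ⟨⟨⟨Int.emod_nonneg _ hpf.ne', Int.emod_lt_of_pos _ hpf⟩,
        ⟨Int.emod_nonneg _ hpf.ne', Int.emod_lt_of_pos _ hpf⟩⟩, ?_, ?_⟩
      · exact hsq _ z.1 _ z.2 _ Int.dvd_self_sub_emod Int.dvd_self_sub_emod (hd'.trans hd)
      · have := (hTp z.1 (z.1 % (p : ℤ) ^ f) z.2 (z.2 % (p : ℤ) ^ f) (hdf.trans Int.dvd_self_sub_emod)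
          (hdf.trans Int.dvd_self_sub_emod)).1 hT'
        exact this

end Local

section Local2
open Finset Real
open scoped Classical

lemma p3_zero (p : ℕ) [Fact p.Prime] (h3 : p % 4 = 3) (u v : ZMod p) (h : u ^ 2 + v ^ 2 = 0) :
    u = 0 ∧ v = 0 := by
  by_contra hne
  have hv : v ≠ 0 := by
    rintro rfl
    apply hne
    refine ⟨?_, rfl⟩
    simpa using h
  exact ZMod.mod_four_ne_three_of_sq_eq_neg_sq' hv (x := u) (by linear_combination h) h3

lemma p3_count_eq (p : ℕ) [Fact p.Prime] (m : ZMod p) (hm : m ≠ 0) :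
    (Finset.univ.filter (fun z : ZMod p × ZMod p => z.1 ^ 2 + z.2 ^ 2 = m)).card =
    (Finset.univ.filter (fun z : ZMod p × ZMod p => z.1 ^ 2 + z.2 ^ 2 = 1)).card := by
  obtain ⟨c, d, hcd⟩ := ZMod.sq_add_sq p m
  refine Finset.card_nbij' (fun z => ((c * z.1 + d * z.2) / m, (c * z.2 - d * z.1) / m))
    (fun z => (c * z.1 - d * z.2, c * z.2 + d * z.1)) ?_ ?_ ?_ ?_
  · intro z hz
    simp only [Finset.coe_filter, Finset.mem_univ, true_and, Set.mem_ofPred_eq] at hz ⊢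
    field_simp
    linear_combination (c ^ 2 + d ^ 2) * hz + m * hcd
  · intro z hz
    simp only [Finset.coe_filter, Finset.mem_univ, true_and, Set.mem_ofPred_eq] at hz ⊢
    linear_combination (c ^ 2 + d ^ 2) * hz + hcd
  · intro z _
    ext
    · simp only
      field_simp
      linear_combination z.1 * hcd
    · simp only
      field_simp
      linear_combination z.2 * hcd
  · intro z _
    ext
    · simp only
      field_simp
      linear_combination z.1 * hcd
    · simp only
      field_simp
      linear_combination z.2 * hcd

lemma p3_count_zero (p : ℕ) [Fact p.Prime] (h3 : p % 4 = 3) :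
    (Finset.univ.filter (fun z : ZMod p × ZMod p => z.1 ^ 2 + z.2 ^ 2 = 0)).card = 1 := by
  rw [Finset.card_eq_one]
  refine ⟨(0, 0), ?_⟩
  ext z
  simp only [Finset.mem_filter, Finset.mem_univ, true_and, Finset.mem_singleton]
  constructor
  · intro h
    have := p3_zero p h3 _ _ h
    ext
    · exact this.1
    · exact this.2
  · rintro rfl; simp

lemma p3_count (p : ℕ) [Fact p.Prime] (h3 : p % 4 = 3) (m : ZMod p) (hm : m ≠ 0) :
    (Finset.univ.filter (fun z : ZMod p × ZMod p => z.1 ^ 2 + z.2 ^ 2 = m)).card = p + 1 := by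
  rw [p3_count_eq p m hm]
  set N := (Finset.univ.filter (fun z : ZMod p × ZMod p => z.1 ^ 2 + z.2 ^ 2 = 1)).card with hN
  have hp1 : 1 < p := (Fact.out : p.Prime).one_lt
  have htot : (Finset.univ : Finset (ZMod p × ZMod p)).card =
      ∑ m : ZMod p, (Finset.univ.filter (fun z : ZMod p × ZMod p => z.1 ^ 2 + z.2 ^ 2 = m)).card :=
    Finset.card_eq_sum_card_fiberwise (fun _ _ => Finset.mem_univ _)
  rw [Finset.card_univ, Fintype.card_prod, ZMod.card,
    ← Finset.add_sum_erase _ _ (Finset.mem_univ (0 : ZMod p)), p3_count_zero p h3,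
    Finset.sum_congr rfl (fun m hm => p3_count_eq p m (Finset.ne_of_mem_erase hm)), ← hN,
    Finset.sum_const, Finset.card_erase_of_mem (Finset.mem_univ _), Finset.card_univ, ZMod.card, smul_eq_mul] at htot
  obtain ⟨q, rfl⟩ : ∃ q, p = q + 1 := ⟨p - 1, by omega⟩
  simp only [Nat.add_sub_cancel] at htot
  have hq : 0 < q := by omega
  have : q * N = q * (q + 1 + 1) := by linarith
  exact Nat.eq_of_mul_eq_mul_left hq this

lemma p1_count (p : ℕ) [Fact p.Prime] (hp2 : p ≠ 2) (i : ZMod p) (hi : i ^ 2 = -1) (m : ZMod p) :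
    (Finset.univ.filter (fun z : ZMod p × ZMod p => z.1 ^ 2 + z.2 ^ 2 = m ∧ z.1 + i * z.2 ≠ 0)).card = p - 1 := by
  have h2 : (2 : ZMod p) ≠ 0 := by
    intro h
    have : ((2 : ℕ) : ZMod p) = 0 := by exact_mod_cast h
    rw [ZMod.natCast_eq_zero_iff] at this
    exact hp2 ((Nat.prime_dvd_prime_iff_eq Fact.out Nat.prime_two).1 this)
  have hi0 : i ≠ 0 := by rintro rfl; simp at hi
  have hcard : (Finset.univ.erase (0 : ZMod p)).card = p - 1 := by
    rw [Finset.card_erase_of_mem (Finset.mem_univ _), Finset.card_univ, ZMod.card]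
  rw [← hcard]
  refine Finset.card_nbij' (fun z => z.1 + i * z.2)
    (fun X => ((X + m / X) / 2, (X - m / X) / (2 * i))) ?_ ?_ ?_ ?_
  · intro z hz
    simp only [Finset.coe_filter, Finset.mem_univ, true_and, Set.mem_ofPred_eq] at hz
    simpa using hz.2
  · intro X hX
    have hX0 : X ≠ 0 := by simpa using hX
    simp only [Finset.coe_filter, Finset.mem_univ, true_and, Set.mem_ofPred_eq]
    constructor
    · field_simp
      rw [hi]; ring
    · have : (X + m / X) / 2 + i * ((X - m / X) / (2 * i)) = X := by field_simp; ring
      rw [this]; exact hX0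
  · intro z hz
    simp only [Finset.coe_filter, Finset.mem_univ, true_and, Set.mem_ofPred_eq] at hz
    obtain ⟨h1, h0⟩ := hz
    have e : m / (z.1 + i * z.2) = z.1 - i * z.2 := by
      rw [div_eq_iff h0]; linear_combination -h1 + z.2 ^ 2 * hi
    ext
    · simp only [e]; field_simp; ring
    · simp only [e]; field_simp; ring
  · intro X hX
    simp only
    have hX0 : X ≠ 0 := by simpa using hX
    field_simp; ring

lemma dens_pow3 (p : ℕ) (hp : p.Prime) (h3 : p % 4 = 3) (m : ℤ) (hm : ¬ (p : ℤ) ∣ m) (f : ℕ) (hf : 1 ≤ f) :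
    HasDens (p ^ f) (fun u v => (p : ℤ) ^ f ∣ u ^ 2 + v ^ 2 - m) ((1 + 1 / p) / (p : ℝ) ^ f) := by
  have : Fact p.Prime := ⟨hp⟩
  have hp0 : (p : ℝ) ≠ 0 := by exact_mod_cast hp.ne_zero
  have hm' : (m : ZMod p) ≠ 0 := by rwa [Ne, ZMod.intCast_zmod_eq_zero_iff_dvd]
  have key : HasDens (p ^ f) (fun u v => (p : ℤ) ^ f ∣ u ^ 2 + v ^ 2 - m ∧
      ¬ ((u : ZMod p) = 0 ∧ (v : ZMod p) = 0)) ((1 + 1 / p) / (p : ℝ) ^ f) := by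
    induction f, hf using Nat.le_induction with
    | base =>
      rw [pow_one]
      refine HasDens.of_pred p (fun u v => u ^ 2 + v ^ 2 = (m : ZMod p))
        (Finset.univ.filter (fun z : ZMod p × ZMod p => z.1 ^ 2 + z.2 ^ 2 = (m : ZMod p))) (by simp) _ ?_ (p + 1) _ ?_ (by field_simp)
      · intro u v
        rw [pow_one, ← ZMod.intCast_zmod_eq_zero_iff_dvd]; push_cast
        rw [sub_eq_zero]
        constructor
        · exact fun h => h.1
        · intro h
          refine ⟨h, ?_⟩
          rintro ⟨h1, h2⟩
          rw [h1, h2] at h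
          apply hm'; rw [← h]; ring
      · have := p3_count p h3 m hm'
        rw [this]; push_cast; rfl
    | succ f hf ih =>
      have := dens_lift p hp (by rintro rfl; omega) (fun u v => ¬ (u = 0 ∧ v = 0)) (by simp) m f hf _ ih
      refine this.congr (fun _ _ => Iff.rfl) ?_
      rw [pow_succ]; field_simp
  refine key.congr ?_ rfl
  intro u v
  constructor
  · exact fun h => h.1
  · intro h
    refine ⟨h, ?_⟩
    rintro ⟨h1, h2⟩
    have h' : (p : ℤ) ∣ u ^ 2 + v ^ 2 - m := (dvd_pow_self _ (by omega)).trans h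
    rw [← ZMod.intCast_zmod_eq_zero_iff_dvd] at h'
    push_cast at h'
    rw [h1, h2] at h'
    apply hm'
    linear_combination -h'

lemma dens_pow1 (p : ℕ) (hp : p.Prime) (h1 : p % 4 = 1) (i : ℤ) (hi : (p : ℤ) ∣ i ^ 2 + 1) (m : ℤ)
    (f : ℕ) (hf : 1 ≤ f) :
    HasDens (p ^ f) (fun u v => (p : ℤ) ^ f ∣ u ^ 2 + v ^ 2 - m ∧ ¬ (p : ℤ) ∣ u + i * v)
      ((1 - 1 / p) / (p : ℝ) ^ f) := by
  have : Fact p.Prime := ⟨hp⟩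
  have hp0 : (p : ℝ) ≠ 0 := by exact_mod_cast hp.ne_zero
  have hp2 : p ≠ 2 := by rintro rfl; omega
  have hi' : (i : ZMod p) ^ 2 = -1 := by
    rw [← ZMod.intCast_zmod_eq_zero_iff_dvd] at hi
    push_cast at hi
    linear_combination hi
  have hdv : ∀ u v : ℤ, ¬ (p : ℤ) ∣ u + i * v ↔ (u : ZMod p) + i * v ≠ 0 := by
    intro u v
    rw [← ZMod.intCast_zmod_eq_zero_iff_dvd]; push_cast; rfl
  have key : HasDens (p ^ f) (fun u v => (p : ℤ) ^ f ∣ u ^ 2 + v ^ 2 - m ∧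
      (u : ZMod p) + i * v ≠ 0) ((1 - 1 / p) / (p : ℝ) ^ f) := by
    induction f, hf using Nat.le_induction with
    | base =>
      rw [pow_one]
      refine HasDens.of_pred p (fun u v => u ^ 2 + v ^ 2 = (m : ZMod p) ∧ u + i * v ≠ 0)
        (Finset.univ.filter (fun z : ZMod p × ZMod p => z.1 ^ 2 + z.2 ^ 2 = (m : ZMod p) ∧ z.1 + i * z.2 ≠ 0)) (by simp) _ ?_
        (p - 1) _ ?_ (by field_simp)
      · intro u v
        rw [pow_one, ← ZMod.intCast_zmod_eq_zero_iff_dvd]; push_cast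
        rw [sub_eq_zero]
      · have := p1_count p hp2 i hi' m
        have h1p : 1 ≤ p := hp.one_le
        rw [← Nat.cast_one (R := ℝ), ← Nat.cast_sub h1p, ← this]
    | succ f hf ih =>
      have := dens_lift p hp hp2 (fun u v => u + i * v ≠ 0) (by simp) m f hf _ ih
      refine this.congr (fun _ _ => Iff.rfl) ?_
      rw [pow_succ]; field_simp
  refine key.congr ?_ rfl
  intro u v
  rw [hdv]

lemma dens_four (m : ℤ) (hm : m % 4 = 1) :
    HasDens 4 (fun u v => (4 : ℤ) ∣ u ^ 2 + v ^ 2 - m) (1 / 2) := by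
  refine HasDens.of_pred 4 (fun u v => u ^ 2 + v ^ 2 = 1)
    (Finset.univ.filter (fun z : ZMod 4 × ZMod 4 => z.1 ^ 2 + z.2 ^ 2 = 1)) (by simp) _ ?_ 8 _ ?_ (by norm_num)
  · intro u v
    have e : (m : ZMod 4) = 1 := by
      have : (m : ZMod 4) = ((1 : ℤ) : ZMod 4) := by
        rw [ZMod.intCast_eq_intCast_iff']; simpa using hm
      simpa using this
    have := ZMod.intCast_zmod_eq_zero_iff_dvd (u ^ 2 + v ^ 2 - m) 4
    push_cast at this
    rw [← this, e, sub_eq_zero]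
  · have h8 : (Finset.univ.filter (fun z : ZMod 4 × ZMod 4 => z.1 ^ 2 + z.2 ^ 2 = 1)).card = 8 := by decide
    have : (Finset.univ.filter (fun z : ZMod 4 × ZMod 4 => z.1 ^ 2 + z.2 ^ 2 = 1)).card = 8 := by
      convert h8
    exact_mod_cast this

lemma dens_bad1 (p : ℕ) (hp : p.Prime) (i : ℤ) :
    HasDens p (fun u v => (p : ℤ) ∣ u + i * v) (1 / p) := by
  refine (dens_lin p hp 0 1 i ?_).congr ?_ rfl
  · rintro ⟨h, _⟩
    have := Int.le_of_dvd one_pos h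
    have := hp.one_lt
    omega
  · intro u v; simp

lemma dens_class (Q : ℕ) (hQ : 0 < Q) (n0 : ℤ) :
    HasDens Q (fun n _ => (Q : ℤ) ∣ n - n0) (1 / Q) := by
  have : NeZero Q := ⟨hQ.ne'⟩
  have hQ0 : (Q : ℝ) ≠ 0 := by positivity
  refine HasDens.of_pred Q (fun n _ => n = (n0 : ZMod Q)) ({(n0 : ZMod Q)} ×ˢ Finset.univ)
    (by intro z; rw [Finset.mem_product]; simp) _ ?_ Q _ ?_ (by field_simp)
  · intro u v
    rw [← ZMod.intCast_zmod_eq_zero_iff_dvd]; push_cast; rw [sub_eq_zero]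
  · rw [Finset.card_product]; simp [ZMod.card]

/-- roots of the product of linear forms modulo `p` -/
noncomputable def rootsMod {k : ℕ} (a b : Fin k → ℤ) (p : ℕ) : Set (ZMod p) :=
  {r | ∏ i, ((a i : ZMod p) * r + b i) = 0}

lemma mem_rootsMod {k : ℕ} (a b : Fin k → ℤ) (p : ℕ) (r : ZMod p) :
    r ∈ rootsMod a b p ↔ ∏ i, ((a i : ZMod p) * r + b i) = 0 := Iff.rfl

/-- number of roots -/
noncomputable def omg {k : ℕ} (a b : Fin k → ℤ) (p : ℕ) : ℕ := (rootsMod a b p).ncard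

lemma omg_eq {k : ℕ} (a b : Fin k → ℤ) (p : ℕ) [NeZero p] :
    omg a b p = (Finset.univ.filter (fun r : ZMod p => r ∈ rootsMod a b p)).card := by
  rw [omg, ← Set.ncard_coe_finset]; congr 1; ext; simp

lemma omg_le {k : ℕ} (a b : Fin k → ℤ) (p : ℕ) (hp : p.Prime) (ha : ∀ i, ¬ (p : ℤ) ∣ a i) :
    omg a b p ≤ k := by
  have : Fact p.Prime := ⟨hp⟩
  rw [omg_eq]
  have hsub : (Finset.univ.filter (fun r : ZMod p => r ∈ rootsMod a b p)) ⊆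
      (Finset.univ : Finset (Fin k)).image (fun i => -(b i : ZMod p) / a i) := by
    intro r hr
    simp only [Finset.mem_filter, Finset.mem_univ, true_and, mem_rootsMod] at hr
    rw [Finset.prod_eq_zero_iff] at hr
    obtain ⟨i, _, hi⟩ := hr
    rw [Finset.mem_image]
    refine ⟨i, Finset.mem_univ _, ?_⟩
    have hai : (a i : ZMod p) ≠ 0 := by
      rw [Ne, ZMod.intCast_zmod_eq_zero_iff_dvd]; exact ha i
    rw [div_eq_iff hai]; linear_combination -hi
  calc _ ≤ _ := Finset.card_le_card hsub
    _ ≤ _ := Finset.card_image_le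
    _ = k := by simp

lemma omg_pos {k : ℕ} (a b : Fin k → ℤ) (p : ℕ) (hp : p.Prime) (i : Fin k) (ha : ¬ (p : ℤ) ∣ a i) :
    1 ≤ omg a b p := by
  have : Fact p.Prime := ⟨hp⟩
  rw [omg_eq]
  rw [Nat.one_le_iff_ne_zero, Finset.card_ne_zero]
  have hai : (a i : ZMod p) ≠ 0 := by
    rw [Ne, ZMod.intCast_zmod_eq_zero_iff_dvd]; exact ha
  refine ⟨-(b i : ZMod p) / a i, ?_⟩
  simp only [Finset.mem_filter, Finset.mem_univ, true_and, mem_rootsMod]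
  apply Finset.prod_eq_zero (Finset.mem_univ i)
  field_simp; ring

lemma dens_n {k : ℕ} (a b : Fin k → ℤ) (p : ℕ) (hp : p.Prime) :
    HasDens p (fun n _ => (p : ℤ) ∣ ∏ i, (a i * n + b i)) (omg a b p / p) := by
  have : Fact p.Prime := ⟨hp⟩
  have hp0 : (p : ℝ) ≠ 0 := by exact_mod_cast hp.ne_zero
  refine HasDens.of_pred p (fun n _ => n ∈ rootsMod a b p)
    ((Finset.univ.filter (fun r : ZMod p => r ∈ rootsMod a b p)) ×ˢ Finset.univ)
    (by intro z; rw [Finset.mem_product]; simp) _ ?_ (omg a b p * p) _ ?_ (by field_simp)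
  · intro u v
    rw [← ZMod.intCast_zmod_eq_zero_iff_dvd]; push_cast; rfl
  · rw [Finset.card_product, ← omg_eq]; simp [ZMod.card]

lemma dens_bad3 {k : ℕ} (a b : Fin k → ℤ) (p : ℕ) (hp : p.Prime) (h3 : p % 4 = 3) (i : Fin k)
    (ha : ¬ (p : ℤ) ∣ a i) :
    HasDens p (fun u v => ∃ r ∈ rootsMod a b p, (a i : ZMod p) * r + b i = (u : ZMod p) ^ 2 + (v : ZMod p) ^ 2)
      (1 - (1 - omg a b p / p) * (1 + 1 / p)) := by
  have : Fact p.Prime := ⟨hp⟩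
  have hp0 : (p : ℝ) ≠ 0 := by exact_mod_cast hp.ne_zero
  have hai : (a i : ZMod p) ≠ 0 := by
    rw [Ne, ZMod.intCast_zmod_eq_zero_iff_dvd]; exact ha
  set Rt := (Finset.univ.filter (fun r : ZMod p => r ∈ rootsMod a b p)) with hRt
  refine HasDens.of_pred p (fun u v => ∃ r ∈ rootsMod a b p, (a i : ZMod p) * r + b i = u ^ 2 + v ^ 2)
    (Rt.biUnion (fun r => Finset.univ.filter (fun z : ZMod p × ZMod p => z.1 ^ 2 + z.2 ^ 2 = a i * r + b i)))
    (by
      intro z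
      simp only [Finset.mem_filter, Finset.mem_univ, true_and, Finset.mem_biUnion, hRt]
      constructor
      · rintro ⟨r, hr, h⟩; exact ⟨r, hr, h.symm⟩
      · rintro ⟨r, hr, h⟩; exact ⟨r, hr, h.symm⟩) _
    (fun _ _ => Iff.rfl) (1 + (omg a b p - 1) * (p + 1)) _ ?_ (by field_simp; ring)
  rw [Finset.card_biUnion]
  · set r0 : ZMod p := -(b i : ZMod p) / a i with hr0
    have hr0' : (a i : ZMod p) * r0 + b i = 0 := by rw [hr0]; field_simp; ring
    have hr0m : r0 ∈ Rt := by
      simp only [hRt, Finset.mem_filter, Finset.mem_univ, true_and, mem_rootsMod]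
      exact Finset.prod_eq_zero (Finset.mem_univ i) hr0'
    rw [← Finset.add_sum_erase _ _ hr0m, hr0', p3_count_zero p h3,
      Finset.sum_congr rfl (fun r hr => p3_count p h3 _ (by
        intro h
        apply Finset.ne_of_mem_erase hr
        have : (a i : ZMod p) * (r - r0) = 0 := by linear_combination h - hr0'
        rcases mul_eq_zero.1 this with h' | h'
        · exact absurd h' hai
        · exact sub_eq_zero.1 h')),
      Finset.sum_const, Finset.card_erase_of_mem hr0m, hRt, ← omg_eq, smul_eq_mul]
    push_cast
    rw [Nat.cast_sub (omg_pos a b p hp i ha)]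
    push_cast; rfl
  · intro r _ s _ hrs
    rw [Function.onFun, Finset.disjoint_left]
    intro z hz hz'
    simp only [Finset.mem_filter, Finset.mem_univ, true_and] at hz hz'
    apply hrs
    have : (a i : ZMod p) * (r - s) = 0 := by linear_combination hz' - hz
    rcases mul_eq_zero.1 this with h' | h'
    · exact absurd h' hai
    · exact sub_eq_zero.1 h'

end Local2

section Base
open Finset Real
open scoped Classical

/-- primes `1 mod 4` dividing `a` -/
noncomputable def A1 (a : ℕ) : Finset ℕ := a.primeFactors.filter (fun p => p % 4 = 1)

lemma mem_A1 (a p : ℕ) (ha : 0 < a) : p ∈ A1 a ↔ p.Prime ∧ p ∣ a ∧ p % 4 = 1 := by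
  simp [A1, Nat.mem_primeFactors, ha.ne']; tauto

lemma dens_base (a : ℕ) (ha : 0 < a) (hodd : Odd a) (PW : Finset ℕ)
    (hPW : ∀ p ∈ PW, p.Prime ∧ p % 4 = 3) (hcov : ∀ p : ℕ, p.Prime → p ∣ a → p % 4 = 3 → p ∈ PW)
    (i : ℕ → ℤ) (hi : ∀ p : ℕ, p.Prime → p % 4 = 1 → (p : ℤ) ∣ i p ^ 2 + 1)
    (m : ℤ) (hm4 : m % 4 = 1) (hm : ∀ p ∈ PW, ¬ (p : ℤ) ∣ m) :
    HasDens (a * (4 * ∏ p ∈ PW, p))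
      (fun u v => ((a * (4 * ∏ p ∈ PW, p) : ℕ) : ℤ) ∣ u ^ 2 + v ^ 2 - m ∧
        ∀ p ∈ A1 a, ¬ (p : ℤ) ∣ u + i p * v)
      (2 / ((a * (4 * ∏ p ∈ PW, p) : ℕ) : ℝ) * (∏ p ∈ PW, (1 + 1 / (p : ℝ))) * ∏ p ∈ A1 a, (1 - 1 / (p : ℝ))) := by
  set D := PW ∪ A1 a with hD
  set e : ℕ → ℕ := fun p => a.factorization p + (if p ∈ PW then 1 else 0) with he
  have hdisj : Disjoint PW (A1 a) := by
    rw [Finset.disjoint_left]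
    intro p h1 h2
    have := (hPW p h1).2
    have := ((mem_A1 a p ha).1 h2).2.2
    omega
  have hDp : ∀ p ∈ D, p.Prime := by
    intro p hp
    rcases Finset.mem_union.1 hp with h | h
    · exact (hPW p h).1
    · exact ((mem_A1 a p ha).1 h).1
  have hDodd : ∀ p ∈ D, Nat.Coprime 4 p := by
    intro p hp
    have h2 : p ≠ 2 := by
      rcases Finset.mem_union.1 hp with h | h
      · have := (hPW p h).2; omega
      · have := ((mem_A1 a p ha).1 h).2.2; omega
    have : Nat.Coprime 2 p := (Nat.coprime_primes Nat.prime_two (hDp p hp)).2 h2.symm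
    have h4 := Nat.Coprime.pow_left 2 this
    simpa using h4
  have hsupp : a.primeFactors ⊆ D := by
    intro p hp
    have hp' := Nat.mem_primeFactors.1 hp
    have h2 : p ≠ 2 := by
      rintro rfl
      have := hp'.2.1
      rw [← even_iff_two_dvd] at this
      exact (Nat.not_even_iff_odd.2 hodd) this
    have h13 := hp'.1.eq_two_or_odd
    rw [hD, Finset.mem_union, mem_A1 a p ha]
    have : p % 4 = 1 ∨ p % 4 = 3 := by omega
    rcases this with h | h
    · exact Or.inr ⟨hp'.1, hp'.2.1, h⟩
    · exact Or.inl (hcov p hp'.1 hp'.2.1 h)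
  have hprod : ∏ p ∈ D, p ^ e p = a * ∏ p ∈ PW, p := by
    simp only [he, pow_add, Finset.prod_mul_distrib]
    congr 1
    · conv_rhs => rw [← Nat.prod_factorization_pow_eq_self ha.ne']
      exact (Finsupp.prod_of_support_subset _ (by simpa using hsupp) _ (by simp)).symm
    · rw [← Finset.prod_subset (Finset.subset_union_left : PW ⊆ D)]
      · apply Finset.prod_congr rfl
        intro p hp; simp [hp]
      · intro p _ hp; simp [hp]
  have hq : a * (4 * ∏ p ∈ PW, p) = 4 * ∏ p ∈ D, p ^ e p := by rw [hprod]; ring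
  set bad : ℕ → ℤ → ℤ → Prop := fun p u v => (p : ℤ) ^ e p ∣ u ^ 2 + v ^ 2 - m ∧
    (p ∈ A1 a → ¬ (p : ℤ) ∣ u + i p * v) with hbad
  set g : ℕ → ℝ := fun p => (if p ∈ PW then 1 + 1 / (p : ℝ) else 1 - 1 / (p : ℝ)) / (p : ℝ) ^ e p with hg
  have hcop : ∀ p ∈ D, ∀ q ∈ D, p ≠ q → Nat.Coprime (p ^ e p) (q ^ e q) := by
    intro p hp q hq hpq
    apply Nat.Coprime.pow
    exact (Nat.coprime_primes (hDp p hp) (hDp q hq)).2 hpq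
  have hcop0 : ∀ p ∈ D, Nat.Coprime 4 (p ^ e p) := fun p hp => Nat.Coprime.pow_right _ (hDodd p hp)
  have main := HasDens.prod D (fun p => p ^ e p) 4 _ _ bad g (dens_four m hm4) hcop0 hcop (by
    intro p hp
    by_cases hpw : p ∈ PW
    · have hpA : p ∉ A1 a := Finset.disjoint_left.1 hdisj hpw
      refine (dens_pow3 p (hPW p hpw).1 (hPW p hpw).2 m (hm p hpw) (e p) (by simp [he, hpw])).congr ?_ ?_
      · intro u v; simp [hbad, hpA]
      · simp [hg, hpw]
    · have hpA : p ∈ A1 a := by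
        rcases Finset.mem_union.1 hp with h | h
        · exact absurd h hpw
        · exact h
      have hA := (mem_A1 a p ha).1 hpA
      have hfac : 1 ≤ a.factorization p := (Nat.Prime.dvd_iff_one_le_factorization hA.1 ha.ne').1 hA.2.1
      refine (dens_pow1 p hA.1 hA.2.2 (i p) (hi p hA.1 hA.2.2) m (e p) (by simp only [he]; omega)).congr ?_ ?_
      · intro u v; simp [hbad, hpA]
      · simp [hg, hpw])
  rw [hq]
  refine main.congr ?_ ?_
  · intro u v
    constructor
    · rintro ⟨h4, hall⟩
      refine ⟨?_, fun p hp => (hall p (Finset.mem_union_right _ hp)).2 hp⟩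
      push_cast
      apply IsCoprime.mul_dvd
      · have : Nat.Coprime 4 (∏ p ∈ D, p ^ e p) := Nat.Coprime.prod_right hcop0
        have := Nat.isCoprime_iff_coprime.2 this
        push_cast at this
        exact this
      · exact h4
      · apply Finset.prod_dvd_of_coprime
        · intro p hp q hq hpq
          have := Nat.isCoprime_iff_coprime.2 (hcop p hp q hq hpq)
          push_cast at this
          exact this
        · intro p hp; exact (hall p hp).1
    · rintro ⟨hdv, hall⟩
      push_cast at hdv
      refine ⟨(dvd_mul_right _ _).trans hdv, fun p hp => ⟨?_, fun hpA => hall p hpA⟩⟩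
      exact ((Finset.dvd_prod_of_mem (fun p : ℕ => (p : ℤ) ^ e p) hp).trans (dvd_mul_left _ _)).trans hdv
  · have e1 : ∏ p ∈ D, (if p ∈ PW then 1 + 1 / (p : ℝ) else 1 - 1 / (p : ℝ)) =
        (∏ p ∈ PW, (1 + 1 / (p : ℝ))) * ∏ p ∈ A1 a, (1 - 1 / (p : ℝ)) := by
      rw [hD, Finset.prod_union hdisj]
      congr 1
      · apply Finset.prod_congr rfl; intro p hp; simp [hp]
      · apply Finset.prod_congr rfl; intro p hp
        have : p ∉ PW := fun h => Finset.disjoint_left.1 hdisj h hp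
        simp [this]
    simp only [hg]
    rw [Finset.prod_div_distrib, e1]
    push_cast
    have : ∏ p ∈ D, (p : ℝ) ^ e p ≠ 0 := by
      rw [Finset.prod_ne_zero_iff]
      intro p hp
      have : (p : ℝ) ≠ 0 := by exact_mod_cast (hDp p hp).ne_zero
      positivity
    field_simp
    ring

end Base

section Mult
open Finset Real
open scoped Classical

/-- restricted representations as sum of two squares -/
def RepSq (i : ℕ → ℤ) (V : ℝ) (m : ℕ) (z : ℤ × ℤ) : Prop :=
  z.1 ^ 2 + z.2 ^ 2 = m ∧ ∀ p : ℕ, p.Prime → p % 4 = 1 → (p : ℝ) ≤ V → ¬ (p : ℤ) ∣ z.1 + i p * z.2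

/-- multiplication of Gaussian integers -/
def mulc (c d : ℤ) (z : ℤ × ℤ) : ℤ × ℤ := (c * z.1 - d * z.2, d * z.1 + c * z.2)

lemma rep_step (i : ℕ → ℤ) (hi : ∀ p : ℕ, p.Prime → p % 4 = 1 → (p : ℤ) ∣ i p ^ 2 + 1) (V : ℝ)
    (m m' n : ℕ) (c d : ℤ) (hn : 0 < n) (hcd : c ^ 2 + d ^ 2 = n) (hm : m = n * m') (z : ℤ × ℤ)
    (h : RepSq i V m (mulc c d z)) : RepSq i V m' z := by
  obtain ⟨h1, h2⟩ := h
  constructor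
  · have hn' : (n : ℤ) ≠ 0 := by exact_mod_cast hn.ne'
    apply mul_left_cancel₀ hn'
    simp only [mulc] at h1
    rw [hm] at h1
    push_cast at h1
    linear_combination h1 - (z.1 ^ 2 + z.2 ^ 2) * hcd
  · intro p hp hp1 hpV hdv
    apply h2 p hp hp1 hpV
    simp only [mulc]
    have e : c * z.1 - d * z.2 + i p * (d * z.1 + c * z.2) =
      (c + i p * d) * (z.1 + i p * z.2) - (i p ^ 2 + 1) * (d * z.2) := by ring
    rw [e]
    exact dvd_sub (hdv.mul_left _) ((hi p hp hp1).mul_right _)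

lemma rep_bound (i : ℕ → ℤ) (hi : ∀ p : ℕ, p.Prime → p % 4 = 1 → (p : ℤ) ∣ i p ^ 2 + 1) (V : ℝ) (hV : 0 < V)
    (m : ℕ) : 0 < m → ∀ t : ℕ, (m : ℝ) < V ^ (t + 1) →
    ∃ F : Finset (ℤ × ℤ), (∀ z, RepSq i V m z → z ∈ F) ∧ F.card ≤ 4 * 2 ^ t := by
  induction m using Nat.strong_induction_on with
  | _ m ih =>
  intro hm0 t ht
  by_cases hm1 : m = 1
  · subst hm1
    refine ⟨{(1, 0), (-1, 0), (0, 1), (0, -1)}, ?_, ?_⟩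
    · rintro ⟨u, v⟩ ⟨h1, _⟩
      simp only [Nat.cast_one] at h1
      have hu : u ≤ 1 := by nlinarith [sq_nonneg v]
      have hu' : -1 ≤ u := by nlinarith [sq_nonneg v]
      have hv : v ≤ 1 := by nlinarith [sq_nonneg u]
      have hv' : -1 ≤ v := by nlinarith [sq_nonneg u]
      interval_cases u <;> interval_cases v <;> simp_all
    · have : 1 ≤ 2 ^ t := Nat.one_le_two_pow
      calc _ ≤ 4 := Finset.card_le_four
        _ ≤ _ := by omega
  by_cases hne : ∃ z, RepSq i V m z
  swap
  · exact ⟨∅, fun z hz => absurd ⟨z, hz⟩ hne, by simp⟩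
  have hp := Nat.minFac_prime hm1
  set p := m.minFac with hpdef
  have hpm : p ∣ m := Nat.minFac_dvd m
  have : Fact p.Prime := ⟨hp⟩
  -- generic single-option step
  have single : ∀ (n : ℕ) (c d : ℤ), 1 < n → c ^ 2 + d ^ 2 = n → n ∣ m →
      (∀ z, RepSq i V m z → ∃ z', z = mulc c d z') →
      ∃ F : Finset (ℤ × ℤ), (∀ z, RepSq i V m z → z ∈ F) ∧ F.card ≤ 4 * 2 ^ t := by
    intro n c d hn hcd hnm hz
    obtain ⟨m', hm'⟩ := hnm
    have hm'0 : 0 < m' := by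
      rcases Nat.eq_zero_or_pos m' with h | h
      · rw [h] at hm'; omega
      · exact h
    have hlt : m' < m := by rw [hm']; nlinarith
    obtain ⟨F, hF1, hF2⟩ := ih m' hlt hm'0 t (lt_of_le_of_lt (by exact_mod_cast hlt.le) ht)
    refine ⟨F.image (mulc c d), ?_, Finset.card_image_le.trans hF2⟩
    intro z hzm
    obtain ⟨z', rfl⟩ := hz z hzm
    exact Finset.mem_image_of_mem _ (hF1 z' (rep_step i hi V m m' n c d (by omega) hcd hm' z' hzm))
  have hmod : p = 2 ∨ p % 4 = 3 ∨ p % 4 = 1 := by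
    have := hp.eq_two_or_odd
    omega
  rcases hmod with h2 | h3 | h1
  · apply single 2 1 1 (by norm_num) (by norm_num) (h2 ▸ hpm)
    rintro ⟨u, v⟩ ⟨h1, _⟩
    simp only at h1
    rw [h2] at hpm
    obtain ⟨w, hw⟩ := hpm
    rw [hw] at h1
    push_cast at h1
    have hpar : (2 : ℤ) ∣ u + v := by
      rw [← even_iff_two_dvd]
      have he : Even (u ^ 2 + v ^ 2) := by rw [h1]; exact even_two_mul _
      rw [Int.even_add] at he ⊢
      rw [Int.even_pow, Int.even_pow] at he
      simpa using he
    obtain ⟨s, hs⟩ := hpar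
    refine ⟨(s, s - u), ?_⟩
    simp only [mulc, Prod.mk.injEq]
    constructor <;> linarith
  · have hdv : ∀ z, RepSq i V m z → (p : ℤ) ∣ z.1 ∧ (p : ℤ) ∣ z.2 := by
      rintro ⟨u, v⟩ ⟨h1, _⟩
      simp only at h1 ⊢
      have h0 : ((u : ZMod p)) ^ 2 + (v : ZMod p) ^ 2 = 0 := by
        have : ((m : ℤ) : ZMod p) = 0 := by
          rw [ZMod.intCast_zmod_eq_zero_iff_dvd]; exact_mod_cast hpm
        rw [← h1] at this
        push_cast at this
        exact this
      have := p3_zero p h3 _ _ h0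
      rw [ZMod.intCast_zmod_eq_zero_iff_dvd, ZMod.intCast_zmod_eq_zero_iff_dvd] at this
      exact this
    have hp2m : p ^ 2 ∣ m := by
      obtain ⟨z, hz⟩ := hne
      obtain ⟨⟨s, hs⟩, ⟨r, hr⟩⟩ := hdv z hz
      have : ((p ^ 2 : ℕ) : ℤ) ∣ (m : ℤ) := by
        refine ⟨s ^ 2 + r ^ 2, ?_⟩
        rw [← hz.1, hs, hr]; push_cast; ring
      exact_mod_cast this
    apply single (p ^ 2) p 0 (by have := hp.one_lt; nlinarith) (by push_cast; ring) hp2m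
    intro z hz
    obtain ⟨⟨s, hs⟩, ⟨r, hr⟩⟩ := hdv z hz
    refine ⟨(s, r), ?_⟩
    ext
    · simp [mulc, hs]
    · simp [mulc, hr]
  · have hpp : Prime (p : ℤ) := Nat.prime_iff_prime_int.1 hp
    have hpz : (p : ℤ) ≠ 0 := by exact_mod_cast hp.ne_zero
    obtain ⟨j, hj⟩ := hi p hp h1
    -- choose c, d with the right sign
    obtain ⟨c, d, hcd, hcd'⟩ : ∃ c d : ℤ, c ^ 2 + d ^ 2 = p ∧ (p : ℤ) ∣ c - i p * d := by
      obtain ⟨c, d, hcd⟩ := Nat.Prime.sq_add_sq (p := p) (by omega)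
      have hcdz : (c : ℤ) ^ 2 + (d : ℤ) ^ 2 = p := by exact_mod_cast hcd
      have : (p : ℤ) ∣ (c - i p * d) * (c + i p * d) := by
        refine ⟨1 - j * d ^ 2, ?_⟩
        linear_combination hcdz - (d : ℤ) ^ 2 * hj
      rcases hpp.dvd_or_dvd this with h | h
      · exact ⟨c, d, hcdz, h⟩
      · exact ⟨c, -d, by linear_combination hcdz, by rw [mul_neg, sub_neg_eq_add]; exact h⟩
    obtain ⟨l, hl⟩ := hcd'
    have opt1 : ∀ u v : ℤ, (p : ℤ) ∣ u - i p * v → ∃ z', (u, v) = mulc c d z' := by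
      rintro u v ⟨s, hs⟩
      -- u = p s + ι v, c = p l + ι d
      have hA : (p : ℤ) ∣ u * c + v * d := by
        refine ⟨s * c + i p * v * l + v * d * j, ?_⟩
        linear_combination c * hs + i p * v * hl + v * d * hj
      have hB : (p : ℤ) ∣ v * c - u * d := by
        refine ⟨v * l - s * d, ?_⟩
        linear_combination v * hl - d * hs
      obtain ⟨A, hA⟩ := hA
      obtain ⟨B, hB⟩ := hB
      refine ⟨(A, B), ?_⟩
      simp only [mulc, Prod.mk.injEq]
      constructor
      · apply mul_left_cancel₀ hpz
        linear_combination c * hA - d * hB - u * hcd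
      · apply mul_left_cancel₀ hpz
        linear_combination d * hA + c * hB - v * hcd
    have opt2 : ∀ u v : ℤ, (p : ℤ) ∣ u + i p * v → ∃ z', (u, v) = mulc c (-d) z' := by
      rintro u v ⟨s, hs⟩
      have hA : (p : ℤ) ∣ u * c - v * d := by
        refine ⟨s * c - i p * v * l - v * d * j, ?_⟩
        linear_combination c * hs - i p * v * hl - v * d * hj
      have hB : (p : ℤ) ∣ v * c + u * d := by
        refine ⟨v * l + s * d, ?_⟩
        linear_combination v * hl + d * hs
      obtain ⟨A, hA⟩ := hA
      obtain ⟨B, hB⟩ := hB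
      refine ⟨(A, B), ?_⟩
      simp only [mulc, Prod.mk.injEq]
      constructor
      · apply mul_left_cancel₀ hpz
        linear_combination c * hA + d * hB - u * hcd
      · apply mul_left_cancel₀ hpz
        linear_combination - d * hA + c * hB - v * hcd
    have hor : ∀ z, RepSq i V m z → (p : ℤ) ∣ z.1 - i p * z.2 ∨ (p : ℤ) ∣ z.1 + i p * z.2 := by
      rintro ⟨u, v⟩ ⟨h1, _⟩
      simp only at h1 ⊢
      apply hpp.dvd_or_dvd
      have e : (u - i p * v) * (u + i p * v) = m - (i p ^ 2 + 1) * v ^ 2 := by linear_combination h1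
      rw [e]
      refine dvd_sub (by exact_mod_cast hpm) ((hi p hp ?_).mul_right _)
      assumption
    by_cases hpV : (p : ℝ) ≤ V
    · apply single p c d hp.one_lt hcd hpm
      rintro ⟨u, v⟩ hz
      rcases hor _ hz with h | h
      · exact opt1 u v h
      · exact absurd h (hz.2 p hp h1 hpV)
    · push Not at hpV
      have hp0r : (0 : ℝ) < p := by exact_mod_cast hp.pos
      obtain ⟨m', hm'⟩ := hpm
      have hm'0 : 0 < m' := by
        rcases Nat.eq_zero_or_pos m' with h | h
        · rw [h] at hm'; omega
        · exact h
      have hmr : (m : ℝ) = p * m' := by exact_mod_cast hm'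
      have hm'1 : (1 : ℝ) ≤ m' := by exact_mod_cast hm'0
      cases t with
      | zero =>
        exfalso
        rw [zero_add, pow_one, hmr] at ht
        nlinarith
      | succ t =>
        have hlt : m' < m := by
          rw [hm']
          have := hp.one_lt
          nlinarith
        have hm't : (m' : ℝ) < V ^ (t + 1) := by
          rw [hmr, pow_succ] at ht
          have hVt : 0 < V ^ (t + 1) := by positivity
          by_contra hcon
          push Not at hcon
          have : V ^ (t + 1) * V ≤ p * m' := by
            rw [mul_comm]
            exact mul_le_mul hpV.le hcon hVt.le hp0r.le
          linarith
        obtain ⟨F, hF1, hF2⟩ := ih m' hlt hm'0 t hm't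
        refine ⟨F.image (mulc c d) ∪ F.image (mulc c (-d)), ?_, ?_⟩
        · rintro ⟨u, v⟩ hz
          rw [Finset.mem_union]
          rcases hor _ hz with h | h
          · obtain ⟨z', hz'⟩ := opt1 u v h
            left
            rw [hz'] at hz ⊢
            exact Finset.mem_image_of_mem _ (hF1 z' (rep_step i hi V m m' p c d hp.pos hcd hm' z' hz))
          · obtain ⟨z', hz'⟩ := opt2 u v h
            right
            rw [hz'] at hz ⊢
            exact Finset.mem_image_of_mem _ (hF1 z' (rep_step i hi V m m' p c (-d) hp.pos
              (by linear_combination hcd) hm' z' hz))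
        · calc _ ≤ (F.image (mulc c d)).card + (F.image (mulc c (-d))).card := Finset.card_union_le _ _
            _ ≤ F.card + F.card := add_le_add Finset.card_image_le Finset.card_image_le
            _ ≤ 4 * 2 ^ (t + 1) := by rw [pow_succ]; omega

end Mult

section Asm
open Finset Real
open scoped Classical

lemma crt_finset (f : ℕ → ℤ) (S : Finset ℕ) (hS : ∀ p ∈ S, p.Prime) :
    ∃ n : ℤ, ∀ p ∈ S, (p : ℤ) ∣ n - f p := by
  induction S using Finset.induction_on with
  | empty => exact ⟨0, by simp⟩
  | insert q S hq ih =>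
    obtain ⟨n, hn⟩ := ih (fun p hp => hS p (Finset.mem_insert_of_mem hp))
    have hqp := hS q (Finset.mem_insert_self _ _)
    have hcop : Nat.Coprime (∏ p ∈ S, p) q := by
      apply Nat.Coprime.prod_left
      intro p hp
      refine (Nat.coprime_primes (hS p (Finset.mem_insert_of_mem hp)) hqp).2 ?_
      rintro rfl; exact hq hp
    have hc : IsCoprime ((∏ p ∈ S, p : ℕ) : ℤ) (q : ℤ) := Nat.isCoprime_iff_coprime.2 hcop
    obtain ⟨s, t, hst⟩ := hc
    refine ⟨n + (f q - n) * (s * ((∏ p ∈ S, p : ℕ) : ℤ)), ?_⟩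
    intro p hp
    rcases Finset.mem_insert.1 hp with rfl | hp
    · refine ⟨(n - f p) * t, ?_⟩
      linear_combination (f p - n) * hst
    · have h1 := hn p hp
      have h2 : (p : ℤ) ∣ ((∏ p ∈ S, p : ℕ) : ℤ) := by exact_mod_cast Finset.dvd_prod_of_mem (fun p => p) hp
      have : n + (f q - n) * (s * ((∏ p ∈ S, p : ℕ) : ℤ)) - f p = (n - f p) + (f q - n) * s * ((∏ p ∈ S, p : ℕ) : ℤ) := by ring
      rw [this]
      exact dvd_add h1 (h2.mul_left _)

lemma choose_n0 {k : ℕ} (a b : Fin k → ℤ) (hodd : ∀ i, Odd (a i)) (PW : Finset ℕ)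
    (hPW : ∀ p ∈ PW, p.Prime ∧ p % 4 = 3)
    (hadm : ∀ p : ℕ, p.Prime → p % 4 = 3 → ∃ n : ℤ, Int.gcd (∏ i, (a i * n + b i)) (p : ℤ) = 1) :
    ∃ n0 : ℤ, ∃ I : Finset (Fin k), k ≤ 4 * I.card ∧ (∀ i ∈ I, (a i * n0 + b i) % 4 = 1) ∧
      ∀ p ∈ PW, ∀ i, ¬ (p : ℤ) ∣ a i * n0 + b i := by
  have : ∀ p : ℕ, ∃ n : ℤ, p.Prime → p % 4 = 3 → Int.gcd (∏ i, (a i * n + b i)) (p : ℤ) = 1 := by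
    intro p
    by_cases h : p.Prime ∧ p % 4 = 3
    · obtain ⟨n, hn⟩ := hadm p h.1 h.2
      exact ⟨n, fun _ _ => hn⟩
    · exact ⟨0, fun h1 h2 => absurd ⟨h1, h2⟩ h⟩
  choose f hf using this
  obtain ⟨n1, hn1⟩ := crt_finset f PW (fun p hp => (hPW p hp).1)
  set P : ℤ := ((∏ p ∈ PW, p : ℕ) : ℤ) with hP
  have hPodd : Odd P := by
    rw [hP, Int.odd_coe_nat]
    apply Finset.prod_induction _ (fun n => Odd n) (fun _ _ h1 h2 => h1.mul h2) odd_one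
    intro p hp
    have := (hPW p hp).2
    rw [Nat.odd_iff]; omega
  have hgood : ∀ s : ℤ, ∀ p ∈ PW, ∀ i, ¬ (p : ℤ) ∣ a i * (n1 + P * s) + b i := by
    intro s p hp i hd
    have hg := hf p (hPW p hp).1 (hPW p hp).2
    have h2 : (p : ℤ) ∣ P := by rw [hP]; exact_mod_cast Finset.dvd_prod_of_mem (fun p => p) hp
    have h3 : (p : ℤ) ∣ a i * f p + b i := by
      have e : a i * f p + b i = (a i * (n1 + P * s) + b i) - a i * (n1 - f p) - P * (a i * s) := by ring
      rw [e]
      exact dvd_sub (dvd_sub hd ((hn1 p hp).mul_left _)) (h2.mul_right _)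
    have h4 : (p : ℤ) ∣ ∏ i, (a i * f p + b i) := h3.trans (Finset.dvd_prod_of_mem _ (Finset.mem_univ i))
    have h5 : p ∣ Int.gcd (∏ i, (a i * f p + b i)) (p : ℤ) := by
      have := Int.dvd_coe_gcd h4 (dvd_refl (p : ℤ))
      exact_mod_cast this
    rw [hg] at h5
    exact (hPW p hp).1.one_lt.ne' (Nat.dvd_one.1 h5)
  have hex : ∀ i, ∃ s ∈ Finset.range 4, (a i * (n1 + P * (s : ℤ)) + b i) % 4 = 1 := by
    intro i
    have h1 : Odd (a i * P) := (hodd i).mul hPodd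
    have h2 : (a i * P) % 4 = 1 ∨ (a i * P) % 4 = 3 := by
      obtain ⟨c, hc⟩ := h1; omega
    have e : ∀ s : ℤ, a i * (n1 + P * s) + b i = (a i * P) * s + (a i * n1 + b i) := by intro s; ring
    simp only [e]
    generalize a i * P = A at *
    generalize a i * n1 + b i = B at *
    have hB : B % 4 = 0 ∨ B % 4 = 1 ∨ B % 4 = 2 ∨ B % 4 = 3 := by omega
    rcases h2 with h | h <;> rcases hB with h' | h' | h' | h'
    · exact ⟨1, by simp, by push_cast; omega⟩
    · exact ⟨0, by simp, by push_cast; omega⟩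
    · exact ⟨3, by simp, by push_cast; omega⟩
    · exact ⟨2, by simp, by push_cast; omega⟩
    · exact ⟨3, by simp, by push_cast; omega⟩
    · exact ⟨0, by simp, by push_cast; omega⟩
    · exact ⟨1, by simp, by push_cast; omega⟩
    · exact ⟨2, by simp, by push_cast; omega⟩
  set I : ℕ → Finset (Fin k) := fun s => Finset.univ.filter (fun i => (a i * (n1 + P * (s : ℤ)) + b i) % 4 = 1) with hI
  have hcover : (Finset.univ : Finset (Fin k)) ⊆ (Finset.range 4).biUnion I := by
    intro i _
    obtain ⟨s, hs, h⟩ := hex i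
    rw [Finset.mem_biUnion]
    exact ⟨s, hs, by simp [hI, h]⟩
  have hk : k ≤ ∑ s ∈ Finset.range 4, (I s).card := by
    calc k = (Finset.univ : Finset (Fin k)).card := by simp
      _ ≤ _ := Finset.card_le_card hcover
      _ ≤ _ := Finset.card_biUnion_le
  obtain ⟨s, hs⟩ : ∃ s, k ≤ 4 * (I s).card := by
    by_contra hcon
    push Not at hcon
    have h0 := hcon 0
    have h1 := hcon 1
    have h2 := hcon 2
    have h3 := hcon 3
    simp only [Finset.sum_range_succ, Finset.sum_range_zero] at hk
    omega
  refine ⟨n1 + P * s, I s, hs, ?_, hgood s⟩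
  intro i hi
  exact (Finset.mem_filter.1 hi).2

lemma count_core {k : ℕ} (hk : 0 < k) (N : Finset ℤ) (T : Fin k → ℤ → Prop) (I : Finset (Fin k))
    (U c1 : ℝ) (hc1 : 0 < c1) (hN : (N.card : ℝ) ≤ U) (hI : k ≤ 4 * I.card)
    (hT : ∀ i ∈ I, c1 * U / √k ≤ ((N.filter (T i)).card : ℝ)) :
    c1 * U / (8 * √k) ≤
      ((N.filter (fun n => √k / (8 / c1) ≤ ((Finset.univ.filter (fun i => T i n)).card : ℝ))).card : ℝ) := by
  have hkr : (0 : ℝ) < k := by exact_mod_cast hk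
  have hs : 0 < √(k : ℝ) := Real.sqrt_pos.2 hkr
  have hss : √(k : ℝ) * √(k : ℝ) = k := Real.mul_self_sqrt hkr.le
  have hU : 0 ≤ U := le_trans (by positivity) hN
  set G := N.filter (fun n => √k / (8 / c1) ≤ ((Finset.univ.filter (fun i => T i n)).card : ℝ)) with hG
  have h1 : (I.card : ℝ) * (c1 * U / √k) ≤ ∑ i ∈ I, ((N.filter (T i)).card : ℝ) := by
    rw [← nsmul_eq_mul]
    exact Finset.card_nsmul_le_sum _ _ _ hT
  have h2 : ∑ i ∈ I, ((N.filter (T i)).card : ℝ) ≤ ∑ n ∈ N, ((Finset.univ.filter (fun i => T i n)).card : ℝ) := by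
    calc _ ≤ ∑ i : Fin k, ((N.filter (T i)).card : ℝ) :=
          Finset.sum_le_sum_of_subset_of_nonneg (Finset.subset_univ _) (fun _ _ _ => by positivity)
      _ = ∑ n ∈ N, ((Finset.univ.filter (fun i => T i n)).card : ℝ) := by
        simp only [Finset.card_filter, Nat.cast_sum]
        exact Finset.sum_comm
  have h3 : ∑ n ∈ N, ((Finset.univ.filter (fun i => T i n)).card : ℝ) ≤
      ∑ n ∈ N, ((if n ∈ G then (k : ℝ) else 0) + √k / (8 / c1)) := by
    apply Finset.sum_le_sum
    intro n hn
    by_cases hg : n ∈ G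
    · rw [if_pos hg]
      have : ((Finset.univ.filter (fun i => T i n)).card : ℝ) ≤ k := by
        have := Finset.card_le_univ (Finset.univ.filter (fun i : Fin k => T i n))
        rw [Fintype.card_fin] at this
        exact_mod_cast this
      have : 0 ≤ √k / (8 / c1) := by positivity
      linarith
    · rw [if_neg hg]
      have : ¬ (√k / (8 / c1) ≤ ((Finset.univ.filter (fun i => T i n)).card : ℝ)) := by
        intro h; exact hg (Finset.mem_filter.2 ⟨hn, h⟩)
      linarith
  have h4 : ∑ n ∈ N, ((if n ∈ G then (k : ℝ) else 0) + √k / (8 / c1)) = G.card * k + N.card * (√k / (8 / c1)) := by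
    rw [Finset.sum_add_distrib, Finset.sum_const, nsmul_eq_mul, ← Finset.sum_filter, Finset.sum_const, nsmul_eq_mul]
    congr 4
    ext n
    simp only [Finset.mem_filter, hG]; tauto
  have h5 : (k : ℝ) / 4 ≤ I.card := by
    have : (k : ℝ) ≤ 4 * I.card := by exact_mod_cast hI
    linarith
  have h6 : (k : ℝ) / 4 * (c1 * U / √k) ≤ I.card * (c1 * U / √k) := by gcongr
  have h7 : (N.card : ℝ) * (√k / (8 / c1)) ≤ U * (√k / (8 / c1)) := by gcongr
  have h8 : (k : ℝ) / 4 * (c1 * U / √k) = √k * (c1 * U) / 4 := by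
    rw [show (k : ℝ) / 4 * (c1 * U / √k) = (√(k:ℝ) * √(k:ℝ)) / 4 * (c1 * U / √k) by rw [hss]]
    field_simp
  have h9 : U * (√k / (8 / c1)) = √k * (c1 * U) / 8 := by field_simp
  have h10 : √k * (c1 * U) / 8 ≤ G.card * k := by linarith
  rw [div_le_iff₀ (by positivity)]
  have : √k * (c1 * U / 8) ≤ √k * (G.card * √k) := by
    have e : √k * (G.card * √k) = G.card * (√k * √k) := by ring
    rw [e, hss]; linarith
  have := le_of_mul_le_mul_left this hs
  linarith

/-- the sifted set of `n` -/
noncomputable def Nset {k : ℕ} (x : ℝ) (a b : Fin k → ℤ) (Q : ℕ) (n0 : ℤ) (P3 : Finset ℕ) : Finset ℤ :=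
  (Finset.Ico ⌈x⌉ (⌈x⌉ + (⌊x⌋₊ : ℤ))).filter
    (fun n => (Q : ℤ) ∣ n - n0 ∧ ∀ p ∈ P3, ¬ (p : ℤ) ∣ ∏ i, (a i * n + b i))

lemma N_upper {k : ℕ} (hk : 0 < k) (a b : Fin k → ℤ) (Q : ℕ) (n0 : ℤ) (P3 : Finset ℕ) (L3 x y : ℝ) (J : ℕ)
    (hQ : 0 < Q) (hL3 : 0 < L3) (hP3 : ∀ p ∈ P3, p.Prime ∧ log p ≤ L3 ∧ 2 * k ≤ p ∧ Nat.Coprime Q p)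
    (ha : ∀ p ∈ P3, ∀ i, ¬ (p : ℤ) ∣ a i) (hJ : k * L3 < 2 ^ J * log 2)
    (hx : x = y ^ 20) (hy : 10 ≤ y) (hW : exp (480 * (k * L3)) ≤ y) (hQy : (Q : ℝ) ≤ y)
    (hV : 1 / y ≤ ∏ p ∈ P3, (1 - (omg a b p : ℝ) / p)) :
    ((Nset x a b Q n0 P3).card : ℝ) ≤ 3 * (x / Q) * ∏ p ∈ P3, (1 - (omg a b p : ℝ) / p) := by
  have hk1 : (1 : ℝ) ≤ k := by exact_mod_cast hk
  have hx1 : (1 : ℝ) ≤ x := by rw [hx]; exact one_le_pow₀ (by linarith)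
  have hH1 : 1 ≤ ⌊x⌋₊ := (Nat.one_le_floor_iff x).2 hx1
  have hHx : (⌊x⌋₊ : ℝ) ≤ x := Nat.floor_le (by linarith)
  set H := ⌊x⌋₊ with hH
  have hQr : (0 : ℝ) < Q := by exact_mod_cast hQ
  have key := sieve_box ⌈x⌉ 0 H H Q (fun n _ => (Q : ℤ) ∣ n - n0) (1 / Q)
    (fun p n _ => (p : ℤ) ∣ ∏ i, (a i * n + b i)) (fun p => (omg a b p : ℝ) / p) (480 * (k * L3)) J
    (fun s => if s then P3 else ∅) (fun s => if s then L3 else k * L3) (fun s => if s then k else 1)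
    (by positivity) (dens_class Q hQ n0)
    (by intro s; cases s <;> simp <;> positivity)
    (by intro s; cases s <;> simp; omega)
    (by simp)
    (by intro s; cases s
        · simp
        · simp only [if_true]; exact fun p hp => ⟨(hP3 p hp).1, (hP3 p hp).2.1⟩)
    (by intro s; cases s
        · simpa using hJ
        · simp only [if_true]
          refine lt_of_le_of_lt ?_ hJ
          nlinarith)
    (by intro s; cases s
        · simp
        · simp only [if_true]
          intro p hp
          have hp0 : (0 : ℝ) < p := by exact_mod_cast (hP3 p hp).1.pos
          have h1 : (omg a b p : ℝ) ≤ k := by exact_mod_cast omg_le a b p (hP3 p hp).1 (ha p hp)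
          have h2 : (2 : ℝ) * k ≤ p := by exact_mod_cast (hP3 p hp).2.2.1
          refine ⟨by positivity, ?_, by gcongr⟩
          rw [div_le_iff₀ hp0]; linarith)
    (by simp; nlinarith)
    (by intro p hp; simp at hp; exact (hP3 p hp).2.2.2)
    (by intro p hp; simp at hp; exact dens_n a b p (hP3 p hp).1)
  simp only [if_true, Bool.false_eq_true, if_false, Finset.union_empty] at key
  have key1 := key.1
  have hcard : (((Finset.Ico ⌈x⌉ (⌈x⌉ + (H : ℤ))) ×ˢ (Finset.Ico (0 : ℤ) (0 + (H : ℤ)))).filter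
      (fun z : ℤ × ℤ => (Q : ℤ) ∣ z.1 - n0 ∧ ∀ p ∈ P3, ¬ (p : ℤ) ∣ ∏ i, (a i * z.1 + b i))).card
      = (Nset x a b Q n0 P3).card * H := by
    have : ((Finset.Ico ⌈x⌉ (⌈x⌉ + (H : ℤ))) ×ˢ (Finset.Ico (0 : ℤ) (0 + (H : ℤ)))).filter
      (fun z : ℤ × ℤ => (Q : ℤ) ∣ z.1 - n0 ∧ ∀ p ∈ P3, ¬ (p : ℤ) ∣ ∏ i, (a i * z.1 + b i)) =
      (Nset x a b Q n0 P3) ×ˢ (Finset.Ico (0 : ℤ) (0 + (H : ℤ))) := by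
      ext z
      simp only [Nset, Finset.mem_filter, Finset.mem_product, ← hH]
      tauto
    rw [this, Finset.card_product]
    simp
  set V := ∏ p ∈ P3, (1 - (omg a b p : ℝ) / p) with hVdef
  set N := (Nset x a b Q n0 P3).card with hNdef
  set E := exp (480 * (k * L3)) with hE
  have hE0 : 0 < E := exp_pos _
  have hHr : (1 : ℝ) ≤ H := by exact_mod_cast hH1
  have key2 : (N : ℝ) * H ≤ 2 * (1 / Q * H * H) * V + ((H + H) * (Q * E) + (Q * E) ^ 2) * E := by
    have e : ((N * H : ℕ) : ℝ) = (N : ℝ) * H := by push_cast; ring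
    rw [← e, ← hcard]
    convert key1 using 1
  have hy0 : 0 < y := by linarith
  have hQE : (Q : ℝ) * E ≤ y ^ 2 := by rw [sq]; gcongr
  have herr : ((H + H) * (Q * E) + (Q * E) ^ 2) * E ≤ H * (3 * y ^ 5) := by
    calc ((H + H) * (Q * E) + (Q * E) ^ 2) * E ≤ ((H + H) * (y ^ 2) + (y ^ 2) ^ 2) * y := by gcongr
      _ = H * (2 * y ^ 3) + 1 * y ^ 5 := by ring
      _ ≤ H * (2 * y ^ 5) + H * y ^ 5 := by
        have : y ^ 3 ≤ y ^ 5 := pow_le_pow_right₀ (by linarith) (by norm_num)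
        gcongr
      _ = _ := by ring
  have key3 : (H : ℝ) * N ≤ H * (2 * (H / Q) * V + 3 * y ^ 5) := by
    have e : (H : ℝ) * (2 * (H / Q) * V + 3 * y ^ 5) =
      2 * (1 / Q * H * H) * V + H * (3 * y ^ 5) := by ring
    rw [e]
    linarith
  have key4 := le_of_mul_le_mul_left key3 (by linarith)
  have hV0 : 0 < V := lt_of_lt_of_le (by positivity) hV
  have h3 : 3 * y ^ 5 ≤ x / Q * V := by
    have h1 : y ^ 19 ≤ x / Q := by
      rw [le_div_iff₀ hQr, hx]
      calc y ^ 19 * Q ≤ y ^ 19 * y := by gcongr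
        _ = _ := by ring
    calc 3 * y ^ 5 ≤ y * y ^ 5 := by gcongr; linarith
      _ = y ^ 6 := by ring
      _ ≤ y ^ 18 := pow_le_pow_right₀ (by linarith) (by norm_num)
      _ = y ^ 19 * (1 / y) := by field_simp
      _ ≤ x / Q * V := by gcongr
  have h4 : 2 * (H / Q) * V ≤ 2 * (x / Q) * V := by gcongr
  linarith

end Asm

section Low
open Finset Real
open scoped Classical

/-- the bad event at the prime `p` -/
def badp {k : ℕ} (a b : Fin k → ℤ) (i0 : Fin k) (ii : ℕ → ℤ) (p : ℕ) (u v : ℤ) : Prop :=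
  if p % 4 = 3 then ∃ r ∈ rootsMod a b p, (a i0 : ZMod p) * r + b i0 = (u : ZMod p) ^ 2 + (v : ZMod p) ^ 2
  else (p : ℤ) ∣ u + ii p * v

/-- the set of sifted pairs -/
noncomputable def Sset {k : ℕ} (a b : Fin k → ℤ) (i0 : Fin k) (ii : ℕ → ℤ) (PW : Finset ℕ) (n0 : ℤ)
    (L3 Y : ℝ) : Finset (ℤ × ℤ) :=
  ((Finset.Ico ⌈√Y⌉ (⌈√Y⌉ + (⌊√Y / 10⌋₊ : ℤ))) ×ˢ (Finset.Ico (0 : ℤ) (0 + (⌊√Y / 10⌋₊ : ℤ)))).filter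
    (fun z : ℤ × ℤ => ((((a i0).toNat * (4 * ∏ p ∈ PW, p) : ℕ) : ℤ) ∣ z.1 ^ 2 + z.2 ^ 2 - (a i0 * n0 + b i0) ∧
        ∀ p ∈ A1 (a i0).toNat, ¬ (p : ℤ) ∣ z.1 + ii p * z.2) ∧
      ∀ p ∈ (PM 3 L3 \ PW) ∪ (PM 1 (k * L3) \ A1 (a i0).toNat), ¬ badp a b i0 ii p z.1 z.2)

lemma coprime_Q (PW : Finset ℕ) (hPW : ∀ p ∈ PW, p.Prime ∧ p % 4 = 3) (p : ℕ) (hp : p.Prime) (h2 : p % 2 = 1)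
    (hn : p ∉ PW) : Nat.Coprime (4 * ∏ p ∈ PW, p) p := by
  apply Nat.Coprime.mul_left
  · have : Nat.Coprime (2 ^ 2) p := by
      apply Nat.Coprime.pow_left
      exact (Nat.coprime_primes Nat.prime_two hp).2 (by omega)
    simpa using this
  · apply Nat.Coprime.prod_left
    intro q hq
    refine (Nat.coprime_primes (hPW q hq).1 hp).2 ?_
    rintro rfl; exact hn hq

set_option maxHeartbeats 2000000 in
lemma S_lower {k : ℕ} (hk : 0 < k) (a b : Fin k → ℤ) (i0 : Fin k) (ii : ℕ → ℤ)
    (hi : ∀ p : ℕ, p.Prime → p % 4 = 1 → (p : ℤ) ∣ ii p ^ 2 + 1) (PW : Finset ℕ) (n0 : ℤ)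
    (L3 x y : ℝ) (J : ℕ) (hL3 : 0 < L3)
    (hPW : ∀ p ∈ PW, p.Prime ∧ p % 4 = 3) (hPWs : PW ⊆ PM 3 L3)
    (hP3 : ∀ p ∈ PM 3 L3 \ PW, 2 * k ≤ p)
    (ha : ∀ p ∈ PM 3 L3 \ PW, ∀ i, ¬ (p : ℤ) ∣ a i) (hJ : k * L3 < 2 ^ J * log 2)
    (ha0 : 0 < a i0) (hodd : Odd (a i0))
    (hcov : ∀ p : ℕ, p.Prime → p ∣ (a i0).toNat → p % 4 = 3 → p ∈ PW)
    (hA1 : A1 (a i0).toNat ⊆ PM 1 (k * L3))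
    (hb0 : 0 < b i0) (hbx : (b i0 : ℝ) < x)
    (hm4 : (a i0 * n0 + b i0) % 4 = 1) (hm : ∀ p ∈ PW, ¬ (p : ℤ) ∣ a i0 * n0 + b i0)
    (hx : x = y ^ 20) (hy : 1000 ≤ y) (hW : exp (480 * (k * L3)) ≤ y)
    (hQy : (a i0 : ℝ) * ((4 * ∏ p ∈ PW, p : ℕ) : ℝ) ≤ y) (hJy : (1 : ℝ) + 2 * J ≤ y)
    (hVE : 1 / y ^ 2 ≤ (∏ p ∈ PM 3 L3 \ PW, (1 - (omg a b p : ℝ) / p)) *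
      ((∏ p ∈ PM 3 L3, (1 + 1 / (p : ℝ))) * ∏ p ∈ PM 1 (k * L3), (1 - 1 / (p : ℝ)))) :
    (x / ((4 * ∏ p ∈ PW, p : ℕ) : ℝ)) / 250 * ((∏ p ∈ PM 3 L3 \ PW, (1 - (omg a b p : ℝ) / p)) *
      ((∏ p ∈ PM 3 L3, (1 + 1 / (p : ℝ))) * ∏ p ∈ PM 1 (k * L3), (1 - 1 / (p : ℝ)))) ≤
      ((Sset a b i0 ii PW n0 L3 (a i0 * x + b i0)).card : ℝ) := by
  have hk1 : (1 : ℝ) ≤ k := by exact_mod_cast hk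
  obtain ⟨a0, ha0'⟩ : ∃ a0 : ℕ, (a0 : ℤ) = a i0 := ⟨(a i0).toNat, Int.toNat_of_nonneg ha0.le⟩
  have htn : (a i0).toNat = a0 := by rw [← ha0']; simp
  have haR : (a i0 : ℝ) = a0 := by rw [← ha0']; simp
  have ha0n : 0 < a0 := by zify; rw [ha0']; exact ha0
  have hoddn : Odd a0 := by rw [← Int.odd_coe_nat, ha0']; exact hodd
  unfold Sset
  rw [htn] at hcov hA1 ⊢
  rw [haR] at hQy ⊢
  set Y : ℝ := a0 * x + b i0 with hY
  set H := ⌊√Y / 10⌋₊ with hH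
  have hy0 : 0 < y := by linarith
  have hm3 : ∀ p ∈ PM 3 L3 \ PW, p.Prime ∧ p % 4 = 3 ∧ log p ≤ L3 ∧ p ∉ PW := by
    intro p hp
    rw [Finset.mem_sdiff, mem_PM] at hp
    tauto
  have hm1 : ∀ p ∈ PM 1 (k * L3) \ A1 a0, p.Prime ∧ p % 4 = 1 ∧ log p ≤ k * L3 ∧ ¬ p ∣ a0 := by
    intro p hp
    rw [Finset.mem_sdiff, mem_PM, mem_A1 _ _ ha0n] at hp
    tauto
  have hom : ∀ p ∈ PM 3 L3 \ PW, (0 : ℝ) < p ∧ (1 : ℝ) ≤ omg a b p ∧ (omg a b p : ℝ) / p ≤ 1 / 2 ∧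
      (omg a b p : ℝ) / p ≤ (k : ℝ) / p := by
    intro p hp
    have hp0 : (0 : ℝ) < p := by exact_mod_cast (hm3 p hp).1.pos
    have h1 : (omg a b p : ℝ) ≤ k := by exact_mod_cast omg_le a b p (hm3 p hp).1 (ha p hp)
    have h2 : (2 : ℝ) * k ≤ p := by exact_mod_cast hP3 p hp
    refine ⟨hp0, ?_, ?_, by gcongr⟩
    · exact_mod_cast omg_pos a b p (hm3 p hp).1 i0 (ha p hp i0)
    · rw [div_le_iff₀ hp0]; linarith
  have hdisj : Disjoint (PM 3 L3 \ PW) (PM 1 (k * L3) \ A1 a0) := by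
    rw [Finset.disjoint_left]
    intro p h1 h2
    have := (hm3 p h1).2.1
    have := (hm1 p h2).2.1
    omega
  set Q : ℕ := 4 * ∏ p ∈ PW, p with hQ
  have hQ0 : 0 < Q := by
    apply Nat.mul_pos (by norm_num)
    exact Finset.prod_pos (fun p hp => (hPW p hp).1.pos)
  set g : ℕ → ℝ := fun p => if p % 4 = 3 then 1 - (1 - (omg a b p : ℝ) / p) * (1 + 1 / p) else 1 / p with hg
  set δ0 : ℝ := 2 / ((a0 * Q : ℕ) : ℝ) * (∏ p ∈ PW, (1 + 1 / (p : ℝ))) * ∏ p ∈ A1 a0, (1 - 1 / (p : ℝ)) with hδ0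
  have hdens_nonneg : 0 ≤ δ0 := by
    rw [hδ0]
    refine mul_nonneg (mul_nonneg (by positivity) (Finset.prod_nonneg (fun p _ => by positivity))) ?_
    apply Finset.prod_nonneg
    intro p hp
    have : (1 : ℝ) ≤ p := by exact_mod_cast ((mem_A1 _ _ ha0n).1 hp).1.one_le
    rw [sub_nonneg, div_le_one (by linarith)]; exact this
  have key := (sieve_box ⌈√Y⌉ 0 H H (a0 * Q) (fun u v => ((a0 * Q : ℕ) : ℤ) ∣ u ^ 2 + v ^ 2 - (a i0 * n0 + b i0) ∧
        ∀ p ∈ A1 a0, ¬ (p : ℤ) ∣ u + ii p * v) δ0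
    (badp a b i0 ii) g (480 * (k * L3)) J
    (fun s => if s then PM 3 L3 \ PW else PM 1 (k * L3) \ A1 a0) (fun s => if s then L3 else k * L3)
    (fun s => if s then k else 1) hdens_nonneg
    (dens_base a0 ha0n hoddn PW hPW hcov ii hi (a i0 * n0 + b i0) hm4 hm)
    (by intro s; cases s <;> simp <;> positivity)
    (by intro s; cases s <;> simp; omega)
    (by simpa using hdisj)
    (by intro s; cases s
        · simp only [Bool.false_eq_true, if_false]; exact fun p hp => ⟨(hm1 p hp).1, (hm1 p hp).2.2.1⟩
        · simp only [if_true]; exact fun p hp => ⟨(hm3 p hp).1, (hm3 p hp).2.2.1⟩)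
    (by intro s; cases s
        · simpa using hJ
        · simp only [if_true]
          refine lt_of_le_of_lt ?_ hJ
          nlinarith)
    (by intro s; cases s
        · simp only [Bool.false_eq_true, if_false]
          intro p hp
          have h := hm1 p hp
          have hp2 : (2 : ℝ) ≤ p := by exact_mod_cast h.1.two_le
          simp only [hg]
          rw [if_neg (by omega)]
          refine ⟨by positivity, ?_, by simp⟩
          rw [div_le_div_iff₀ (by linarith) (by norm_num)]; linarith
        · simp only [if_true]
          intro p hp
          obtain ⟨hp0, h1, h2, h3⟩ := hom p hp
          simp only [hg]
          rw [if_pos (hm3 p hp).2.1]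
          have e : 1 - (1 - (omg a b p : ℝ) / p) * (1 + 1 / p) =
            ((omg a b p : ℝ) - 1) / p + (omg a b p : ℝ) / p * (1 / p) := by field_simp; ring
          have e2 : 1 - (1 - (omg a b p : ℝ) / p) * (1 + 1 / p) =
            (omg a b p : ℝ) / p - (1 - (omg a b p : ℝ) / p) * (1 / p) := by ring
          have h4 : 0 ≤ (1 - (omg a b p : ℝ) / p) * (1 / p) := mul_nonneg (by linarith) (by positivity)
          refine ⟨?_, by linarith, by linarith⟩
          rw [e]
          have : 0 ≤ ((omg a b p : ℝ) - 1) / p := div_nonneg (by linarith) hp0.le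
          positivity)
    (by simp; nlinarith)
    (by
      intro p hp
      simp only [if_true, Bool.false_eq_true, if_false, Finset.mem_union] at hp
      apply Nat.Coprime.mul_left
      · rcases hp with hp | hp
        · have h := ha p hp i0
          rw [← ha0'] at h
          refine (((hm3 p hp).1.coprime_iff_not_dvd).2 ?_).symm
          exact_mod_cast h
        · exact (((hm1 p hp).1.coprime_iff_not_dvd).2 (hm1 p hp).2.2.2).symm
      · rcases hp with hp | hp
        · have h := hm3 p hp
          exact coprime_Q PW hPW p h.1 (by omega) h.2.2.2
        · have h := hm1 p hp
          refine coprime_Q PW hPW p h.1 (by omega) ?_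
          intro h'
          have := (hPW p h').2
          omega)
    (by
      intro p hp
      simp only [if_true, Bool.false_eq_true, if_false, Finset.mem_union] at hp
      rcases hp with hp | hp
      · have h := hm3 p hp
        have := dens_bad3 a b p h.1 h.2.1 i0 (ha p hp i0)
        refine this.congr ?_ ?_
        · intro u v; unfold badp; rw [if_pos h.2.1]
        · simp only [hg]; rw [if_pos h.2.1]
      · have h := hm1 p hp
        have h3 : ¬ p % 4 = 3 := by omega
        refine (dens_bad1 p h.1 (ii p)).congr ?_ ?_
        · intro u v; unfold badp; rw [if_neg h3]
        · simp only [hg]; rw [if_neg h3])).2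
  simp only [if_true, Bool.false_eq_true, if_false] at key
  have hprod : δ0 * ∏ p ∈ (PM 3 L3 \ PW) ∪ (PM 1 (k * L3) \ A1 a0), (1 - g p) =
      2 / ((a0 * Q : ℕ) : ℝ) * ((∏ p ∈ PM 3 L3 \ PW, (1 - (omg a b p : ℝ) / p)) *
      ((∏ p ∈ PM 3 L3, (1 + 1 / (p : ℝ))) * ∏ p ∈ PM 1 (k * L3), (1 - 1 / (p : ℝ)))) := by
    rw [Finset.prod_union hdisj]
    have e1 : ∏ p ∈ PM 3 L3 \ PW, (1 - g p) =
        (∏ p ∈ PM 3 L3 \ PW, (1 - (omg a b p : ℝ) / p)) * ∏ p ∈ PM 3 L3 \ PW, (1 + 1 / (p : ℝ)) := by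
      rw [← Finset.prod_mul_distrib]
      apply Finset.prod_congr rfl
      intro p hp
      simp only [hg]; rw [if_pos (hm3 p hp).2.1]; ring
    have e2 : ∏ p ∈ PM 1 (k * L3) \ A1 a0, (1 - g p) = ∏ p ∈ PM 1 (k * L3) \ A1 a0, (1 - 1 / (p : ℝ)) := by
      apply Finset.prod_congr rfl
      intro p hp
      have h := hm1 p hp
      simp only [hg]; rw [if_neg (by omega)]
    rw [e1, e2, ← Finset.prod_sdiff hPWs, ← Finset.prod_sdiff hA1, hδ0]
    ring
  set VE := (∏ p ∈ PM 3 L3 \ PW, (1 - (omg a b p : ℝ) / p)) *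
      ((∏ p ∈ PM 3 L3, (1 + 1 / (p : ℝ))) * ∏ p ∈ PM 1 (k * L3), (1 - 1 / (p : ℝ))) with hVEdef
  set V' := ∏ p ∈ (PM 3 L3 \ PW) ∪ (PM 1 (k * L3) \ A1 a0), (1 - g p) with hV'
  set E := exp (480 * (k * L3)) with hE
  have hE0 : 0 < E := exp_pos _
  have hVE0 : 0 < VE := lt_of_lt_of_le (by positivity) hVE
  have haR1 : (1 : ℝ) ≤ a0 := by exact_mod_cast ha0n
  have hQR1 : (1 : ℝ) ≤ Q := by exact_mod_cast hQ0
  have hb0R : (0 : ℝ) < b i0 := by exact_mod_cast hb0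
  have hay : (a0 : ℝ) ≤ y := (le_mul_of_one_le_right (by linarith) hQR1).trans hQy
  have hx0 : 0 < x := by rw [hx]; positivity
  have hYx : a0 * x ≤ Y := by rw [hY]; linarith
  have hY0 : 0 < Y := lt_of_lt_of_le (mul_pos (by linarith) hx0) hYx
  have hYu : Y ≤ (2 * y ^ 11) ^ 2 := by
    have h1 : Y ≤ 2 * (a0 * x) := by
      have := le_mul_of_one_le_left hx0.le haR1
      rw [hY]; linarith
    have h2 : a0 * x ≤ y * y ^ 20 := by rw [hx]; gcongr
    have h3 : y * y ^ 20 ≤ y ^ 22 := by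
      have : y ^ 22 = y * (y * y ^ 20) := by ring
      rw [this]
      exact le_mul_of_one_le_left (by positivity) (by linarith)
    have h4 : (2 * y ^ 11) ^ 2 = 4 * y ^ 22 := by ring
    have : 0 < y ^ 22 := by positivity
    linarith
  have hsu : √Y ≤ 2 * y ^ 11 := Real.sqrt_le_iff.2 ⟨by positivity, hYu⟩
  have hsl : 110 ≤ √Y := by
    apply Real.le_sqrt_of_sq_le
    have h1 : y ^ 2 ≤ y ^ 20 := pow_le_pow_right₀ (by linarith) (by norm_num)
    have h2 : (1000 : ℝ) ^ 2 ≤ y ^ 2 := by gcongr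
    have h3 := le_mul_of_one_le_left hx0.le haR1
    linarith
  have hH1 : √Y / 11 ≤ H := by
    have := Nat.lt_floor_add_one (√Y / 10)
    rw [← hH] at this
    linarith
  have hH2 : (H : ℝ) ≤ y ^ 11 := by
    have := Nat.floor_le (show 0 ≤ √Y / 10 by positivity)
    rw [← hH] at this
    have : 0 < y ^ 11 := by positivity
    linarith
  have hHH : a0 * x / 121 ≤ (H : ℝ) * H := by
    have h1 : √Y / 11 * (√Y / 11) ≤ (H : ℝ) * H := by gcongr
    have h2 := Real.mul_self_sqrt hY0.le
    have e : √Y / 11 * (√Y / 11) = (√Y * √Y) / 121 := by ring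
    rw [e, h2] at h1
    linarith
  have hmain : x / Q / 121 * VE ≤ (δ0 * H * H) / 2 * V' := by
    have e : (δ0 * H * H) / 2 * V' = (H * H) / 2 * (δ0 * V') := by ring
    rw [e, hprod]
    calc x / Q / 121 * VE = (a0 * x / 121) / 2 * (2 / ((a0 * Q : ℕ) : ℝ) * VE) := by
          push_cast; field_simp
      _ ≤ _ := by gcongr
  have hMy : ((a0 * Q : ℕ) : ℝ) ≤ y := by push_cast; exact hQy
  have herr : (1 + 2 * (J : ℝ)) * (((H + H) * (((a0 * Q : ℕ) : ℝ) * E) + (((a0 * Q : ℕ) : ℝ) * E) ^ 2) * E) ≤ 3 * y ^ 15 := by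
    calc _ ≤ y * (((y ^ 11 + y ^ 11) * (y * y) + (y * y) ^ 2) * y) := by gcongr
      _ = 2 * y ^ 15 + y ^ 6 := by ring
      _ ≤ 2 * y ^ 15 + y ^ 15 := by
        have : y ^ 6 ≤ y ^ 15 := pow_le_pow_right₀ (by linarith) (by norm_num)
        gcongr
      _ = _ := by ring
  have hbig : 1000 * (3 * y ^ 15) ≤ x / Q * VE := by
    have h1 : y ^ 19 ≤ x / Q := by
      rw [le_div_iff₀ (by linarith), hx]
      calc y ^ 19 * Q ≤ y ^ 19 * y := by
            gcongr
            exact (le_mul_of_one_le_left (by linarith) haR1).trans hQy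
        _ = _ := by ring
    calc 1000 * (3 * y ^ 15) ≤ y * (y * y ^ 15) := by
            have : 0 < y ^ 15 := by positivity
            gcongr
            linarith
      _ = y ^ 19 * (1 / y ^ 2) := by field_simp
      _ ≤ x / Q * VE := by gcongr
  have hfin : x / Q / 250 * VE ≤ (δ0 * H * H) / 2 * V' -
      (1 + 2 * (J : ℝ)) * (((H + H) * (((a0 * Q : ℕ) : ℝ) * E) + (((a0 * Q : ℕ) : ℝ) * E) ^ 2) * E) := by
    have h1 : x / Q / 121 * VE = (x / Q * VE) / 121 := by ring
    have h2 : x / Q / 250 * VE = (x / Q * VE) / 250 := by ring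
    have : 0 < y ^ 15 := by positivity
    linarith
  refine hfin.trans ?_
  convert key using 1

end Low

section Map
open Finset Real
open scoped Classical

lemma S_to_N {k : ℕ} (a b : Fin k → ℤ) (i0 : Fin k) (ii : ℕ → ℤ)
    (hi : ∀ p : ℕ, p.Prime → p % 4 = 1 → (p : ℤ) ∣ ii p ^ 2 + 1) (PW : Finset ℕ) (n0 : ℤ)
    (L3 x : ℝ) (ha0 : 0 < a i0) (hb0 : 0 < b i0) (hbx : (b i0 : ℝ) < x) (hx : 1000 ≤ x) (t : ℕ)
    (ht : 2 * (a i0 * x + b i0) < exp (k * L3) ^ (t + 1)) :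
    (Sset a b i0 ii PW n0 L3 (a i0 * x + b i0)).card ≤ 4 * 2 ^ t *
      ((Nset x a b (4 * ∏ p ∈ PW, p) n0 (PM 3 L3 \ PW)).filter
        (fun n => IsSumTwoSquaresZ (a i0 * n + b i0))).card := by
  obtain ⟨a0, ha0'⟩ : ∃ a0 : ℕ, (a0 : ℤ) = a i0 := ⟨(a i0).toNat, Int.toNat_of_nonneg ha0.le⟩
  have htn : (a i0).toNat = a0 := by rw [← ha0']; simp
  have ha0n : 0 < a0 := by zify; rw [ha0']; exact ha0
  have haR1 : (1 : ℝ) ≤ a i0 := by exact_mod_cast ha0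
  have hb0R : (0 : ℝ) < b i0 := by exact_mod_cast hb0
  set Y : ℝ := a i0 * x + b i0 with hY
  have hax : x ≤ a i0 * x := le_mul_of_one_le_left (by linarith) haR1
  have hY0 : 1000 ≤ Y := by rw [hY]; linarith
  have hss := Real.mul_self_sqrt (show 0 ≤ Y by linarith)
  have hs31 : 31 ≤ √Y := by
    apply Real.le_sqrt_of_sq_le; linarith
  set Q : ℕ := 4 * ∏ p ∈ PW, p with hQ
  set S := Sset a b i0 ii PW n0 L3 Y with hS
  set f : ℤ × ℤ → ℤ := fun z => (z.1 ^ 2 + z.2 ^ 2 - b i0) / a i0 with hf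
  -- basic facts
  have hfact : ∀ z ∈ S, a i0 * f z + b i0 = z.1 ^ 2 + z.2 ^ 2 ∧ (Q : ℤ) ∣ f z - n0 ∧
      Y ≤ ((z.1 ^ 2 + z.2 ^ 2 : ℤ) : ℝ) ∧ ((z.1 ^ 2 + z.2 ^ 2 : ℤ) : ℝ) ≤ 1.4 * Y := by
    intro z hz
    rw [hS, Sset, Finset.mem_filter, Finset.mem_product, Finset.mem_Ico, Finset.mem_Ico, htn] at hz
    obtain ⟨⟨⟨hu1, hu2⟩, hv1, hv2⟩, ⟨hd, _⟩, _⟩ := hz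
    obtain ⟨c, hc⟩ := hd
    have e : z.1 ^ 2 + z.2 ^ 2 - b i0 = a i0 * (n0 + Q * c) := by
      push_cast at hc
      rw [ha0'] at hc
      rw [hQ]; push_cast
      linear_combination hc
    have hfz : f z = n0 + Q * c := by
      simp only [hf]; rw [e, Int.mul_ediv_cancel_left _ ha0.ne']
    refine ⟨by rw [hfz]; linear_combination -e, ⟨c, by rw [hfz]; ring⟩, ?_, ?_⟩
    · have h1 : √Y ≤ z.1 := Int.ceil_le.1 hu1
      push_cast
      nlinarith [sq_nonneg (z.2 : ℝ)]
    · have h2 : (⌊√Y / 10⌋₊ : ℝ) ≤ √Y / 10 := Nat.floor_le (by positivity)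
      have h3 : (⌈√Y⌉ : ℝ) < √Y + 1 := Int.ceil_lt_add_one _
      have h4 : (z.1 : ℝ) + 1 ≤ ⌈√Y⌉ + (⌊√Y / 10⌋₊ : ℝ) := by exact_mod_cast Int.add_one_le_iff.2 hu2
      have h5 : (z.2 : ℝ) ≤ (⌊√Y / 10⌋₊ : ℝ) := by
        have := hv2.le
        rw [zero_add] at this
        exact_mod_cast this
      have h6 : √Y ≤ z.1 := Int.ceil_le.1 hu1
      have h7 : (0 : ℝ) ≤ z.2 := by exact_mod_cast hv1
      have h8 : (z.1 : ℝ) ^ 2 ≤ (1.1 * √Y) ^ 2 := by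
        apply pow_le_pow_left₀ <;> linarith
      have h9 : (z.2 : ℝ) ^ 2 ≤ (√Y / 10) ^ 2 := by
        apply pow_le_pow_left₀ <;> linarith
      push_cast
      nlinarith
  have hrep : ∀ z ∈ S, ∀ p : ℕ, p.Prime → p % 4 = 1 → (p : ℝ) ≤ exp (k * L3) → ¬ (p : ℤ) ∣ z.1 + ii p * z.2 := by
    intro z hz p hp hp1 hpV
    rw [hS, Sset, Finset.mem_filter, htn] at hz
    obtain ⟨_, ⟨_, hA⟩, hB⟩ := hz
    by_cases hpA : p ∈ A1 a0
    · exact hA p hpA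
    · have hp0 : (0 : ℝ) < p := by exact_mod_cast hp.pos
      have : p ∈ PM 1 (k * L3) := by
        rw [mem_PM]
        exact ⟨hp, hp1, (Real.log_le_iff_le_exp hp0).2 hpV⟩
      have := hB p (Finset.mem_union_right _ (Finset.mem_sdiff.2 ⟨this, hpA⟩))
      unfold badp at this
      rwa [if_neg (by omega)] at this
  have himg : S.image f ⊆ (Nset x a b Q n0 (PM 3 L3 \ PW)).filter
        (fun n => IsSumTwoSquaresZ (a i0 * n + b i0)) := by
    intro n hn
    obtain ⟨z, hz, rfl⟩ := Finset.mem_image.1 hn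
    obtain ⟨h1, h2, h3, h4⟩ := hfact z hz
    have h1R : (a i0 : ℝ) * (f z : ℝ) + b i0 = ((z.1 ^ 2 + z.2 ^ 2 : ℤ) : ℝ) := by exact_mod_cast congrArg (Int.cast : ℤ → ℝ) h1
    rw [Finset.mem_filter, Nset, Finset.mem_filter, Finset.mem_Ico]
    refine ⟨⟨⟨?_, ?_⟩, h2, ?_⟩, ?_, z.1, z.2, h1⟩
    · rw [Int.ceil_le]
      have : (a i0 : ℝ) * x ≤ a i0 * f z := by linarith
      exact le_of_mul_le_mul_left this (by linarith)
    · have h5 : (a i0 : ℝ) * f z ≤ a i0 * (1.8 * x) := by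
        have : (a i0 : ℝ) * (1.8 * x) = 1.8 * (a i0 * x) := by ring
        rw [this]
        linarith
      have h6 := le_of_mul_le_mul_left h5 (by linarith)
      have h7 := Nat.lt_floor_add_one x
      have h8 := Int.le_ceil x
      have h9 : (f z : ℝ) < ⌈x⌉ + (⌊x⌋₊ : ℝ) := by linarith
      exact_mod_cast h9
    · intro p hp hd
      have hz' := hz
      rw [hS, Sset, Finset.mem_filter] at hz'
      have := hz'.2.2 p (Finset.mem_union_left _ hp)
      rw [Finset.mem_sdiff, mem_PM] at hp
      unfold badp at this
      rw [if_pos hp.1.2.1] at this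
      apply this
      refine ⟨(f z : ZMod p), ?_, ?_⟩
      · rw [mem_rootsMod]
        rw [← ZMod.intCast_zmod_eq_zero_iff_dvd] at hd
        push_cast at hd
        exact hd
      · have := congrArg (Int.cast : ℤ → ZMod p) h1
        push_cast at this
        exact this
    · rw [h1]
      have : (0 : ℝ) < ((z.1 ^ 2 + z.2 ^ 2 : ℤ) : ℝ) := by linarith
      exact_mod_cast this
  have hfib : ∀ n ∈ S.image f, (S.filter (fun z => f z = n)).card ≤ 4 * 2 ^ t := by
    intro n hn
    obtain ⟨z0, hz0, hz0n⟩ := Finset.mem_image.1 hn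
    obtain ⟨h1, _, h3, h4⟩ := hfact z0 hz0
    rw [hz0n] at h1
    obtain ⟨m, hm⟩ : ∃ m : ℕ, (m : ℤ) = a i0 * n + b i0 := by
      refine ⟨(a i0 * n + b i0).toNat, Int.toNat_of_nonneg ?_⟩
      rw [h1]; positivity
    have hmR : (m : ℝ) = ((z0.1 ^ 2 + z0.2 ^ 2 : ℤ) : ℝ) := by
      rw [← h1, ← hm]; simp
    obtain ⟨F, hF1, hF2⟩ := rep_bound ii hi (exp (k * L3)) (exp_pos _) m
      (by have : (0 : ℝ) < m := by rw [hmR]; linarith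
          exact_mod_cast this) t (by rw [hmR]; linarith)
    refine (Finset.card_le_card ?_).trans hF2
    intro z hz
    rw [Finset.mem_filter] at hz
    refine hF1 z ⟨?_, hrep z hz.1⟩
    rw [hm, ← (hfact z hz.1).1, hz.2]
  calc S.card ≤ 4 * 2 ^ t * (S.image f).card := Finset.card_le_mul_card_image S _ hfib
    _ ≤ _ := Nat.mul_le_mul_left _ (Finset.card_le_card himg)

end Map

section Fin
open Finset Real
open scoped Classical

lemma exists_ii : ∃ ii : ℕ → ℤ, ∀ p : ℕ, p.Prime → p % 4 = 1 → (p : ℤ) ∣ ii p ^ 2 + 1 := by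
  have : ∀ p : ℕ, ∃ i : ℤ, p.Prime → p % 4 = 1 → (p : ℤ) ∣ i ^ 2 + 1 := by
    intro p
    by_cases h : p.Prime ∧ p % 4 = 1
    · have : Fact p.Prime := ⟨h.1⟩
      obtain ⟨r, hr⟩ := ZMod.exists_sq_eq_neg_one_iff.2 (show p % 4 ≠ 3 by omega)
      refine ⟨(r.val : ℤ), fun _ _ => ?_⟩
      rw [← ZMod.intCast_zmod_eq_zero_iff_dvd]
      push_cast
      rw [ZMod.natCast_zmod_val, sq, ← hr]; ring
    · exact ⟨0, fun h1 h2 => absurd ⟨h1, h2⟩ h⟩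
  choose f hf using this
  exact ⟨f, hf⟩

lemma pw (c τ : ℝ) (hc : c ≤ τ) (h1 : 1 ≤ τ) (m n : ℕ) (h : m < n) : c * τ ^ m ≤ τ ^ n := by
  calc c * τ ^ m ≤ τ * τ ^ m := by gcongr
    _ = τ ^ (m + 1) := by ring
    _ ≤ τ ^ n := pow_le_pow_right₀ h1 h

lemma Q_le (w : ℝ) (hw : 0 < w) : ((4 * ∏ p ∈ PM 3 (log w), p : ℕ) : ℝ) ≤ exp (2 + 2 * w) := by
  have h1 : ∏ p ∈ PM 3 (log w), p ≤ primorial ⌊w⌋₊ := by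
    unfold primorial
    apply Finset.prod_le_prod_of_subset_of_one_le'
    · intro p hp
      rw [mem_PM] at hp
      have hp0 : (0 : ℝ) < p := by exact_mod_cast hp.1.pos
      have : (p : ℝ) ≤ w := (Real.log_le_log_iff hp0 hw).1 hp.2.2
      have := Nat.le_floor this
      simp only [Finset.mem_filter, Finset.mem_range]
      exact ⟨by omega, hp.1⟩
    · intro p hp _
      exact (Finset.mem_filter.1 hp).2.one_le
  have h2 := primorial_le_four_pow ⌊w⌋₊
  have h3 : ((∏ p ∈ PM 3 (log w), p : ℕ) : ℝ) ≤ 4 ^ ⌊w⌋₊ := by exact_mod_cast h1.trans h2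
  have h4 : (4 : ℝ) ≤ exp 2 := by
    have := Real.exp_one_gt_d9
    have e : exp 2 = exp 1 * exp 1 := by rw [← exp_add]; norm_num
    rw [e]; nlinarith
  have h5 : (4 : ℝ) ^ ⌊w⌋₊ ≤ exp (2 * w) := by
    calc (4 : ℝ) ^ ⌊w⌋₊ ≤ (exp 2) ^ ⌊w⌋₊ := by gcongr
      _ = exp (2 * ⌊w⌋₊) := by rw [← exp_nat_mul, mul_comm]
      _ ≤ _ := by
        apply exp_le_exp.2
        have := Nat.floor_le hw.le
        linarith
  rw [Nat.cast_mul, exp_add]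
  have h6 : ((4 : ℕ) : ℝ) ≤ exp 2 := by exact_mod_cast h4
  have h7 := h3.trans h5
  gcongr

end Fin

section Core
open Finset Real
open scoped Classical

set_option maxHeartbeats 2000000 in
lemma core_tau (t : ℕ) (ht : t + 1 = 19200) (c0 c1 τ x : ℝ) (hc0 : 0 < c0) (hc1 : c1 = c0 / (3000 * 2 ^ t))
    (hτ : 1000000 ≤ τ) (hτ0 : 1 / c0 ≤ τ) (hτ1 : 1 / c1 ≤ τ) (hx : x = exp (τ ^ 30))
    (k : ℕ) (hk : 0 < k) (hkτ : (k : ℝ) ≤ τ ^ 6) (a b : Fin k → ℤ)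
    (hadm : ∀ p : ℕ, p.Prime → p % 4 = 3 → ∃ n : ℤ, Int.gcd (∏ i, (a i * n + b i)) (p : ℤ) = 1)
    (ha0 : ∀ i, 0 < a i) (haτ : ∀ i, (a i : ℝ) ≤ τ ^ 10) (hodd : ∀ i, Odd (a i))
    (hb0 : ∀ i, 0 < b i) (hbx : ∀ i, (b i : ℝ) < x)
    (hE : c0 / √k ≤ (∏ p ∈ PM 3 (τ ^ 30 / 9600 / k), (1 + 1 / (p : ℝ))) *
      ∏ p ∈ PM 1 (k * (τ ^ 30 / 9600 / k)), (1 - 1 / (p : ℝ))) :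
    ∃ G : Finset ℤ, (∀ n ∈ G, x ≤ (n : ℝ) ∧ (n : ℝ) ≤ 2 * x ∧
      √k / (8 / c1) ≤ ((Finset.univ.filter (fun i => IsSumTwoSquaresZ (a i * n + b i))).card : ℝ)) ∧
      x * exp (-τ ^ 15) ≤ (G.card : ℝ) := by
  have hτ1' : (1 : ℝ) ≤ τ := by linarith
  have hτpos : 0 < τ := by linarith
  have hk1 : (1 : ℝ) ≤ k := by exact_mod_cast hk
  have hkpos : (0 : ℝ) < k := by linarith
  have hc1pos : 0 < c1 := by rw [hc1]; positivity
  have hsk1 : 1 ≤ √(k : ℝ) := by rw [Real.one_le_sqrt]; exact hk1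
  have hskk : √(k : ℝ) ≤ k := by
    have := Real.mul_self_sqrt hkpos.le
    nlinarith
  have hskτ : √(k : ℝ) ≤ τ ^ 6 := hskk.trans hkτ
  have hlogτ : log τ ≤ τ := (Real.log_le_sub_one_of_pos hτpos).trans (by linarith)
  have hτexp : τ ≤ exp τ := (by linarith : τ ≤ τ + 1).trans (Real.add_one_le_exp τ)
  have hτpow : ∀ n : ℕ, τ ^ n ≤ exp (n * τ) := by
    intro n
    calc τ ^ n ≤ (exp τ) ^ n := by gcongr
      _ = exp (n * τ) := by rw [← exp_nat_mul]
  set L3 : ℝ := τ ^ 30 / 9600 / k with hL3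
  have hkL3 : k * L3 = τ ^ 30 / 9600 := by rw [hL3]; field_simp
  have hL3low : τ ^ 24 / 9600 ≤ L3 := by
    rw [hL3, le_div_iff₀ hkpos]
    calc τ ^ 24 / 9600 * k ≤ τ ^ 24 / 9600 * τ ^ 6 := by gcongr
      _ = _ := by ring
  have hL3pos : 0 < L3 := lt_of_lt_of_le (by positivity) hL3low
  have hlw : log (τ ^ 12) ≤ L3 := by
    refine le_trans ?_ hL3low
    rw [Real.log_pow]
    have := pw 115200 τ (by linarith) hτ1' 1 24 (by norm_num)
    rw [pow_one] at this
    push_cast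
    linarith
  set PW := PM 3 (log (τ ^ 12)) with hPWdef
  have hPW : ∀ p ∈ PW, p.Prime ∧ p % 4 = 3 := by
    intro p hp; rw [hPWdef, mem_PM] at hp; exact ⟨hp.1, hp.2.1⟩
  have hPWs : PW ⊆ PM 3 L3 := by
    intro p hp
    rw [hPWdef, mem_PM] at hp
    rw [mem_PM]
    exact ⟨hp.1, hp.2.1, hp.2.2.trans hlw⟩
  have hw0 : (0 : ℝ) < τ ^ 12 := by positivity
  have hP3 : ∀ p ∈ PM 3 L3 \ PW, p.Prime ∧ p % 4 = 3 ∧ log p ≤ L3 ∧ p ∉ PW ∧ τ ^ 12 < (p : ℝ) := by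
    intro p hp
    rw [Finset.mem_sdiff, mem_PM] at hp
    refine ⟨hp.1.1, hp.1.2.1, hp.1.2.2, hp.2, ?_⟩
    by_contra hcon
    push Not at hcon
    apply hp.2
    rw [hPWdef, mem_PM]
    have hp0 : (0 : ℝ) < p := by exact_mod_cast hp.1.1.pos
    exact ⟨hp.1.1, hp.1.2.1, Real.log_le_log hp0 hcon⟩
  have h2k : ∀ p ∈ PM 3 L3 \ PW, 2 * k ≤ p := by
    intro p hp
    have h1 := (hP3 p hp).2.2.2.2
    have h2 := pw 2 τ (by linarith) hτ1' 6 12 (by norm_num)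
    have : (2 : ℝ) * k ≤ p := by linarith
    exact_mod_cast this
  have ha : ∀ p ∈ PM 3 L3 \ PW, ∀ i, ¬ (p : ℤ) ∣ a i := by
    intro p hp i hd
    have h1 := (hP3 p hp).2.2.2.2
    have h2 := pw 1 τ (by linarith) hτ1' 10 12 (by norm_num)
    have h3 : (p : ℤ) ≤ a i := Int.le_of_dvd (ha0 i) hd
    have h4 : (p : ℝ) ≤ a i := by exact_mod_cast h3
    have := haτ i
    linarith
  set J : ℕ := ⌈60 * τ⌉₊ with hJdef
  have hJle : (J : ℝ) ≤ 61 * τ := by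
    have := Nat.ceil_lt_add_one (show 0 ≤ 60 * τ by positivity)
    rw [← hJdef] at this
    linarith
  have hJge : 60 * τ ≤ J := Nat.le_ceil _
  have hl2 : (0.69 : ℝ) ≤ log 2 := by have := Real.log_two_gt_d9; linarith
  have hJ : k * L3 < 2 ^ J * log 2 := by
    rw [hkL3]
    have h1 : τ ^ 30 ≤ 2 ^ J := by
      calc τ ^ 30 ≤ exp ((30 : ℕ) * τ) := hτpow 30
        _ ≤ exp (log 2 * J) := by
          apply exp_le_exp.2
          push_cast
          nlinarith
        _ = 2 ^ J := by rw [mul_comm, exp_nat_mul, Real.exp_log (by norm_num)]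
    have : (0 : ℝ) < 2 ^ J := by positivity
    nlinarith
  set y : ℝ := exp (τ ^ 30 / 20) with hy
  have hxy : x = y ^ 20 := by
    rw [hx, hy, ← exp_nat_mul]; congr 1; push_cast; ring
  have hτ30 : (1000000 : ℝ) ^ 30 ≤ τ ^ 30 := by gcongr
  have hyW : exp (480 * (k * L3)) ≤ y := by
    rw [hkL3, hy]; apply exp_le_exp.2; linarith
  have hylow : τ ^ 30 / 20 ≤ y := (by linarith : τ ^ 30 / 20 ≤ τ ^ 30 / 20 + 1).trans (Real.add_one_le_exp _)
  have hy1000 : 1000 ≤ y := by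
    refine le_trans ?_ hylow
    have := pw 1000000 τ hτ hτ1' 1 30 (by norm_num)
    nlinarith
  have hypos : 0 < y := by linarith
  set Q : ℕ := 4 * ∏ p ∈ PW, p with hQ
  have hQ0 : 0 < Q := by
    apply Nat.mul_pos (by norm_num)
    exact Finset.prod_pos (fun p hp => (hPW p hp).1.pos)
  have hQR : (1 : ℝ) ≤ Q := by exact_mod_cast hQ0
  have hQexp : (Q : ℝ) ≤ exp (2 + 2 * τ ^ 12) := Q_le _ hw0
  have haQ : ∀ i, (a i : ℝ) * Q ≤ y := by
    intro i
    have h0 : (0 : ℝ) < a i := by exact_mod_cast ha0 i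
    calc (a i : ℝ) * Q ≤ exp ((10 : ℕ) * τ) * exp (2 + 2 * τ ^ 12) := by
          gcongr
          exact (haτ i).trans (hτpow 10)
      _ = exp ((10 : ℕ) * τ + (2 + 2 * τ ^ 12)) := by rw [← exp_add]
      _ ≤ y := by
        rw [hy]; apply exp_le_exp.2
        have h1 := pw 1000 τ (by linarith) hτ1' 1 30 (by norm_num)
        have h2 := pw 1000 τ (by linarith) hτ1' 12 30 (by norm_num)
        rw [pow_one] at h1
        push_cast
        linarith
  have hQy : (Q : ℝ) ≤ y := by
    have h1 : (1 : ℝ) ≤ a ⟨0, hk⟩ := by exact_mod_cast ha0 ⟨0, hk⟩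
    have := haQ ⟨0, hk⟩
    nlinarith
  have hJy : (1 : ℝ) + 2 * J ≤ y := by
    refine le_trans ?_ hylow
    have h1 := pw 10000 τ (by linarith) hτ1' 1 30 (by norm_num)
    rw [pow_one] at h1
    linarith
  set V := ∏ p ∈ PM 3 L3 \ PW, (1 - (omg a b p : ℝ) / p) with hV
  have h12 : 12 * (k : ℝ) * J ≤ 732 * τ ^ 7 := by
    calc 12 * (k : ℝ) * J ≤ 12 * τ ^ 6 * (61 * τ) := by gcongr
      _ = _ := by ring
  have hVlow : exp (-(732 * τ ^ 7)) ≤ V := by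
    have h := V_lower J (PM 3 L3 \ PW) L3 k (fun p => (omg a b p : ℝ) / p) hL3pos
      (fun p hp => ⟨(hP3 p hp).1, (hP3 p hp).2.2.1⟩) (lt_of_le_of_lt (by nlinarith) hJ)
      (by
        intro p hp
        have hp0 : (0 : ℝ) < p := by exact_mod_cast (hP3 p hp).1.pos
        have h1 : (omg a b p : ℝ) ≤ k := by exact_mod_cast omg_le a b p (hP3 p hp).1 (ha p hp)
        have h2 : (2 : ℝ) * k ≤ p := by exact_mod_cast h2k p hp
        refine ⟨by positivity, ?_, by gcongr⟩
        rw [div_le_iff₀ hp0]; linarith)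
    refine le_trans ?_ h
    apply exp_le_exp.2
    linarith
  have hVpos : 0 < V := lt_of_lt_of_le (exp_pos _) hVlow
  have hVy : 1 / y ≤ V := by
    refine le_trans ?_ hVlow
    rw [hy, one_div, ← Real.exp_neg]
    apply exp_le_exp.2
    have h1 := pw 100000 τ (by linarith) hτ1' 7 30 (by norm_num)
    linarith
  set E := (∏ p ∈ PM 3 L3, (1 + 1 / (p : ℝ))) * ∏ p ∈ PM 1 (k * L3), (1 - 1 / (p : ℝ)) with hEdef
  have hEy : 1 / y ≤ E := by
    refine le_trans ?_ hE
    rw [div_le_div_iff₀ hypos (by linarith), one_mul]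
    have h1 : 1 ≤ c0 * τ := by
      rw [div_le_iff₀ hc0] at hτ0; linarith
    have h2 := pw 20 τ (by linarith) hτ1' 7 30 (by norm_num)
    calc √(k : ℝ) ≤ τ ^ 6 := hskτ
      _ ≤ (c0 * τ) * τ ^ 6 := le_mul_of_one_le_left (by positivity) h1
      _ = c0 * τ ^ 7 := by ring
      _ ≤ c0 * y := by gcongr; linarith
  have hVE : 1 / y ^ 2 ≤ V * E := by
    calc 1 / y ^ 2 = 1 / y * (1 / y) := by field_simp
      _ ≤ V * E := by gcongr
  obtain ⟨ii, hii⟩ := exists_ii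
  obtain ⟨n0, I, hIk, hI4, hIPW⟩ := choose_n0 a b hodd PW hPW hadm
  have hx1000 : 1000 ≤ x := by
    rw [hxy]
    exact hy1000.trans (le_self_pow₀ (by linarith) (by norm_num))
  have hxpos : 0 < x := by linarith
  have hN := N_upper hk a b Q n0 (PM 3 L3 \ PW) L3 x y J hQ0 hL3pos
    (fun p hp => ⟨(hP3 p hp).1, (hP3 p hp).2.2.1, h2k p hp,
      coprime_Q PW hPW p (hP3 p hp).1 (by have := (hP3 p hp).2.1; omega) (hP3 p hp).2.2.2.1⟩)
    ha hJ hxy (by linarith) hyW hQy hVy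
  rw [← hV] at hN
  have hlow : ∀ i ∈ I, c1 * (3 * (x / Q) * V) / √k ≤
      (((Nset x a b Q n0 (PM 3 L3 \ PW)).filter (fun n => IsSumTwoSquaresZ (a i * n + b i))).card : ℝ) := by
    intro i hi
    have hai : (0 : ℝ) < a i := by exact_mod_cast ha0 i
    have hpa : ∀ p : ℕ, p.Prime → p ∣ (a i).toNat → log p ≤ log (τ ^ 12) := by
      intro p hp hd
      have hp0 : (0 : ℝ) < p := by exact_mod_cast hp.pos
      apply Real.log_le_log hp0
      have h1 : p ≤ (a i).toNat := Nat.le_of_dvd (by have := ha0 i; omega) hd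
      have h2 : (p : ℤ) ≤ a i := by have := ha0 i; omega
      have h3 : (p : ℝ) ≤ a i := by exact_mod_cast h2
      have h4 := pw 1 τ (by linarith) hτ1' 10 12 (by norm_num)
      have := haτ i
      linarith
    have hS := S_lower hk a b i ii hii PW n0 L3 x y J hL3pos hPW hPWs h2k ha hJ (ha0 i) (hodd i)
      (by
        intro p hp hd h3
        rw [hPWdef, mem_PM]
        exact ⟨hp, h3, hpa p hp hd⟩)
      (by
        intro p hp
        rw [mem_A1 _ _ (by have := ha0 i; omega)] at hp
        rw [mem_PM]
        refine ⟨hp.1, hp.2.2, (hpa p hp.1 hp.2.1).trans (hlw.trans ?_)⟩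
        exact le_mul_of_one_le_left hL3pos.le hk1)
      (hb0 i) (hbx i) (hI4 i hi) (fun p hp => hIPW p hp i) hxy hy1000 hyW (haQ i) hJy hVE
    have hSN := S_to_N a b i ii hii PW n0 L3 x (ha0 i) (hb0 i) (hbx i) hx1000 t
      (by
        rw [hkL3, ← exp_nat_mul, ht]
        have e : ((19200 : ℕ) : ℝ) * (τ ^ 30 / 9600) = τ ^ 30 + τ ^ 30 := by push_cast; ring
        rw [e, exp_add, ← hx]
        have h1 : (a i : ℝ) ≤ y := (le_mul_of_one_le_right hai.le hQR).trans (haQ i)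
        have h2 : 4 * y < x := by
          have : y ^ 2 ≤ x := by rw [hxy]; exact pow_le_pow_right₀ (by linarith) (by norm_num)
          nlinarith
        have h3 := hbx i
        have h4 : (a i : ℝ) * x ≤ y * x := by gcongr
        nlinarith)
    have hSNR : ((Sset a b i ii PW n0 L3 (a i * x + b i)).card : ℝ) ≤ 4 * 2 ^ t *
      (((Nset x a b Q n0 (PM 3 L3 \ PW)).filter
        (fun n => IsSumTwoSquaresZ (a i * n + b i))).card : ℝ) := by exact_mod_cast hSN
    have h := hS.trans hSNR
    have h5 : x / Q / 250 * (V * (c0 / √k)) ≤ x / Q / 250 * (V * E) := by gcongr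
    have h6 := h5.trans h
    rw [mul_comm] at h6
    have h2t : (0 : ℝ) < 2 ^ t := by positivity
    have e : c1 * (3 * (x / Q) * V) / √k = (V * (c0 / √k) * (x / Q / 250)) / (4 * 2 ^ t) := by
      rw [hc1]; field_simp; norm_num
    rw [e, div_le_iff₀ (by positivity)]
    linarith
  have hcore := count_core hk (Nset x a b Q n0 (PM 3 L3 \ PW)) (fun i n => IsSumTwoSquaresZ (a i * n + b i)) I
    (3 * (x / Q) * V) c1 hc1pos hN hIk hlow
  refine ⟨_, ?_, le_trans ?_ hcore⟩
  · intro n hn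
    rw [Finset.mem_filter] at hn
    obtain ⟨hn1, hn2⟩ := hn
    rw [Nset, Finset.mem_filter, Finset.mem_Ico] at hn1
    obtain ⟨⟨h1, h2⟩, _⟩ := hn1
    refine ⟨Int.ceil_le.1 h1, ?_, hn2⟩
    have h3 : (n : ℝ) + 1 ≤ ⌈x⌉ + (⌊x⌋₊ : ℝ) := by exact_mod_cast Int.add_one_le_iff.2 h2
    have h4 := Nat.floor_le hxpos.le
    have h5 := Int.ceil_lt_add_one x
    linarith
  · have hfin : 8 * √k * Q ≤ 3 * c1 * V * exp (τ ^ 15) := by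
      have hc1τ : 1 ≤ c1 * τ := by
        rw [div_le_iff₀ hc1pos] at hτ1; linarith
      have hexp : exp ((10 : ℕ) * τ) * exp (2 + 2 * τ ^ 12) ≤ exp (-(732 * τ ^ 7)) * exp (τ ^ 15) := by
        rw [← exp_add, ← exp_add]
        apply exp_le_exp.2
        have h1 := pw 1000 τ (by linarith) hτ1' 1 15 (by norm_num)
        have h2 := pw 1000 τ (by linarith) hτ1' 12 15 (by norm_num)
        have h3 := pw 10000 τ (by linarith) hτ1' 7 15 (by norm_num)
        rw [pow_one] at h1
        push_cast
        linarith
      have h8 := pw 8 τ (by linarith) hτ1' 6 9 (by norm_num)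
      calc 8 * √k * Q ≤ 8 * τ ^ 6 * exp (2 + 2 * τ ^ 12) := by gcongr
        _ ≤ τ ^ 9 * exp (2 + 2 * τ ^ 12) := by gcongr
        _ ≤ (c1 * τ) * τ ^ 9 * exp (2 + 2 * τ ^ 12) := by
          gcongr
          exact le_mul_of_one_le_left (by positivity) hc1τ
        _ = c1 * (τ ^ 10 * exp (2 + 2 * τ ^ 12)) := by ring
        _ ≤ c1 * (exp ((10 : ℕ) * τ) * exp (2 + 2 * τ ^ 12)) := by
          gcongr
          exact hτpow 10
        _ ≤ c1 * (exp (-(732 * τ ^ 7)) * exp (τ ^ 15)) := by gcongr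
        _ ≤ c1 * (V * exp (τ ^ 15)) := by gcongr
        _ ≤ 3 * c1 * V * exp (τ ^ 15) := by
          have : 0 < c1 * (V * exp (τ ^ 15)) := by positivity
          linarith
    rw [exp_neg, ← div_eq_mul_inv, div_le_div_iff₀ (exp_pos _) (by positivity)]
    have hQp : (0 : ℝ) < Q := by linarith
    calc x * (8 * √k) = x / Q * (8 * √k * Q) := by field_simp
      _ ≤ x / Q * (3 * c1 * V * exp (τ ^ 15)) := by gcongr
      _ = _ := by ring

end Core

theorem many_sums_of_two_squares_among_admissible_linear_forms :
    ∃ C : ℝ, 0 < C ∧ ∃ c : ℝ, 0 < c ∧ ∃ x0 : ℝ, ∀ x : ℝ, x0 ≤ x →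
      ∀ k : ℕ, 0 < k → (k : ℝ) ≤ Real.log x ^ ((1 : ℝ) / 5) →
        ∃ p0 : ℕ, p0.Prime ∧ c * Real.log (Real.log x) ≤ (p0 : ℝ) ∧ (p0 : ℝ) ≤ x ∧
          ∀ a b : Fin k → ℤ,
            -- the linear functions `Lᵢ(n) = aᵢ n + bᵢ` are distinct
            Function.Injective (fun i => (a i, b i)) →
            -- `⟨P3⟩`-admissibility
            (∀ p : ℕ, p.Prime → p % 4 = 3 →
              ∃ n : ℤ, Int.gcd (∏ i, (a i * n + b i)) (p : ℤ) = 1) →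
            -- coefficient conditions
            (∀ i, 0 < a i ∧ (a i : ℝ) ≤ Real.log x ^ ((1 : ℝ) / 3) ∧
              Int.gcd (2 * (p0 : ℤ)) (a i) = 1 ∧ 0 < b i ∧ (b i : ℝ) < x) →
            x * Real.exp (-(Real.log x ^ ((1 : ℝ) / 2))) ≤
              (({n : ℤ | x ≤ (n : ℝ) ∧ (n : ℝ) ≤ 2 * x ∧
                (k : ℝ) ^ ((1 : ℝ) / 2) / C ≤
                  (Nat.card {i : Fin k // IsSumTwoSquaresZ (a i * n + b i)} : ℝ)}).ncard : ℝ) := by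
  obtain ⟨c0, hc0, L0, hL0, hEul⟩ := euler_ratio
  obtain ⟨t, ht⟩ : ∃ t : ℕ, t + 1 = 19200 := ⟨19199, rfl⟩
  obtain ⟨c1, hc1⟩ : ∃ c1 : ℝ, c1 = c0 / (3000 * 2 ^ t) := ⟨_, rfl⟩
  have hc1pos : 0 < c1 := by rw [hc1]; positivity
  obtain ⟨T, hT⟩ : ∃ T : ℝ, T = max (max 1000000 (9600 * L0)) (max (1 / c0) (1 / c1)) := ⟨_, rfl⟩
  have hT1 : 1000000 ≤ T := by rw [hT]; exact (le_max_left _ _).trans (le_max_left _ _)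
  have hT2 : 9600 * L0 ≤ T := by rw [hT]; exact (le_max_right _ _).trans (le_max_left _ _)
  have hT3 : 1 / c0 ≤ T := by rw [hT]; exact (le_max_left _ _).trans (le_max_right _ _)
  have hT4 : 1 / c1 ≤ T := by rw [hT]; exact (le_max_right _ _).trans (le_max_right _ _)
  refine ⟨8 / c1, by positivity, 1, one_pos, Real.exp (T ^ 30), ?_⟩
  intro x hx k hk hkx
  have hxpos : 0 < x := lt_of_lt_of_le (Real.exp_pos _) hx
  have hl : T ^ 30 ≤ Real.log x := (Real.le_log_iff_exp_le hxpos).2 hx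
  have hlpos : 0 < Real.log x := lt_of_lt_of_le (by positivity) hl
  obtain ⟨τ, hτ⟩ : ∃ τ : ℝ, τ = Real.log x ^ ((1 : ℝ) / 30) := ⟨_, rfl⟩
  have hτpow : ∀ n : ℕ, τ ^ n = Real.log x ^ ((n : ℝ) / 30) := by
    intro n
    rw [hτ, ← Real.rpow_natCast, ← Real.rpow_mul hlpos.le]
    congr 1; ring
  have hτ30 : τ ^ 30 = Real.log x := by
    rw [hτpow 30]; norm_num
  have hτ0 : 0 ≤ τ := by rw [hτ]; positivity
  have hτT : T ≤ τ := by
    rw [← hτ30] at hl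
    exact le_of_pow_le_pow_left₀ (by norm_num) hτ0 hl
  have hτ6 : Real.log x ^ ((1 : ℝ) / 5) = τ ^ 6 := by rw [hτpow 6]; norm_num
  have hτ10 : Real.log x ^ ((1 : ℝ) / 3) = τ ^ 10 := by rw [hτpow 10]; norm_num
  have hτ15 : Real.log x ^ ((1 : ℝ) / 2) = τ ^ 15 := by rw [hτpow 15]; norm_num
  have hxexp : x = Real.exp (τ ^ 30) := by rw [hτ30, Real.exp_log hxpos]
  have hτ1 : 1 ≤ τ := by linarith
  have hτ30' : τ ≤ τ ^ 30 := le_self_pow₀ hτ1 (by norm_num)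
  have hxbig : τ ^ 30 + 1 ≤ x := by rw [hxexp]; exact Real.add_one_le_exp _
  have hx2 : 2 ≤ x := by linarith
  -- the prime p0
  have hfl : 1 ≤ ⌊x / 2⌋₊ := (Nat.one_le_floor_iff _).2 (by linarith)
  obtain ⟨p0, hp0, hp1, hp2⟩ := Nat.exists_prime_lt_and_le_two_mul ⌊x / 2⌋₊ (by omega)
  refine ⟨p0, hp0, ?_, ?_, ?_⟩
  · have h1 : x / 2 < ⌊x / 2⌋₊ + 1 := Nat.lt_floor_add_one _
    have h2 : ((⌊x / 2⌋₊ : ℝ)) + 1 ≤ p0 := by exact_mod_cast hp1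
    have h3 : Real.log (Real.log x) ≤ Real.log x - 1 := Real.log_le_sub_one_of_pos hlpos
    have h4 : Real.log x ≤ x / 2 := by
      have h5 : Real.log (x / 2) ≤ x / 2 - 1 := Real.log_le_sub_one_of_pos (by positivity)
      rw [Real.log_div hxpos.ne' (by norm_num)] at h5
      have : Real.log 2 ≤ 1 := by have := Real.log_two_lt_d9; linarith
      linarith
    linarith
  · have h1 : (⌊x / 2⌋₊ : ℝ) ≤ x / 2 := Nat.floor_le (by positivity)
    have h2 : (p0 : ℝ) ≤ 2 * ⌊x / 2⌋₊ := by exact_mod_cast hp2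
    linarith
  intro a b _ hadm hab
  have hk1 : (1 : ℝ) ≤ k := by exact_mod_cast hk
  have hkpos : (0 : ℝ) < k := by linarith
  rw [hτ6] at hkx
  have hLk : L0 ≤ τ ^ 30 / 9600 / k := by
    rw [le_div_iff₀ hkpos]
    have h1 : L0 * k ≤ (τ / 9600) * τ ^ 6 := by
      apply mul_le_mul _ hkx hkpos.le (by positivity)
      linarith
    have h2 : τ ^ 7 ≤ τ ^ 30 := pow_le_pow_right₀ hτ1 (by norm_num)
    have h3 : (τ / 9600) * τ ^ 6 = τ ^ 7 / 9600 := by ring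
    linarith
  have hE := hEul k hk _ hLk
  rw [← Real.sqrt_eq_rpow] at hE
  obtain ⟨G, hG1, hG2⟩ := core_tau t ht c0 c1 τ x hc0 hc1 (by linarith) (by linarith) (by linarith) hxexp k hk hkx
    a b hadm (fun i => (hab i).1) (fun i => by rw [← hτ10]; exact (hab i).2.1)
    (fun i => by
      have h := (hab i).2.2.1
      rw [← Int.not_even_iff_odd, even_iff_two_dvd]
      intro hd
      have h2 : (2 : ℤ) ∣ Int.gcd (2 * (p0 : ℤ)) (a i) := Int.dvd_coe_gcd (dvd_mul_right _ _) hd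
      rw [h] at h2
      norm_num at h2)
    (fun i => (hab i).2.2.2.1) (fun i => (hab i).2.2.2.2) hE
  rw [hτ15]
  refine hG2.trans ?_
  have hfin : ({n : ℤ | x ≤ (n : ℝ) ∧ (n : ℝ) ≤ 2 * x ∧ (k : ℝ) ^ ((1 : ℝ) / 2) / (8 / c1) ≤
      (Nat.card {i : Fin k // IsSumTwoSquaresZ (a i * n + b i)} : ℝ)}).Finite := by
    apply (Set.finite_Icc ⌈x⌉ ⌊2 * x⌋).subset
    intro n hn
    exact ⟨Int.ceil_le.2 hn.1, Int.le_floor.2 hn.2.1⟩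
  have hsub : (G : Set ℤ) ⊆ {n : ℤ | x ≤ (n : ℝ) ∧ (n : ℝ) ≤ 2 * x ∧ (k : ℝ) ^ ((1 : ℝ) / 2) / (8 / c1) ≤
      (Nat.card {i : Fin k // IsSumTwoSquaresZ (a i * n + b i)} : ℝ)} := by
    intro n hn
    obtain ⟨h1, h2, h3⟩ := hG1 n hn
    refine ⟨h1, h2, ?_⟩
    rw [← Real.sqrt_eq_rpow]
    classical
    rw [Nat.card_eq_fintype_card, Fintype.card_subtype]
    convert h3 using 3
  have := Set.ncard_le_ncard hsub hfin
  rw [Set.ncard_coe_finset] at this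
  exact_mod_cast this
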